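/- arXiv:0810.1829 — 5 statements merged into one kernel-verified Lean document; each statement's English description precedes it below -/
import Mathlib

section
/- Assume p ≠ 0 and q ≠ 0. Then for every nonempty word W in the free monoid on {x, y}, ρ_0(W) = p^{|W|−d(W)−h(W)} · q^{d(W)−h(W)} · (αβ+pq)^{h(W)−1} · M, where the 2×2 matrix M is: [[αβ, βq],[αp, pq]] if W begins with x and ends with y; [[0, 0],[αp, pq]] if W begins with y and ends with y (including W = y); [[0, βq],[0, pq]] if W begins with x and ends with x (including W = x); and [[0, 0],[0, pq]] if W begins with y and ends with x. (Possibly negative exponents of p and q are interpreted as inverses in ℂ.) -/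
open scoped BigOperators

/-- A word in the free monoid on two letters `{x, y}`, encoded as a `List Bool`
with `false = x` and `true = y`. The monoid homomorphism determined by
`x ↦ A`, `y ↦ B` sends a word to the product of the images of its letters. -/
noncomputable def wordRep (A B : Matrix (Fin 2) (Fin 2) ℂ) (W : List Bool) : Matrix (Fin 2) (Fin 2) ℂ :=
  (W.map fun b => if b then B else A).prod

/-- `d(W)`: the number of occurrences of the letter `y` in `W`. -/
def wordDepth (W : List Bool) : ℕ := W.count true

/-- `h(W)`: the number of occurrences of the two-letter factor `yx` in `W`, plus one. -/
def wordHeight (W : List Bool) : ℕ := (W.zip W.tail).count (true, false) + 1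

/-- The scalar factor of `ρ₀(W)`. -/
noncomputable def wordCoeff (α β p q : ℂ) (W : List Bool) : ℂ :=
  p ^ ((W.length : ℤ) - wordDepth W - wordHeight W) *
    q ^ ((wordDepth W : ℤ) - wordHeight W) *
    (α * β + p * q) ^ ((wordHeight W : ℤ) - 1)

/-- The rank one matrix attached to the first letter `a` and the last letter `b` of a word. -/
def wordCore (α β p q : ℂ) (a b : Bool) : Matrix (Fin 2) (Fin 2) ℂ :=
  Matrix.vecMulVec ![if a then 0 else β, p] ![if b then α else 0, q]

/-- The factor by which `wordCoeff` changes when `a` is prepended to a word starting with `b`. -/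
noncomputable def transitionFactor (α β p q : ℂ) (a b : Bool) : ℂ :=
  if a then (if b then q else (α * β + p * q) * p⁻¹) else p

theorem wordCoeff_cons_cons (α β : ℂ) {p q : ℂ} (hp : p ≠ 0) (hq : q ≠ 0) (a b : Bool)
    (w : List Bool) :
    wordCoeff α β p q (a :: b :: w) =
      transitionFactor α β p q a b * wordCoeff α β p q (b :: w) := by
  have key (l d h k : ℤ) (n : ℕ) (r : ℂ) (e : ℕ) :
      p ^ (l + k) * q ^ (d + h) * r ^ (((n + e + 1 : ℕ) : ℤ) - 1) =
        p ^ k * q ^ h * r ^ e * (p ^ l * q ^ d * r ^ (((n + 1 : ℕ) : ℤ) - 1)) := by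
    rw [zpow_add₀ hp, zpow_add₀ hq]
    simp only [Nat.cast_add, Nat.cast_one, add_sub_cancel_right]
    rw [← Nat.cast_add, zpow_natCast, zpow_natCast, pow_add]
    ring
  set n := ((b :: w).zip w).count (true, false) with hn
  have hh : wordHeight (b :: w) = n + 1 := rfl
  have hh' : wordHeight (a :: b :: w) = n + (if a && !b then 1 else 0) + 1 := by
    cases a <;> cases b <;> simp [wordHeight, hn]
  have hd : wordDepth (a :: b :: w) = wordDepth (b :: w) + (if a then 1 else 0) := by
    cases a <;> simp [wordDepth]
  set e : ℕ := if a && !b then 1 else 0 with he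
  have := key (((b :: w).length : ℤ) - wordDepth (b :: w) - wordHeight (b :: w))
    ((wordDepth (b :: w) : ℤ) - wordHeight (b :: w))
    ((if a then 1 else 0) - e) (1 - (if a then 1 else 0) - e) n (α * β + p * q) e
  unfold wordCoeff
  rw [hh] at this
  rw [hh, hh', hd]
  convert this using 1
  · congr 3 <;> push_cast [List.length_cons] <;> ring
  · congr 1
    cases a <;> cases b <;> simp [he, transitionFactor, mul_comm]

theorem wordRep_cons (α β : ℂ) {p q : ℂ} (hp : p ≠ 0) (hq : q ≠ 0) (a : Bool) (w : List Bool) :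
    wordRep !![0, β; 0, p] !![0, 0; α, q] (a :: w) =
      wordCoeff α β p q (a :: w) •
        wordCore α β p q a ((a :: w).getLast (List.cons_ne_nil a w)) := by
  induction w generalizing a with
  | nil =>
    cases a <;> ext i j <;> fin_cases i <;> fin_cases j <;>
      simp [wordRep, wordCoeff, wordCore, wordDepth, wordHeight] <;>
      field_simp
  | cons b w ih =>
    have hmul : wordRep !![0, β; 0, p] !![0, 0; α, q] (a :: b :: w) =
        (if a then !![0, 0; α, q] else !![0, β; 0, p]) *
          wordRep !![0, β; 0, p] !![0, 0; α, q] (b :: w) := by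
      simp [wordRep]
    have hcore (c : Bool) :
        (if a then !![0, 0; α, q] else !![0, β; 0, p]) * wordCore α β p q b c =
          transitionFactor α β p q a b • wordCore α β p q a c := by
      cases a <;> cases b <;> ext i j <;> fin_cases i <;> fin_cases j <;>
        simp [wordCore, transitionFactor, Matrix.mul_apply] <;>
        field_simp
    rw [hmul, ih, Matrix.mul_smul, hcore, wordCoeff_cons_cons α β hp hq, smul_smul, mul_comm,
      List.getLast_cons (List.cons_ne_nil b w)]

/-- The image of a nonempty word `W` under the representation
`ρ₀(x) = [[0, β],[0, p]]`, `ρ₀(y) = [[0, 0],[α, q]]` equals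
`p^{|W|−d(W)−h(W)} q^{d(W)−h(W)} (αβ+pq)^{h(W)−1} M`, where `M` depends only on
the first and last letters of `W`. -/
theorem rho0_word_eval (α β p q : ℂ) (hp : p ≠ 0) (hq : q ≠ 0) (W : List Bool)
    (hW : W ≠ []) :
    (W.head? = some false → W.getLast? = some true →
      wordRep !![0, β; 0, p] !![0, 0; α, q] W =
        (p ^ ((W.length : ℤ) - wordDepth W - wordHeight W) *
          q ^ ((wordDepth W : ℤ) - wordHeight W) *
          (α * β + p * q) ^ ((wordHeight W : ℤ) - 1)) •
        !![α * β, β * q; α * p, p * q]) ∧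
    (W.head? = some true → W.getLast? = some true →
      wordRep !![0, β; 0, p] !![0, 0; α, q] W =
        (p ^ ((W.length : ℤ) - wordDepth W - wordHeight W) *
          q ^ ((wordDepth W : ℤ) - wordHeight W) *
          (α * β + p * q) ^ ((wordHeight W : ℤ) - 1)) •
        !![0, 0; α * p, p * q]) ∧
    (W.head? = some false → W.getLast? = some false →
      wordRep !![0, β; 0, p] !![0, 0; α, q] W =
        (p ^ ((W.length : ℤ) - wordDepth W - wordHeight W) *
          q ^ ((wordDepth W : ℤ) - wordHeight W) *
          (α * β + p * q) ^ ((wordHeight W : ℤ) - 1)) •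
        !![0, β * q; 0, p * q]) ∧
    (W.head? = some true → W.getLast? = some false →
      wordRep !![0, β; 0, p] !![0, 0; α, q] W =
        (p ^ ((W.length : ℤ) - wordDepth W - wordHeight W) *
          q ^ ((wordDepth W : ℤ) - wordHeight W) *
          (α * β + p * q) ^ ((wordHeight W : ℤ) - 1)) •
        !![0, 0; 0, p * q]) := by
  obtain ⟨a, w, rfl⟩ := List.exists_cons_of_ne_nil hW
  have key := wordRep_cons α β hp hq a w
  rw [List.getLast?_eq_getLast_of_ne_nil hW]
  refine ⟨?_, ?_, ?_, ?_⟩ <;> intro ha hb <;>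
    rw [List.head?_cons, Option.some_inj] at ha <;> rw [Option.some_inj] at hb <;>
    rw [hb] at key <;> subst ha <;> rw [key] <;> unfold wordCoeff <;> congr 1 <;>
    ext i j <;> fin_cases i <;> fin_cases j <;>
    simp [wordCore, Matrix.vecMulVec_apply, mul_comm]
end

section
/- (Ohno–Zagier relation.) Let k, l, m be nonnegative integers, not all zero. Then Ḡ_0(k+l+2m, l+m, m; 1) = Ḡ_0(k+l+2m, k+m, m; 1) = ∑_{i=0}^{k} ∑_{j=0}^{l} ∑_{μ=0}^{m} binom(i+j, i) · P_{k−i}(ζ̂) · P_{l−j}(ζ̂) · P_μ(−ζ̂) · P_{i+j+2m−μ}(−ζ̂) · N_{i+j, m−μ}. -/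
open scoped BigOperators

/-- Multiple zeta value `ζ(k_1,…,k_r) = ∑_{m_1 > ⋯ > m_r > 0} 1/(m_1^{k_1} ⋯ m_r^{k_r})`. -/
noncomputable def mzv (ks : List ℕ) : ℝ :=
  ∑' m : Fin ks.length → ℕ,
    if (∀ i, 0 < m i) ∧ (∀ i j, i < j → m j < m i) then
      1 / ∏ i, (m i : ℝ) ^ ks.get i
    else 0

/-- Index set for `G0`: tuples `(k_1,…,k_n)` of positive integers with
`k_1 + ⋯ + k_n = k`, `k_1 ≥ 2` and `#{i : k_i ≥ 2} = s`. -/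
def G0set (k n s : ℕ) : Finset (Fin n → ℕ) :=
  (Finset.Nat.antidiagonalTuple n k).filter fun c =>
    0 < n ∧ (∀ i, 0 < c i) ∧ (∀ i : Fin n, i.val = 0 → 2 ≤ c i) ∧
      (Finset.univ.filter fun i => 2 ≤ c i).card = s

/-- `G_0(k,n,s;1)`, the sum of the multiple zeta values over `G0set k n s`. -/
noncomputable def G0one (k n s : ℕ) : ℝ :=
  ∑ c ∈ G0set k n s, mzv (List.ofFn c)

/-- `Ḡ_0(k,n,s;1) = G_0(k,n,s;1) − G_0(k,n,s+1;1)`. -/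
noncomputable def Gbar0one (k n s : ℕ) : ℝ := G0one k n s - G0one k n (s + 1)

/-- Schur polynomial `P_n(a)` of a sequence `a` (indexed so that `a 1` is the first term). -/
noncomputable def SchurP (a : ℕ → ℂ) (n : ℕ) : ℂ :=
  ∑ c ∈ (Fintype.piFinset fun _ : Fin n => Finset.range (n + 1)).filter
      (fun c => ∑ j, (j.val + 1) * c j = n),
    ∏ j, a (j.val + 1) ^ c j / (Nat.factorial (c j))

/-- The sequence `ζ̂ = (0, ζ(2)/2, ζ(3)/3, …)`. -/
noncomputable def zhat (n : ℕ) : ℂ := if 2 ≤ n then riemannZeta n / n else 0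

open scoped ENNReal

/-- The multiple zeta value as an extended nonnegative real, with all summation indices
required to lie strictly below the bound `B`. -/
noncomputable def boundedMzv (ks : List ℕ) (B : ℕ∞) : ℝ≥0∞ :=
  ∑' m : Fin ks.length → ℕ,
    if (∀ i, 0 < m i) ∧ (∀ i j, i < j → m j < m i) ∧ (∀ i, (m i : ℕ∞) < B) then
      ENNReal.ofReal (1 / ∏ i, (m i : ℝ) ^ ks.get i)
    else 0

lemma mzv_eq_toReal (ks : List ℕ) : mzv ks = (boundedMzv ks ⊤).toReal := by
  unfold mzv boundedMzv
  rw [ENNReal.tsum_toReal_eq]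
  · refine tsum_congr fun m => ?_
    simp only [ENat.natCast_lt_top, implies_true, and_true]
    split_ifs
    · rw [ENNReal.toReal_ofReal (by positivity)]
    · simp
  · intro m
    split_ifs <;> simp

lemma boundedMzv_nil (B : ℕ∞) : boundedMzv [] B = 1 := by
  unfold boundedMzv
  rw [tsum_eq_single default]
  · simp
  · intro b hb
    exact absurd (Subsingleton.elim (α := Fin 0 → ℕ) b default) hb

lemma boundedMzv_cons (k : ℕ) (ks : List ℕ) (B : ℕ∞) :
    boundedMzv (k :: ks) B =
      ∑' m : ℕ, if 0 < m ∧ (m : ℕ∞) < B then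
        ENNReal.ofReal (1 / (m : ℝ) ^ k) * boundedMzv ks m else 0 := by
  unfold boundedMzv
  refine ((Fin.consEquiv (n := ks.length) (fun _ => ℕ)).tsum_eq _).symm.trans ?_
  rw [ENNReal.summable.tsum_prod' fun _ => ENNReal.summable]
  refine tsum_congr fun a => ?_
  split_ifs with ha
  · rw [← ENNReal.tsum_mul_left]
    refine tsum_congr fun b => ?_
    simp only [List.length_cons, Fin.consEquiv_apply, Fin.forall_fin_succ, Fin.cons_zero,
      Fin.cons_succ, Fin.prod_univ_succ]
    have hiff : (0 < a ∧ ∀ i, 0 < b i) ∧ ((((0 : Fin (ks.length + 1)) < 0 → a < a) ∧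
        ∀ i : Fin ks.length, 0 < i.succ → b i < a) ∧ (∀ i : Fin ks.length, (i.succ < 0 → a < b i) ∧
        ∀ j : Fin ks.length, i.succ < j.succ → b j < b i)) ∧ ((a : ℕ∞) < B ∧ ∀ i, (b i : ℕ∞) < B) ↔
        (∀ i, 0 < b i) ∧ (∀ i j, i < j → b j < b i) ∧ ∀ i, ((b i : ℕ) : ℕ∞) < (a : ℕ∞) := by
      constructor
      · rintro ⟨⟨-, h1⟩, ⟨⟨-, h2⟩, h3⟩, -⟩
        exact ⟨h1, fun i j hij => (h3 i).2 j (Fin.succ_lt_succ_iff.2 hij),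
          fun i => by exact_mod_cast h2 i (Fin.succ_pos i)⟩
      · rintro ⟨h1, h2, h3⟩
        refine ⟨⟨ha.1, h1⟩, ⟨⟨fun h => absurd h (lt_irrefl _), fun i _ => by exact_mod_cast h3 i⟩,
          fun i => ⟨fun h => absurd h (Fin.not_lt_zero _), fun j hij =>
            h2 i j (Fin.succ_lt_succ_iff.1 hij)⟩⟩, ha.2, fun i => (h3 i).trans ha.2⟩
    by_cases hc : (∀ i, 0 < b i) ∧ (∀ i j, i < j → b j < b i) ∧ ∀ i, ((b i : ℕ) : ℕ∞) < (a : ℕ∞)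
    · rw [if_pos hc, if_pos, ← ENNReal.ofReal_mul (by positivity)]
      · congr 1
        simp [List.get_eq_getElem, mul_comm]
      · simpa only [and_assoc] using hiff.2 hc
    · rw [if_neg hc, if_neg, mul_zero]
      intro h
      exact hc (hiff.1 (by simpa only [and_assoc] using h))
  · rw [ENNReal.tsum_eq_zero]
    intro b
    rw [if_neg]
    rintro ⟨h1, -, h3⟩
    exact ha ⟨by simpa using h1 (0 : Fin (ks.length + 1)),
      by simpa using h3 (0 : Fin (ks.length + 1))⟩

/-- A list is either empty or a head followed by a tail. -/
def listEquivOptionProd (α : Type*) : Option (α × List α) ≃ List α where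
  toFun o := o.elim [] fun p => p.1 :: p.2
  invFun l := match l with
    | [] => none
    | a :: t => some (a, t)
  left_inv o := by cases o <;> rfl
  right_inv l := by cases l <;> rfl

lemma ENNReal.tsum_list {α : Type*} (f : List α → ℝ≥0∞) :
    ∑' l, f l = f [] + ∑' a, ∑' l, f (a :: l) := by
  rw [← ENNReal.tsum_prod, ← (listEquivOptionProd α).tsum_eq,
    ← (Equiv.optionEquivSumPUnit.{0} (α × List α)).symm.tsum_eq,
    ENNReal.summable.tsum_sum ENNReal.summable, add_comm]
  congr 1
  simp
  rfl

lemma tsum_tsum_mul_boundedMzv_cons (h g : ℕ → ℝ≥0∞) (B : ℕ∞) :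
    ∑' (k : ℕ) (l : List ℕ), h k * (l.map g).prod * boundedMzv (k :: l) B =
      ∑' m : ℕ, if 0 < m ∧ (m : ℕ∞) < B then
        (∑' k, h k * ENNReal.ofReal (1 / (m : ℝ) ^ k)) *
          ∑' l : List ℕ, (l.map g).prod * boundedMzv l m else 0 := by
  have h2 : ∀ (k : ℕ) (l : List ℕ), h k * (l.map g).prod * boundedMzv (k :: l) B =
      ∑' m : ℕ, if 0 < m ∧ (m : ℕ∞) < B then h k * (l.map g).prod *
        (ENNReal.ofReal (1 / (m : ℝ) ^ k) * boundedMzv l m) else 0 := by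
    intro k l
    rw [boundedMzv_cons, ← ENNReal.tsum_mul_left]
    simp only [mul_ite, mul_zero]
  simp_rw [h2]
  rw [tsum_congr fun k => ENNReal.tsum_comm, ENNReal.tsum_comm]
  refine tsum_congr fun m => ?_
  split_ifs
  · rw [← ENNReal.tsum_mul_right]
    refine tsum_congr fun k => ?_
    rw [← ENNReal.tsum_mul_left]
    refine tsum_congr fun l => ?_
    ring
  · simp

lemma tsum_list_prod_mul_boundedMzv (g : ℕ → ℝ≥0∞) (M : ℕ) :
    ∑' l : List ℕ, (l.map g).prod * boundedMzv l M =
      ∏ m ∈ Finset.range M,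
        (1 + if 0 < m then ∑' k, g k * ENNReal.ofReal (1 / (m : ℝ) ^ k) else 0) := by
  have key : ∀ M : ℕ, ∑' l : List ℕ, (l.map g).prod * boundedMzv l M =
      1 + ∑ m ∈ Finset.range M, if 0 < m then
        (∑' k, g k * ENNReal.ofReal (1 / (m : ℝ) ^ k)) *
          ∑' l : List ℕ, (l.map g).prod * boundedMzv l m else 0 := by
    intro M
    rw [ENNReal.tsum_list]
    congr 1
    · simp [boundedMzv_nil]
    · simp only [List.map_cons, List.prod_cons]
      rw [tsum_tsum_mul_boundedMzv_cons, tsum_eq_sum (s := Finset.range M)]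
      · refine Finset.sum_congr rfl fun m hm => ?_
        have : (m : ℕ∞) < M := by exact_mod_cast Finset.mem_range.1 hm
        simp [this]
      · intro m hm
        rw [if_neg]
        rintro ⟨-, h⟩
        exact hm (Finset.mem_range.2 (by exact_mod_cast h))
  induction M with
  | zero =>
    rw [key 0]
    simp
  | succ M ih =>
    rw [key (M + 1), Finset.sum_range_succ, ← add_assoc, ← key M, Finset.prod_range_succ, ih]
    split_ifs <;> ring

/-- Weight of a single argument `k` in the generating function: `t ^ k` times `x` or `y`
according to whether `k ≥ 2` or `k = 1`. -/
noncomputable def argWeight (x y t : ℝ) (k : ℕ) : ℝ≥0∞ :=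
  if k = 0 then 0 else ENNReal.ofReal (t ^ k * if 2 ≤ k then x else y)

/-- Weight of the leading argument, which has to be at least `2`. -/
noncomputable def headWeight (x t : ℝ) (k : ℕ) : ℝ≥0∞ :=
  if 2 ≤ k then ENNReal.ofReal (t ^ k * x) else 0

/-- Weighted multiple zeta value of a list of arguments, zero when the list is not admissible. -/
noncomputable def weightedMzv (x y t : ℝ) : List ℕ → ℝ≥0∞
  | [] => 0
  | k :: l => headWeight x t k * (l.map (argWeight x y t)).prod * boundedMzv (k :: l) ⊤

/-- The coefficient of `t ^ K` in the generating function of the sums `G0one`. -/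
noncomputable def genCoeff (x y : ℝ) (K : ℕ) : ℝ :=
  ∑ l ∈ Finset.range (K + 1), ∑ m ∈ Finset.range (K + 1), G0one K (l + m) m * (y ^ l * x ^ m)

lemma headWeight_mul_prod_argWeight {x y t : ℝ} (hx : 0 ≤ x) (hy : 0 ≤ y) (ht : 0 ≤ t) {n : ℕ}
    (c : Fin (n + 1) → ℕ) :
    headWeight x t (c 0) * ∏ i : Fin n, argWeight x y t (c i.succ) =
      if (∀ i, 0 < c i) ∧ 2 ≤ c 0 then
        ENNReal.ofReal (t ^ (∑ i, c i) * (y ^ (n + 1 - (Finset.univ.filter fun i => 2 ≤ c i).card) *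
          x ^ (Finset.univ.filter fun i => 2 ≤ c i).card))
      else 0 := by
  by_cases h0 : 2 ≤ c 0
  · have hh : headWeight x t (c 0) = argWeight x y t (c 0) := by
      have : c 0 ≠ 0 := by omega
      simp [headWeight, argWeight, h0, this]
    rw [hh, ← Fin.prod_univ_succ (fun i => argWeight x y t (c i))]
    by_cases hpos : ∀ i, 0 < c i
    · rw [if_pos ⟨hpos, h0⟩]
      have : ∀ i, argWeight x y t (c i) =
          ENNReal.ofReal (t ^ c i * if 2 ≤ c i then x else y) := fun i => by
        simp [argWeight, (hpos i).ne']
      simp_rw [this]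
      rw [← ENNReal.ofReal_prod_of_nonneg]
      · congr 1
        rw [Finset.prod_mul_distrib, Finset.prod_pow_eq_pow_sum, Finset.prod_ite]
        simp only [Finset.prod_const]
        have hc := Finset.card_filter_add_card_filter_not (s := Finset.univ)
          (fun i : Fin (n + 1) => 2 ≤ c i)
        rw [Finset.card_univ, Fintype.card_fin] at hc
        rw [mul_comm (x ^ _), show (Finset.univ.filter fun i => ¬ 2 ≤ c i).card =
          n + 1 - (Finset.univ.filter fun i => 2 ≤ c i).card by omega]
      · intro i _
        split_ifs <;> positivity
    · rw [if_neg fun h => hpos h.1]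
      push Not at hpos
      obtain ⟨i, hi⟩ := hpos
      exact Finset.prod_eq_zero (Finset.mem_univ i) (by simp [argWeight, Nat.le_zero.1 hi])
  · rw [if_neg fun h => h0 h.2]
    simp [headWeight, h0]

lemma mem_G0set_succ {K n s : ℕ} {c : Fin (n + 1) → ℕ} :
    c ∈ G0set K (n + 1) s ↔ ((∀ i, 0 < c i) ∧ 2 ≤ c 0) ∧ ∑ i, c i = K ∧
      (Finset.univ.filter fun i => 2 ≤ c i).card = s := by
  simp only [G0set, Finset.mem_filter, Finset.Nat.mem_antidiagonalTuple]
  constructor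
  · rintro ⟨h1, -, h2, h3, h4⟩
    exact ⟨⟨h2, h3 0 rfl⟩, h1, h4⟩
  · rintro ⟨⟨h2, h3⟩, h1, h4⟩
    refine ⟨h1, Nat.succ_pos _, h2, fun i hi => ?_, h4⟩
    rwa [show i = 0 from Fin.ext hi]

lemma G0set_zero (K s : ℕ) : G0set K 0 s = ∅ := by
  simp [G0set]

lemma le_of_mem_G0set {K n s : ℕ} {c : Fin n → ℕ} (h : c ∈ G0set K n s) : n + s ≤ K := by
  simp only [G0set, Finset.mem_filter, Finset.Nat.mem_antidiagonalTuple] at h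
  obtain ⟨h1, -, h2, -, h4⟩ := h
  have : ∑ i : Fin n, (1 + if 2 ≤ c i then 1 else 0) ≤ ∑ i, c i := by
    refine Finset.sum_le_sum fun i _ => ?_
    have := h2 i
    split_ifs <;> omega
  rw [Finset.sum_add_distrib, ← Finset.card_filter, h4, h1] at this
  simpa using this

lemma one_le_and_le_of_mem_G0set {K n s : ℕ} {c : Fin n → ℕ} (h : c ∈ G0set K n s) :
    1 ≤ s ∧ s ≤ n := by
  simp only [G0set, Finset.mem_filter, Finset.Nat.mem_antidiagonalTuple] at h
  obtain ⟨-, hn, -, h3, h4⟩ := h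
  refine ⟨?_, ?_⟩
  · rw [← h4, Nat.one_le_iff_ne_zero, Ne, Finset.card_eq_zero, Finset.filter_eq_empty_iff]
    exact fun hc => hc (Finset.mem_univ ⟨0, hn⟩) (h3 ⟨0, hn⟩ rfl)
  · rw [← h4]
    exact (Finset.card_filter_le _ _).trans (by simp)

lemma weightedMzv_ofFn {x y t : ℝ} (hx : 0 ≤ x) (hy : 0 ≤ y) (ht : 0 ≤ t) {n : ℕ}
    (c : Fin n → ℕ) :
    weightedMzv x y t (List.ofFn c) = ∑' (K : ℕ) (l : ℕ) (m : ℕ),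
      if n = l + m ∧ c ∈ G0set K n m then
        ENNReal.ofReal (t ^ K * (y ^ l * x ^ m)) * boundedMzv (List.ofFn c) ⊤ else 0 := by
  cases n with
  | zero => simp [G0set_zero, weightedMzv]
  | succ n =>
    have hval : weightedMzv x y t (List.ofFn c) =
        headWeight x t (c 0) * (∏ i : Fin n, argWeight x y t (c i.succ)) *
          boundedMzv (List.ofFn c) ⊤ := by
      rw [List.ofFn_succ, weightedMzv, List.map_ofFn, List.prod_ofFn]
      rfl
    rw [hval, headWeight_mul_prod_argWeight hx hy ht]
    set s := (Finset.univ.filter fun i => 2 ≤ c i).card with hs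
    have hsn : s ≤ n + 1 := (Finset.card_filter_le _ _).trans (by simp)
    simp_rw [mem_G0set_succ, ← hs]
    split_ifs with h
    · rw [tsum_eq_single (∑ i, c i), tsum_eq_single (n + 1 - s), tsum_eq_single s]
      · rw [if_pos ⟨by omega, h, rfl, rfl⟩]
      · intro m hm
        exact if_neg fun hh => hm hh.2.2.2.symm
      · intro l hl
        refine ENNReal.tsum_eq_zero.2 fun m => if_neg fun hh => hl ?_
        have := hh.2.2.2
        omega
      · intro K hK
        exact ENNReal.tsum_eq_zero.2 fun l => ENNReal.tsum_eq_zero.2 fun m =>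
          if_neg fun hh => hK hh.2.2.1.symm
    · simp only [h, false_and, and_false, ↓reduceIte, tsum_zero, zero_mul]

lemma tsum_weightedMzv {x y t : ℝ} (hx : 0 ≤ x) (hy : 0 ≤ y) (ht : 0 ≤ t) :
    ∑' L, weightedMzv x y t L = ∑' K : ℕ, ∑ l ∈ Finset.range (K + 1), ∑ m ∈ Finset.range (K + 1),
      ∑ c ∈ G0set K (l + m) m,
        ENNReal.ofReal (t ^ K * (y ^ l * x ^ m)) * boundedMzv (List.ofFn c) ⊤ := by
  rw [← List.equivSigmaTuple.symm.tsum_eq, ENNReal.summable.tsum_sigma' fun _ => ENNReal.summable]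
  have h1 : ∀ (n : ℕ) (c : Fin n → ℕ), weightedMzv x y t (List.equivSigmaTuple.symm ⟨n, c⟩) = _ :=
    fun n c => weightedMzv_ofFn hx hy ht c
  simp_rw [h1]
  simp_rw [ENNReal.tsum_comm (α := Fin _ → ℕ) (β := ℕ)]
  rw [ENNReal.tsum_comm]
  refine tsum_congr fun K => ?_
  rw [ENNReal.tsum_comm]
  have h2 : ∀ l : ℕ, ∑' (n : ℕ) (m : ℕ) (c : Fin n → ℕ), (if n = l + m ∧ c ∈ G0set K n m then
        ENNReal.ofReal (t ^ K * (y ^ l * x ^ m)) * boundedMzv (List.ofFn c) ⊤ else 0) =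
      ∑' m : ℕ, ∑ c ∈ G0set K (l + m) m,
        ENNReal.ofReal (t ^ K * (y ^ l * x ^ m)) * boundedMzv (List.ofFn c) ⊤ := by
    intro l
    rw [ENNReal.tsum_comm]
    refine tsum_congr fun m => ?_
    rw [tsum_eq_single (l + m)]
    · rw [tsum_eq_sum (s := G0set K (l + m) m)]
      · exact Finset.sum_congr rfl fun c hc => if_pos ⟨rfl, hc⟩
      · exact fun c hc => if_neg fun h => hc h.2
    · exact fun n hn => ENNReal.tsum_eq_zero.2 fun c => if_neg fun h => hn h.1
  simp_rw [h2]
  have h3 : ∀ l m, K < l ∨ K < m → G0set K (l + m) m = ∅ := by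
    intro l m h
    refine Finset.eq_empty_of_forall_notMem fun c hc => ?_
    have := le_of_mem_G0set hc
    omega
  rw [tsum_eq_sum (s := Finset.range (K + 1))]
  · refine Finset.sum_congr rfl fun l _ => ?_
    rw [tsum_eq_sum (s := Finset.range (K + 1))]
    intro m hm
    rw [h3 l m (Or.inr (by simpa [Nat.lt_succ_iff] using hm)), Finset.sum_empty]
  · intro l hl
    refine ENNReal.tsum_eq_zero.2 fun m => ?_
    rw [h3 l m (Or.inl (by simpa [Nat.lt_succ_iff] using hl)), Finset.sum_empty]

lemma hasSum_genCoeff {x y t : ℝ} (hx : 0 < x) (hy : 0 < y) (ht : 0 < t)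
    (hfin : ∑' L, weightedMzv x y t L ≠ ∞) :
    HasSum (fun K => t ^ K * genCoeff x y K) (∑' L, weightedMzv x y t L).toReal := by
  rw [tsum_weightedMzv hx.le hy.le ht.le] at hfin ⊢
  have hterm := ENNReal.ne_top_of_tsum_ne_top hfin
  rw [ENNReal.tsum_toReal_eq hterm]
  convert ENNReal.hasSum_toReal hfin using 2 with K
  have hK := hterm K
  rw [ENNReal.sum_ne_top] at hK
  simp only [ENNReal.sum_ne_top] at hK
  rw [ENNReal.toReal_sum fun l hl => by simpa only [ENNReal.sum_ne_top] using hK l hl,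
    genCoeff, Finset.mul_sum]
  refine Finset.sum_congr rfl fun l hl => ?_
  rw [ENNReal.toReal_sum fun m hm => by simpa only [ENNReal.sum_ne_top] using hK l hl m hm,
    Finset.mul_sum]
  refine Finset.sum_congr rfl fun m hm => ?_
  rw [ENNReal.toReal_sum fun c hc => hK l hl m hm c hc, G0one, Finset.sum_mul, Finset.mul_sum]
  refine Finset.sum_congr rfl fun c hc => ?_
  rw [ENNReal.toReal_mul, ENNReal.toReal_ofReal (by positivity), mzv_eq_toReal]
  ring

/-- The product `∏_{j ≤ M} (1 + y t / j + x t² / (j (j - t)))`. -/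
noncomputable def partialProd (x y t : ℝ) (M : ℕ) : ℝ :=
  ∏ j ∈ Finset.range M, (1 + (y * t / (j + 1) + x * t ^ 2 / ((j + 1) * (j + 1 - t))))

lemma tsum_headWeight {x t : ℝ} (hx : 0 ≤ x) (ht : 0 ≤ t) (ht1 : t < 1) {m : ℕ} (hm : 0 < m) :
    ∑' k, headWeight x t k * ENNReal.ofReal (1 / (m : ℝ) ^ k) =
      ENNReal.ofReal (x * t ^ 2 / (m * (m - t))) := by
  have hm1 : (1 : ℝ) ≤ m := by exact_mod_cast hm
  have hm0 : (0 : ℝ) < m := by linarith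
  have hmt : (m : ℝ) - t ≠ 0 := by linarith
  have hs : HasSum (fun k : ℕ => x * (t / m) ^ 2 * (t / m) ^ k) (x * t ^ 2 / (m * (m - t))) := by
    have h := (hasSum_geometric_of_lt_one (r := t / m) (by positivity)
      (by rw [div_lt_one hm0]; linarith)).mul_left (x * (t / m) ^ 2)
    have he : x * (t / m) ^ 2 * (1 - t / m)⁻¹ = x * t ^ 2 / (m * (m - t)) := by
      have : 1 - t / m = (m - t) / m := by field_simp
      rw [this, inv_div]
      field_simp
    rwa [he] at h
  rw [← hs.tsum_eq, ENNReal.ofReal_tsum_of_nonneg (fun k => by positivity) hs.summable,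
    ← ENNReal.summable.sum_add_tsum_nat_add' (k := 2)]
  simp only [Finset.sum_range_succ, Finset.sum_range_zero, headWeight]
  simp only [nonpos_iff_eq_zero, OfNat.ofNat_ne_zero, ↓reduceIte, zero_mul, add_zero,
    Nat.not_ofNat_le_one, le_add_iff_nonneg_left, zero_le, zero_add]
  refine tsum_congr fun k => ?_
  rw [← ENNReal.ofReal_mul (by positivity)]
  congr 1
  rw [div_pow, div_pow]
  field_simp
  ring

lemma tsum_argWeight {x y t : ℝ} (hx : 0 ≤ x) (hy : 0 ≤ y) (ht : 0 ≤ t) (ht1 : t < 1) {m : ℕ}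
    (hm : 0 < m) :
    ∑' k, argWeight x y t k * ENNReal.ofReal (1 / (m : ℝ) ^ k) =
      ENNReal.ofReal (y * t / m + x * t ^ 2 / (m * (m - t))) := by
  have hm1 : (1 : ℝ) ≤ m := by exact_mod_cast hm
  have hmt : 0 < (m : ℝ) - t := by linarith
  have h : ∀ k, argWeight x y t k * ENNReal.ofReal (1 / (m : ℝ) ^ k) =
      (if k = 1 then ENNReal.ofReal (y * t / m) else 0) +
        headWeight x t k * ENNReal.ofReal (1 / (m : ℝ) ^ k) := by
    intro k
    match k with
    | 0 => simp [argWeight, headWeight]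
    | 1 =>
      simp only [argWeight, headWeight]
      norm_num
      rw [← ENNReal.ofReal_mul (by positivity)]
      congr 1
      ring
    | k + 2 => simp [argWeight, headWeight]
  simp_rw [h]
  rw [ENNReal.tsum_add, tsum_headWeight hx ht ht1 hm, tsum_ite_eq,
    ENNReal.ofReal_add (by positivity) (by positivity)]

lemma partialProd_nonneg {x y t : ℝ} (hx : 0 ≤ x) (hy : 0 ≤ y) (ht : 0 ≤ t) (ht1 : t < 1) (M : ℕ) :
    0 ≤ partialProd x y t M := by
  refine Finset.prod_nonneg fun j _ => ?_
  have : 0 < (j : ℝ) + 1 - t := by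
    have : (0 : ℝ) ≤ j := j.cast_nonneg
    linarith
  positivity

lemma tsum_list_prod_argWeight {x y t : ℝ} (hx : 0 ≤ x) (hy : 0 ≤ y) (ht : 0 ≤ t) (ht1 : t < 1)
    (M : ℕ) :
    ∑' l : List ℕ, (l.map (argWeight x y t)).prod * boundedMzv l ((M + 1 : ℕ) : ℕ∞) =
      ENNReal.ofReal (partialProd x y t M) := by
  have hd : ∀ j : ℕ, 0 < (j : ℝ) + 1 - t := fun j => by
    have : (0 : ℝ) ≤ j := j.cast_nonneg
    linarith
  have hnn : ∀ j : ℕ, 0 ≤ y * t / ((j : ℝ) + 1) + x * t ^ 2 / ((j + 1) * (j + 1 - t)) :=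
    fun j => by
      have := hd j
      positivity
  rw [tsum_list_prod_mul_boundedMzv, Finset.prod_range_succ']
  simp only [lt_self_iff_false, ↓reduceIte, add_zero, mul_one, Nat.succ_pos]
  rw [partialProd, ENNReal.ofReal_prod_of_nonneg (fun j _ => add_nonneg zero_le_one (hnn j))]
  refine Finset.prod_congr rfl fun j _ => ?_
  rw [tsum_argWeight hx hy ht ht1 (Nat.succ_pos _), ENNReal.ofReal_add zero_le_one (hnn j),
    ENNReal.ofReal_one, Nat.cast_succ]

lemma tsum_weightedMzv_eq_ofReal {x y t : ℝ} (hx : 0 ≤ x) (hy : 0 ≤ y) (ht : 0 ≤ t) (ht1 : t < 1)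
    (hs : Summable fun m : ℕ =>
      x * t ^ 2 / (((m : ℝ) + 1) * (m + 1 - t)) * partialProd x y t m) :
    ∑' L, weightedMzv x y t L = ENNReal.ofReal
      (∑' m : ℕ, x * t ^ 2 / (((m : ℝ) + 1) * (m + 1 - t)) * partialProd x y t m) := by
  have hc : ∀ m : ℕ, 0 ≤ x * t ^ 2 / (((m : ℝ) + 1) * (m + 1 - t)) := fun m => by
    have : (0 : ℝ) ≤ m := m.cast_nonneg
    have : 0 < (m : ℝ) + 1 - t := by linarith
    positivity
  have hterm : ∀ m : ℕ, (if 0 < m + 1 ∧ ((m + 1 : ℕ) : ℕ∞) < ⊤ then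
      (∑' k, headWeight x t k * ENNReal.ofReal (1 / ((m + 1 : ℕ) : ℝ) ^ k)) *
        ∑' l : List ℕ, (l.map (argWeight x y t)).prod * boundedMzv l ((m + 1 : ℕ) : ℕ∞) else 0) =
      ENNReal.ofReal (x * t ^ 2 / (((m : ℝ) + 1) * (m + 1 - t)) * partialProd x y t m) := by
    intro m
    rw [if_pos ⟨Nat.succ_pos _, ENat.natCast_lt_top _⟩, tsum_headWeight hx ht ht1 (Nat.succ_pos _),
      tsum_list_prod_argWeight hx hy ht ht1, ENNReal.ofReal_mul (hc m), Nat.cast_succ]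
  rw [ENNReal.ofReal_tsum_of_nonneg
    (fun m => mul_nonneg (hc m) (partialProd_nonneg hx hy ht ht1 m)) hs, ENNReal.tsum_list]
  simp only [weightedMzv, zero_add]
  rw [tsum_tsum_mul_boundedMzv_cons, tsum_eq_zero_add' ENNReal.summable]
  simp only [lt_self_iff_false, false_and, ↓reduceIte, zero_add]
  exact tsum_congr hterm

/-- The term of index `m` of the Gauss hypergeometric series `F(a, b; c; 1)` with `a + b = s` and
`a * b = q`. -/
noncomputable def gaussTerm (s q c : ℝ) (m : ℕ) : ℝ :=
  ∏ j ∈ Finset.range m, ((j : ℝ) ^ 2 + s * j + q) / ((j + 1) * (c + j))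

lemma gaussTerm_zero (s q c : ℝ) : gaussTerm s q c 0 = 1 := by
  simp [gaussTerm]

lemma gaussTerm_succ (s q c : ℝ) (m : ℕ) :
    gaussTerm s q c (m + 1) =
      gaussTerm s q c m * (((m : ℝ) ^ 2 + s * m + q) / ((m + 1) * (c + m))) :=
  Finset.prod_range_succ _ _

lemma gaussTerm_add_one (s q : ℝ) {c : ℝ} (hc : 0 < c) (m : ℕ) :
    gaussTerm s q (c + 1) m = gaussTerm s q c m * (c / (c + m)) := by
  induction m with
  | zero => simp [gaussTerm_zero, hc.ne']
  | succ m ih =>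
    have h1 : c + m ≠ 0 := by positivity
    have h2 : c + 1 + m ≠ 0 := by positivity
    have h3 : c + (m + 1) ≠ 0 := by positivity
    rw [gaussTerm_succ, gaussTerm_succ, ih]
    push_cast
    field_simp
    ring

lemma gaussTerm_telescope (s q : ℝ) {c : ℝ} (hc : 0 < c) (m : ℕ) :
    c * (c - s) * gaussTerm s q c m - (c ^ 2 - s * c + q) * gaussTerm s q (c + 1) m =
      c * (m * gaussTerm s q c m) - c * ((m + 1 : ℕ) * gaussTerm s q c (m + 1)) := by
  have h1 : c + m ≠ 0 := by positivity
  rw [gaussTerm_add_one s q hc, gaussTerm_succ]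
  push_cast
  field_simp
  ring

lemma tsum_gaussTerm_contiguous {s q c : ℝ} (hc : 0 < c) (hs : Summable (gaussTerm s q c))
    (hs' : Summable (gaussTerm s q (c + 1)))
    (hlim : Filter.Tendsto (fun m : ℕ => m * gaussTerm s q c m) Filter.atTop (nhds 0)) :
    c * (c - s) * ∑' m, gaussTerm s q c m =
      (c ^ 2 - s * c + q) * ∑' m, gaussTerm s q (c + 1) m := by
  have h1 := ((hs.hasSum.mul_left (c * (c - s))).sub
    (hs'.hasSum.mul_left (c ^ 2 - s * c + q))).tendsto_sum_nat
  have h2 : Filter.Tendsto (fun n : ℕ => ∑ m ∈ Finset.range n,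
      (c * (c - s) * gaussTerm s q c m - (c ^ 2 - s * c + q) * gaussTerm s q (c + 1) m))
      Filter.atTop (nhds 0) := by
    simp_rw [gaussTerm_telescope s q hc, Finset.sum_range_sub' (fun m : ℕ =>
      c * (m * gaussTerm s q c m))]
    simpa using (hlim.const_mul c).neg
  exact sub_eq_zero.1 (tendsto_nhds_unique h1 h2)

lemma abs_gaussTerm_add_nat_le (s q : ℝ) {c : ℝ} (hc : 0 < c) (n m : ℕ) :
    |gaussTerm s q (c + n) (m + 1)| ≤ |gaussTerm s q c (m + 1)| * (c / (c + n)) := by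
  induction n with
  | zero => simp [hc.ne']
  | succ n ih =>
    have h0 : 0 < c + n := by positivity
    have h1 : (0 : ℝ) < c + (n + 1) := by positivity
    rw [Nat.cast_succ, ← add_assoc, gaussTerm_add_one s q h0, abs_mul]
    have h2 : |(c + n) / (c + n + ((m + 1 : ℕ) : ℝ))| ≤ (c + n) / (c + n + 1) := by
      rw [abs_of_nonneg (by positivity)]
      gcongr
      push_cast
      linarith [(m.cast_nonneg : (0 : ℝ) ≤ m)]
    calc _ ≤ |gaussTerm s q c (m + 1)| * (c / (c + n)) * ((c + n) / (c + n + 1)) := by gcongr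
      _ = _ := by field_simp

lemma abs_gaussTerm_add_nat_le' (s q : ℝ) {c : ℝ} (hc : 0 < c) (n m : ℕ) :
    |gaussTerm s q (c + n) m| ≤ |gaussTerm s q c m| := by
  cases m with
  | zero => simp [gaussTerm_zero]
  | succ m =>
    refine (abs_gaussTerm_add_nat_le s q hc n m).trans (mul_le_of_le_one_right (abs_nonneg _) ?_)
    rw [div_le_one (by positivity)]
    linarith [(n.cast_nonneg : (0 : ℝ) ≤ n)]

lemma tendsto_tsum_gaussTerm {s q c : ℝ} (hc : 0 < c) (hs : Summable (gaussTerm s q c)) :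
    Filter.Tendsto (fun n : ℕ => ∑' m, gaussTerm s q (c + n) m) Filter.atTop (nhds 1) := by
  have hsa : Summable fun m => |gaussTerm s q c (m + 1)| :=
    ((summable_nat_add_iff 1).2 hs).abs
  have hsn : ∀ n : ℕ, Summable (gaussTerm s q (c + n)) := fun n =>
    Summable.of_norm_bounded hs.abs fun m => abs_gaussTerm_add_nat_le' s q hc n m
  have hc0 : Filter.Tendsto (fun n : ℕ => (∑' m, |gaussTerm s q c (m + 1)|) * (c / (c + n)))
      Filter.atTop (nhds 0) := by
    have := (tendsto_const_nhds (x := c)).div_atTop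
      (Filter.tendsto_atTop_add_const_left _ c (tendsto_natCast_atTop_atTop (R := ℝ)))
    simpa using this.const_mul (∑' m, |gaussTerm s q c (m + 1)|)
  have h := squeeze_zero_norm (f := fun n : ℕ => ∑' m, gaussTerm s q (c + n) m - 1) (fun n => by
    rw [(hsn n).tsum_eq_zero_add, gaussTerm_zero, add_sub_cancel_left, ← tsum_mul_right]
    exact tsum_of_norm_bounded (hsa.mul_right _).hasSum
      fun m => abs_gaussTerm_add_nat_le s q hc n m) hc0
  simpa using h.add_const 1

/-- Gauss' summation theorem, with the quotient of Gamma values written as an infinite product. -/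
lemma tendsto_prod_tsum_gaussTerm {s q c : ℝ} (hc : 0 < c) (hcs : 0 < c - s)
    (hs : Summable (gaussTerm s q c))
    (hlim : Filter.Tendsto (fun m : ℕ => m * gaussTerm s q c m) Filter.atTop (nhds 0)) :
    Filter.Tendsto (fun N : ℕ => ∏ n ∈ Finset.range N,
      ((c + n) ^ 2 - s * (c + n) + q) / ((c + n) * (c + n - s)))
      Filter.atTop (nhds (∑' m, gaussTerm s q c m)) := by
  have hsn : ∀ n : ℕ, Summable (gaussTerm s q (c + n)) := fun n =>
    Summable.of_norm_bounded hs.abs fun m => abs_gaussTerm_add_nat_le' s q hc n m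
  have hlimn : ∀ n : ℕ, Filter.Tendsto (fun m : ℕ => m * gaussTerm s q (c + n) m)
      Filter.atTop (nhds 0) := fun n => by
    refine squeeze_zero_norm (fun m => ?_)
      (tendsto_zero_iff_norm_tendsto_zero.1 hlim)
    rw [norm_mul, norm_mul]
    exact mul_le_mul_of_nonneg_left (abs_gaussTerm_add_nat_le' s q hc n m) (norm_nonneg _)
  have hprod : ∀ N : ℕ, ∑' m, gaussTerm s q c m = (∏ n ∈ Finset.range N,
      ((c + n) ^ 2 - s * (c + n) + q) / ((c + n) * (c + n - s))) *
        ∑' m, gaussTerm s q (c + N) m := by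
    intro N
    induction N with
    | zero => simp
    | succ N ih =>
      have h0 : 0 < c + N := by positivity
      have h1 : 0 < c + N - s := by linarith [(N.cast_nonneg : (0 : ℝ) ≤ N)]
      have hr := tsum_gaussTerm_contiguous h0 (hsn N)
        (by simpa [add_assoc] using hsn (N + 1)) (hlimn N)
      rw [ih, Finset.prod_range_succ, mul_assoc]
      congr 1
      rw [Nat.cast_succ, ← add_assoc, div_mul_eq_mul_div, ← hr]
      field_simp
  have h1 := tendsto_tsum_gaussTerm hc hs
  have h2 := (tendsto_const_nhds (x := ∑' m, gaussTerm s q c m)).div h1 one_ne_zero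
  rw [div_one] at h2
  refine h2.congr' ?_
  filter_upwards [h1.eventually_ne one_ne_zero] with N hN
  simp only [Pi.div_apply]
  rw [hprod N, mul_div_cancel_right₀ _ hN]

lemma partialProd_le_sqrt {x y t : ℝ} (hx : 0 ≤ x) (hy : 0 ≤ y) (ht : 0 ≤ t) (ht2 : t ≤ 1 / 2)
    (hsmall : y * t + 2 * (x * t ^ 2) ≤ 1 / 3) (M : ℕ) :
    partialProd x y t M ≤ √(M + 1) := by
  induction M with
  | zero => simp [partialProd]
  | succ M ih =>
    have hM : (0 : ℝ) ≤ M := M.cast_nonneg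
    have hd : 0 < (M : ℝ) + 1 - t := by linarith
    rw [partialProd, Finset.prod_range_succ]
    have h1 : x * t ^ 2 / (((M : ℝ) + 1) * (M + 1 - t)) ≤ 2 * (x * t ^ 2) / (M + 1) := by
      rw [div_le_div_iff₀ (by positivity) (by positivity)]
      nlinarith [mul_nonneg (mul_nonneg hx (sq_nonneg t)) (by positivity : (0 : ℝ) ≤ M + 1)]
    have h2 : 1 + (y * t / ((M : ℝ) + 1) + x * t ^ 2 / ((M + 1) * (M + 1 - t))) ≤
        1 + (1 / 3) / (M + 1) := by
      have : y * t / ((M : ℝ) + 1) + 2 * (x * t ^ 2) / (M + 1) ≤ (1 / 3) / (M + 1) := by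
        rw [← add_div]
        gcongr
      linarith
    calc _ ≤ √((M : ℝ) + 1) * (1 + (1 / 3) / (M + 1)) := by
          refine mul_le_mul ih h2 (by positivity) (Real.sqrt_nonneg _)
      _ ≤ _ := by
          refine Real.le_sqrt_of_sq_le ?_
          rw [mul_pow, Real.sq_sqrt (by positivity)]
          push_cast
          have : ((M : ℝ) + 1) * (1 + 1 / 3 / (M + 1)) ^ 2 =
            M + 1 + 2 / 3 + (1 / 9) / (M + 1) := by field_simp; ring
          rw [this]
          have : (1 / 9 : ℝ) / (M + 1) ≤ 1 / 9 := div_le_self (by norm_num) (by linarith)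
          linarith

lemma gaussTerm_eq_partialProd {x y t : ℝ} (ht1 : t < 1) (m : ℕ) :
    gaussTerm (y * t - t) (x * t ^ 2 - t * (y * t)) (1 - t) (m + 1) =
      (x * t ^ 2 - t * (y * t)) / ((m + 1) * (m + 1 - t)) * partialProd x y t m := by
  induction m with
  | zero =>
    rw [gaussTerm_succ, gaussTerm_zero]
    simp [partialProd]
  | succ m ih =>
    have hd : (m : ℝ) + 1 - t ≠ 0 := by linarith [(m.cast_nonneg : (0 : ℝ) ≤ m)]
    have hd' : (m : ℝ) + 1 + 1 - t ≠ 0 := by linarith [(m.cast_nonneg : (0 : ℝ) ≤ m)]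
    have hd'' : 1 - t + ((m : ℝ) + 1) ≠ 0 := by linarith [(m.cast_nonneg : (0 : ℝ) ≤ m)]
    rw [gaussTerm_succ, ih, partialProd, partialProd, Finset.prod_range_succ]
    push_cast
    rw [show 1 - t + ((m : ℝ) + 1) = m + 1 + 1 - t by ring]
    field_simp
    ring

lemma gauss_bounds {x y t : ℝ} (hx : 0 ≤ x) (hy : 0 ≤ y) (ht : 0 ≤ t) (ht2 : t ≤ 1 / 2)
    (hsmall : y * t + 2 * (x * t ^ 2) ≤ 1 / 3) :
    (Summable fun m : ℕ => 1 / (((m : ℝ) + 1) * (m + 1 - t)) * partialProd x y t m) ∧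
    Filter.Tendsto (fun m : ℕ => ((m : ℝ) + 1) *
      (1 / (((m : ℝ) + 1) * (m + 1 - t)) * partialProd x y t m)) Filter.atTop (nhds 0) := by
  have hb : ∀ m : ℕ, 1 / (((m : ℝ) + 1) * (m + 1 - t)) * partialProd x y t m ≤
      2 * (1 / ((m + 1 : ℕ) : ℝ) ^ (3 / 2 : ℝ)) := by
    intro m
    have hm : (0 : ℝ) ≤ m := m.cast_nonneg
    have hd : 0 < (m : ℝ) + 1 - t := by linarith
    have h1 : 1 / (((m : ℝ) + 1) * (m + 1 - t)) ≤ 2 / (m + 1) ^ 2 := by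
      rw [div_le_div_iff₀ (by positivity) (by positivity)]
      nlinarith
    have h2 : ((m : ℝ) + 1) ^ (3 / 2 : ℝ) * √(m + 1) = (m + 1) ^ 2 := by
      rw [Real.sqrt_eq_rpow, ← Real.rpow_add (by positivity)]
      norm_num
    calc _ ≤ 2 / ((m : ℝ) + 1) ^ 2 * √(m + 1) := by
          refine mul_le_mul h1 (partialProd_le_sqrt hx hy ht ht2 hsmall m)
            (partialProd_nonneg hx hy ht (by linarith) m) (by positivity)
      _ = _ := by
          rw [← h2]
          push_cast
          field_simp
  have hnn : ∀ m : ℕ, 0 ≤ 1 / (((m : ℝ) + 1) * (m + 1 - t)) * partialProd x y t m := fun m => by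
    have hm : (0 : ℝ) ≤ m := m.cast_nonneg
    have hd : 0 < (m : ℝ) + 1 - t := by linarith
    have := partialProd_nonneg hx hy ht (by linarith) m
    positivity
  constructor
  · refine Summable.of_nonneg_of_le hnn hb (Summable.mul_left 2 ?_)
    exact (summable_nat_add_iff 1).2 (Real.summable_one_div_nat_rpow.2 (by norm_num))
  · have h0 : Filter.Tendsto (fun m : ℕ => 2 * (((m + 1 : ℕ) : ℝ) ^ (-(1 / 2) : ℝ)))
        Filter.atTop (nhds 0) := by
      have h := (tendsto_rpow_neg_atTop (y := 1 / 2) (by norm_num)).comp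
        ((tendsto_natCast_atTop_atTop (R := ℝ)).comp (Filter.tendsto_add_atTop_nat 1))
      simpa using h.const_mul 2
    refine squeeze_zero (fun m => mul_nonneg (by positivity) (hnn m)) (fun m => ?_) h0
    calc _ ≤ ((m : ℝ) + 1) * (2 * (1 / ((m + 1 : ℕ) : ℝ) ^ (3 / 2 : ℝ))) :=
          mul_le_mul_of_nonneg_left (hb m) (by positivity)
      _ = _ := by
          have h2 : ((m : ℝ) + 1) ^ (3 / 2 : ℝ) * ((m : ℝ) + 1) ^ (-(1 / 2) : ℝ) = m + 1 := by
            rw [← Real.rpow_add (by positivity)]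
            norm_num
          push_cast
          rw [mul_left_comm, mul_one_div]
          congr 1
          rw [div_eq_iff (by positivity), mul_comm, h2]

/-- The generating function evaluated as an infinite product. -/
lemma hasSum_genCoeff_and_tendsto {x y t : ℝ} (hx : 0 < x) (hy : 0 < y) (ht : 0 < t)
    (ht2 : t ≤ 1 / 2) (hsmall : y * t + 2 * (x * t ^ 2) ≤ 1 / 3) :
    ∃ S : ℝ, HasSum (fun K => t ^ K * genCoeff x y K) S ∧
      Filter.Tendsto (fun N : ℕ => ∏ n ∈ Finset.range N,
        (((n : ℝ) + 1) ^ 2 - (t + y * t) * (n + 1) + x * t ^ 2) /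
          ((n + 1 - t) * (n + 1 - y * t))) Filter.atTop (nhds (1 + (x - y) / x * S)) := by
  obtain ⟨hs, hl⟩ := gauss_bounds hx.le hy.le ht.le ht2 hsmall
  set f : ℕ → ℝ := fun m => 1 / (((m : ℝ) + 1) * (m + 1 - t)) * partialProd x y t m with hf
  have hf' : ∀ c : ℝ, (fun m : ℕ => c / (((m : ℝ) + 1) * (m + 1 - t)) * partialProd x y t m) =
      fun m => c * f m := fun c => by
    funext m
    rw [hf]
    ring
  have hS : ∑' L, weightedMzv x y t L = ENNReal.ofReal (x * t ^ 2 * ∑' m, f m) := by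
    rw [tsum_weightedMzv_eq_ofReal hx.le hy.le ht.le (by linarith)
      (by rw [hf']; exact hs.mul_left _), hf', tsum_mul_left]
  have hfnn : 0 ≤ ∑' m, f m := tsum_nonneg fun m => by
    have hm : (0 : ℝ) ≤ m := m.cast_nonneg
    have hd : 0 < (m : ℝ) + 1 - t := by linarith
    have := partialProd_nonneg hx.le hy.le ht.le (by linarith) m
    simp only [hf]
    positivity
  refine ⟨x * t ^ 2 * ∑' m, f m, ?_, ?_⟩
  · have h := hasSum_genCoeff hx hy ht (by rw [hS]; exact ENNReal.ofReal_ne_top)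
    rwa [hS, ENNReal.toReal_ofReal (by positivity)] at h
  · set s := y * t - t
    set q := x * t ^ 2 - t * (y * t) with hq
    have hg : ∀ m : ℕ, gaussTerm s q (1 - t) (m + 1) = q * f m := fun m => by
      rw [gaussTerm_eq_partialProd (by linarith), hf, ← hq]
      ring
    have hsum : Summable (gaussTerm s q (1 - t)) := by
      rw [← summable_nat_add_iff 1]
      simp_rw [hg]
      exact hs.mul_left q
    have hlim : Filter.Tendsto (fun m : ℕ => m * gaussTerm s q (1 - t) m)
        Filter.atTop (nhds 0) := by
      rw [← Filter.tendsto_add_atTop_iff_nat 1]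
      simp_rw [hg]
      have h := hl.const_mul q
      rw [mul_zero] at h
      refine h.congr fun m => ?_
      simp only [hf]
      push_cast
      ring
    have hyt : y * t ≤ 1 / 3 := by nlinarith [mul_pos hx (pow_pos ht 2)]
    have := tendsto_prod_tsum_gaussTerm (s := s) (q := q) (c := 1 - t) (by linarith)
      (by simp only [s]; linarith) hsum hlim
    have hval : ∑' m, gaussTerm s q (1 - t) m = 1 + (x - y) / x * (x * t ^ 2 * ∑' m, f m) := by
      rw [hsum.tsum_eq_zero_add, gaussTerm_zero]
      simp_rw [hg]
      rw [tsum_mul_left, hq]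
      field_simp
    rw [hval] at this
    refine this.congr fun N => Finset.prod_congr rfl fun n _ => ?_
    congr 1 <;> simp only [s, q] <;> ring

/-- The power series `exp (b * X ^ (j + 1))`. -/
noncomputable def expMonomial (b : ℂ) (j : ℕ) : PowerSeries ℂ :=
  PowerSeries.mk fun d => if (j + 1) ∣ d then b ^ (d / (j + 1)) / (d / (j + 1)).factorial else 0

lemma derivative_expMonomial (b : ℂ) (j : ℕ) :
    PowerSeries.derivative ℂ (expMonomial b j) =
      PowerSeries.C (((j : ℂ) + 1) * b) * PowerSeries.X ^ j * expMonomial b j := by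
  ext n
  rw [PowerSeries.coeff_derivative, mul_assoc, PowerSeries.coeff_C_mul,
    PowerSeries.coeff_X_pow_mul']
  simp only [expMonomial, PowerSeries.coeff_mk]
  by_cases hd : (j + 1) ∣ n + 1
  · obtain ⟨e, he⟩ := hd
    have he0 : e ≠ 0 := by
      rintro rfl
      simp at he
    obtain ⟨e, rfl⟩ := Nat.exists_eq_succ_of_ne_zero he0
    have hn : n = j + (j + 1) * e := by
      have : (j + 1) * (e + 1) = j + (j + 1) * e + 1 := by ring
      rw [Nat.succ_eq_add_one] at he
      omega
    have h1 : (j + 1) ∣ n + 1 := ⟨_, he⟩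
    have h2 : (n + 1) / (j + 1) = e + 1 := by rw [he]; exact Nat.mul_div_cancel_left _ j.succ_pos
    have h3 : n - j = (j + 1) * e := by omega
    rw [if_pos h1, h2, if_pos (by omega), h3, if_pos (dvd_mul_right _ _),
      Nat.mul_div_cancel_left _ j.succ_pos, Nat.factorial_succ]
    have h4 : (n : ℂ) + 1 = (j + 1) * (e + 1) := by exact_mod_cast he
    have h5 : (e : ℂ) + 1 ≠ 0 := by exact_mod_cast e.succ_ne_zero
    have h6 : (e.factorial : ℂ) ≠ 0 := by exact_mod_cast e.factorial_ne_zero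
    rw [h4]
    push_cast
    field_simp
    ring
  · rw [if_neg hd, zero_mul]
    split_ifs with h1 h2
    · exfalso
      apply hd
      have : n + 1 = (n - j) + (j + 1) := by omega
      rw [this]
      exact dvd_add h2 dvd_rfl
    · simp
    · simp

lemma derivative_prod_expMonomial (a : ℕ → ℂ) (N : ℕ) :
    PowerSeries.derivative ℂ (∏ j ∈ Finset.range N, expMonomial (a (j + 1)) j) =
      (∑ j ∈ Finset.range N, PowerSeries.C (((j : ℂ) + 1) * a (j + 1)) * PowerSeries.X ^ j) *
        ∏ j ∈ Finset.range N, expMonomial (a (j + 1)) j := by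
  induction N with
  | zero => simp
  | succ N ih =>
    rw [Finset.prod_range_succ, Finset.sum_range_succ, Derivation.leibniz, ih,
      derivative_expMonomial]
    simp only [smul_eq_mul]
    ring

lemma coeff_zero_prod_expMonomial (a : ℕ → ℂ) (N : ℕ) :
    PowerSeries.coeff 0 (∏ j ∈ Finset.range N, expMonomial (a (j + 1)) j) = 1 := by
  rw [PowerSeries.coeff_zero_eq_constantCoeff_apply, map_prod]
  refine Finset.prod_eq_one fun j _ => ?_
  rw [← PowerSeries.coeff_zero_eq_constantCoeff_apply]
  simp [expMonomial]

lemma coeff_succ_prod_expMonomial (a : ℕ → ℂ) {N n : ℕ} (hn : n < N) :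
    ((n : ℂ) + 1) * PowerSeries.coeff (n + 1) (∏ j ∈ Finset.range N, expMonomial (a (j + 1)) j) =
      ∑ i ∈ Finset.range (n + 1), ((i : ℂ) + 1) * a (i + 1) *
        PowerSeries.coeff (n - i) (∏ j ∈ Finset.range N, expMonomial (a (j + 1)) j) := by
  have h := congrArg (PowerSeries.coeff n) (derivative_prod_expMonomial a N)
  rw [PowerSeries.coeff_derivative, mul_comm] at h
  rw [h, PowerSeries.coeff_mul, Finset.Nat.sum_antidiagonal_eq_sum_range_succ_mk]
  refine Finset.sum_congr rfl fun i hi => ?_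
  congr 1
  rw [map_sum, Finset.sum_eq_single i]
  · rw [PowerSeries.coeff_C_mul, PowerSeries.coeff_X_pow, if_pos rfl, mul_one]
  · intro j _ hji
    rw [PowerSeries.coeff_C_mul, PowerSeries.coeff_X_pow, if_neg hji.symm, mul_zero]
  · intro hi'
    have := Finset.mem_range.1 hi
    exact absurd (Finset.mem_range.2 (by omega)) hi'

lemma SchurP_eq_coeff (a : ℕ → ℂ) (n : ℕ) :
    SchurP a n = PowerSeries.coeff n (∏ j ∈ Finset.range n, expMonomial (a (j + 1)) j) := by
  rw [Finset.prod_range, PowerSeries.coeff_prod, SchurP]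
  refine Finset.sum_of_injOn
    (fun c => Finsupp.equivFunOnFinite.symm fun i : Fin n => (i.val + 1) * c i) ?_ ?_ ?_ ?_
  · intro c _ c' _ h
    funext i
    have := congrArg (fun f : Fin n →₀ ℕ => f i) h
    simpa using this
  · intro c hc
    have := (Finset.mem_filter.1 hc).2
    simp only [Finset.mem_coe, Finset.mem_finsuppAntidiag]
    exact ⟨by simpa using this, Finset.subset_univ _⟩
  · intro l hl hl'
    rw [Finset.mem_finsuppAntidiag] at hl
    by_contra hne
    have hdvd : ∀ i : Fin n, (i.val + 1) ∣ l i := by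
      intro i
      by_contra hi
      exact hne (Finset.prod_eq_zero (Finset.mem_univ i) (by simp [expMonomial, hi]))
    apply hl'
    refine ⟨fun i => l i / (i.val + 1), ?_, ?_⟩
    · simp only [Finset.coe_filter, Set.mem_ofPred_eq, Fintype.mem_piFinset, Finset.mem_range]
      refine ⟨fun i => ?_, ?_⟩
      · have : l i ≤ n := by
          exact (Finset.single_le_sum (f := l) (fun _ _ => Nat.zero_le _)
            (Finset.mem_univ i)).trans_eq hl.1
        exact Nat.lt_succ_of_le ((Nat.div_le_self _ _).trans this)
      · exact (Finset.sum_congr rfl fun i _ => Nat.mul_div_cancel' (hdvd i)).trans hl.1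
    · ext i
      simpa using Nat.mul_div_cancel' (hdvd i)
  · intro c _
    refine Finset.prod_congr rfl fun i _ => ?_
    simp [expMonomial]

lemma hasFPowerSeriesOnBall_tsum {a : ℕ → ℂ}
    (ha : ∀ z : ℂ, ‖z‖ < 1 → Summable fun n => a n * z ^ n) :
    HasFPowerSeriesOnBall (fun z : ℂ => ∑' n, a n * z ^ n)
      (FormalMultilinearSeries.ofScalars ℂ a) 0 1 := by
  have hr : 1 ≤ (FormalMultilinearSeries.ofScalars ℂ a).radius := by
    refine ENNReal.le_of_forall_nnreal_lt fun r hr => ?_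
    have hr1 : (r : ℝ) < 1 := by exact_mod_cast hr
    refine FormalMultilinearSeries.le_radius_of_tendsto (l := 0) _ ?_
    have := (ha (r : ℝ) (by simpa using hr1)).tendsto_atTop_zero.norm
    simpa [FormalMultilinearSeries.ofScalars_norm] using this
  have h := ((FormalMultilinearSeries.ofScalars ℂ a).hasFPowerSeriesOnBall
    (zero_lt_one.trans_le hr)).mono zero_lt_one hr
  refine h.congr fun z _ => ?_
  exact (FormalMultilinearSeries.ofScalars_sum_eq a z).trans (by simp)

lemma iteratedDeriv_tsum_zero {a : ℕ → ℂ}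
    (ha : ∀ z : ℂ, ‖z‖ < 1 → Summable fun n => a n * z ^ n) (n : ℕ) :
    iteratedDeriv n (fun z : ℂ => ∑' n, a n * z ^ n) 0 = n.factorial * a n := by
  have h1 := (hasFPowerSeriesOnBall_tsum ha).hasFPowerSeriesAt
  have h2 := h1.analyticAt.hasFPowerSeriesAt
  have h3 := h1.eq_formalMultilinearSeries h2
  have h4 := FormalMultilinearSeries.ofScalars_series_injective ℂ ℂ h3
  have h5 := congrFun h4 n
  have h6 : (n.factorial : ℂ) ≠ 0 := by exact_mod_cast n.factorial_ne_zero
  rw [h5]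
  field_simp

/-- The exponential of a power series has the Schur polynomials as coefficients. -/
lemma hasSum_SchurP {a : ℕ → ℂ} (ha : ∀ z : ℂ, ‖z‖ < 1 → Summable fun n => a n * z ^ n)
    (ha0 : a 0 = 0) {z : ℂ} (hz : ‖z‖ < 1) :
    HasSum (fun n => SchurP a n * z ^ n) (Complex.exp (∑' n, a n * z ^ n)) := by
  set g : ℂ → ℂ := fun z => ∑' n, a n * z ^ n with hg
  set f : ℂ → ℂ := fun z => Complex.exp (g z) with hf
  have hgd : DifferentiableOn ℂ g (Metric.ball 0 1) := by
    have := (hasFPowerSeriesOnBall_tsum ha).differentiableOn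
    rwa [← ENNReal.ofReal_one, Metric.eball_ofReal] at this
  have hfd : DifferentiableOn ℂ f (Metric.ball 0 1) := hgd.cexp
  have h0 : Metric.ball (0 : ℂ) 1 ∈ nhds 0 := Metric.ball_mem_nhds 0 one_pos
  have hga : AnalyticAt ℂ g 0 := hgd.analyticAt h0
  have hfa : AnalyticAt ℂ f 0 := hfd.analyticAt h0
  have hderiv : deriv f =ᶠ[nhds 0] fun z => deriv g z * f z := by
    filter_upwards [Metric.isOpen_ball.mem_nhds (Metric.mem_ball_self (x := (0 : ℂ)) one_pos)]
      with z hz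
    have := (hgd.differentiableAt (Metric.isOpen_ball.mem_nhds hz)).hasDerivAt.cexp.deriv
    rw [hf, this, mul_comm]
  have hrec : ∀ n, iteratedDeriv (n + 1) f 0 = ∑ i ∈ Finset.range (n + 1),
      (n.choose i : ℂ) * ((i + 1).factorial * a (i + 1)) * iteratedDeriv (n - i) f 0 := by
    intro n
    rw [iteratedDeriv_succ', hderiv.iteratedDeriv_eq,
      iteratedDeriv_fun_mul hga.deriv.contDiffAt hfa.contDiffAt]
    refine Finset.sum_congr rfl fun i _ => ?_
    rw [← iteratedDeriv_succ', iteratedDeriv_tsum_zero ha]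
  have hcoeff : ∀ N n, n ≤ N →
      PowerSeries.coeff n (∏ j ∈ Finset.range N, expMonomial (a (j + 1)) j) =
        (n.factorial : ℂ)⁻¹ * iteratedDeriv n f 0 := by
    intro N n
    induction n using Nat.strong_induction_on with
    | _ n ih =>
      intro hn
      cases n with
      | zero =>
        rw [coeff_zero_prod_expMonomial]
        have : g 0 = 0 := by
          rw [hg]
          simp only
          rw [tsum_eq_single 0 (fun n hn => by simp [hn])]
          simp [ha0]
        simp [hf, this]
      | succ n =>
        have hn1 : (n : ℂ) + 1 ≠ 0 := by exact_mod_cast n.succ_ne_zero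
        apply mul_left_cancel₀ hn1
        rw [coeff_succ_prod_expMonomial a hn, hrec, Finset.mul_sum, Finset.mul_sum]
        refine Finset.sum_congr rfl fun i hi => ?_
        have hi' := Finset.mem_range.1 hi
        rw [ih (n - i) (by omega) (by omega), Nat.choose_eq_factorial_div_factorial (by omega),
          Nat.cast_div (Nat.factorial_mul_factorial_dvd_factorial (by omega))
            (by exact_mod_cast mul_ne_zero i.factorial_ne_zero (n - i).factorial_ne_zero),
          Nat.factorial_succ, Nat.factorial_succ]
        have h1 : (i.factorial : ℂ) ≠ 0 := by exact_mod_cast i.factorial_ne_zero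
        have h2 : (n.factorial : ℂ) ≠ 0 := by exact_mod_cast n.factorial_ne_zero
        have h3 : ((n - i).factorial : ℂ) ≠ 0 := by exact_mod_cast (n - i).factorial_ne_zero
        push_cast
        field_simp
  have h := Complex.hasSum_taylorSeries_on_ball hfd (z := z) (by simpa using hz)
  refine h.congr_fun fun n => ?_
  rw [SchurP_eq_coeff, hcoeff n n le_rfl]
  simp only [sub_zero, smul_eq_mul]
  ring

/-- The double series whose row sums are logarithms and whose column sums are zeta values. -/
noncomputable def zetaDouble (z : ℂ) (n r : ℕ) : ℂ :=
  if 2 ≤ r then (z / (n + 1)) ^ r / r else 0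

lemma hasSum_neg_log_sub {w : ℂ} (hw : ‖w‖ < 1) :
    HasSum (fun r : ℕ => if 2 ≤ r then w ^ r / r else 0) (-Complex.log (1 - w) - w) := by
  refine ((Complex.hasSum_taylorSeries_neg_log hw).sub (hasSum_ite_eq 1 w)).congr_fun fun r => ?_
  rcases r with _ | _ | r
  · simp
  · simp
  · simp

lemma hasSum_zeta_column (z : ℂ) (r : ℕ) :
    HasSum (fun n : ℕ => zetaDouble z n r) (zhat r * z ^ r) := by
  by_cases hr : 2 ≤ r
  · simp only [zetaDouble, zhat, if_pos hr]
    have hs : Summable fun n : ℕ => 1 / (n : ℂ) ^ r := by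
      have := (Real.summable_one_div_nat_pow (p := r)).2 (by omega)
      refine Summable.of_norm ?_
      simpa using this
    have h1 := hs.hasSum
    rw [← zeta_nat_eq_tsum_of_gt_one (by omega)] at h1
    have h2 := (hasSum_nat_add_iff' 1).2 h1
    have hr0 : r ≠ 0 := by omega
    simp only [Finset.range_one, Finset.sum_singleton, Nat.cast_zero, zero_pow hr0, div_zero,
      sub_zero] at h2
    have h3 := h2.mul_right (z ^ r / r)
    have h4 : riemannZeta r / r * z ^ r = riemannZeta r * (z ^ r / r) := by ring
    rw [h4]
    refine h3.congr_fun fun n => ?_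
    rw [div_pow]
    push_cast
    ring
  · simp only [zetaDouble, zhat, if_neg hr, zero_mul]
    exact hasSum_zero

lemma summable_zeta_double {z : ℂ} (hz : ‖z‖ < 1) :
    Summable fun p : ℕ × ℕ => zetaDouble z p.1 p.2 := by
  have h1 : Summable fun n : ℕ => 1 / ((n : ℝ) + 1) ^ 2 := by
    have := (Real.summable_one_div_nat_pow (p := 2)).2 (by omega)
    simpa using (summable_nat_add_iff 1).2 this
  have h2 := summable_geometric_of_lt_one (norm_nonneg z) hz
  refine Summable.of_norm_bounded (h1.mul_of_nonneg h2 (fun _ => by positivity)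
    (fun _ => by positivity)) fun p => ?_
  obtain ⟨n, r⟩ := p
  dsimp only [zetaDouble]
  split_ifs with hr
  · have hr1 : (1 : ℝ) ≤ r := by exact_mod_cast (by omega : 1 ≤ r)
    have hn : ‖(n : ℂ) + 1‖ = n + 1 := by
      have : (n : ℂ) + 1 = ((n + 1 : ℕ) : ℂ) := by push_cast; rfl
      rw [this, Complex.norm_natCast]
      push_cast
      rfl
    rw [norm_div, norm_pow, norm_div, hn, Complex.norm_natCast, div_pow]
    refine (div_le_self (by positivity) hr1).trans ?_
    rw [div_eq_mul_one_div, mul_comm]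
    gcongr
    · linarith [(Nat.cast_nonneg n : (0 : ℝ) ≤ n)]
  · simp only [norm_zero]
    positivity

lemma hasSum_zhat {z : ℂ} (hz : ‖z‖ < 1) :
    HasSum (fun r => zhat r * z ^ r) (∑' p : ℕ × ℕ, zetaDouble z p.1 p.2) := by
  have h1 : HasSum (fun p : ℕ × ℕ => zetaDouble z p.2 p.1)
      (∑' p : ℕ × ℕ, zetaDouble z p.1 p.2) := by
    have h := (summable_zeta_double hz).hasSum
    rw [← (Equiv.prodComm ℕ ℕ).hasSum_iff] at h
    exact h
  exact h1.prod_fiberwise fun r => hasSum_zeta_column z r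

lemma tendsto_prod_mul_exp {z : ℂ} (hz : ‖z‖ < 1) :
    Filter.Tendsto (fun N : ℕ => ∏ n ∈ Finset.range N, (1 - z / (n + 1)) * Complex.exp (z / (n + 1)))
      Filter.atTop (nhds (Complex.exp (-∑' r, zhat r * z ^ r))) := by
  have hw : ∀ n : ℕ, ‖z / (n + 1)‖ < 1 := by
    intro n
    have hn : ‖(n : ℂ) + 1‖ = n + 1 := by
      have : (n : ℂ) + 1 = ((n + 1 : ℕ) : ℂ) := by push_cast; rfl
      rw [this, Complex.norm_natCast]
      push_cast
      rfl
    rw [norm_div, hn]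
    refine (div_le_self (norm_nonneg z) ?_).trans_lt hz
    linarith [(Nat.cast_nonneg n : (0 : ℝ) ≤ n)]
  have hS := summable_zeta_double hz
  have hrow : HasSum (fun n : ℕ => -Complex.log (1 - z / (n + 1)) - z / (n + 1))
      (∑' p : ℕ × ℕ, zetaDouble z p.1 p.2) := by
    have hf : ∀ n : ℕ, HasSum (fun r => zetaDouble z n r)
        (-Complex.log (1 - z / (n + 1)) - z / (n + 1)) := fun n => hasSum_neg_log_sub (hw n)
    exact hS.hasSum.prod_fiberwise hf
  rw [(hasSum_zhat hz).tsum_eq]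
  have hlim := (Complex.continuous_exp.tendsto _).comp hrow.tendsto_sum_nat.neg
  refine hlim.congr fun N => ?_
  simp only [Function.comp_apply]
  rw [← Finset.sum_neg_distrib, Complex.exp_sum]
  refine Finset.prod_congr rfl fun n _ => ?_
  have hne : 1 - z / (n + 1) ≠ 0 := by
    intro h
    have h1 := hw n
    rw [← sub_eq_zero.1 h] at h1
    simp at h1
  rw [neg_sub, sub_neg_eq_add, add_comm, Complex.exp_add, Complex.exp_log hne]

lemma hasSum_SchurP_zhat {z : ℂ} (hz : ‖z‖ < 1) :
    HasSum (fun n => SchurP zhat n * z ^ n) (Complex.exp (∑' n, zhat n * z ^ n)) :=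
  hasSum_SchurP (fun _ hz => (hasSum_zhat hz).summable) (by simp [zhat]) hz

lemma hasSum_SchurP_neg_zhat {z : ℂ} (hz : ‖z‖ < 1) :
    HasSum (fun n => SchurP (fun n => -zhat n) n * z ^ n)
      (Complex.exp (-∑' n, zhat n * z ^ n)) := by
  have h := hasSum_SchurP (a := fun n => -zhat n)
    (fun z hz => by simpa only [neg_mul] using (hasSum_zhat hz).summable.neg) (by simp [zhat]) hz
  simpa only [neg_mul, tsum_neg] using h

lemma hasSum_coeff_mul {A B : PowerSeries ℂ} {z a b : ℂ}
    (hA : HasSum (fun n => PowerSeries.coeff n A * z ^ n) a)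
    (hB : HasSum (fun n => PowerSeries.coeff n B * z ^ n) b) :
    HasSum (fun n => PowerSeries.coeff n (A * B) * z ^ n) (a * b) := by
  have hA' := hA.summable.norm
  have hB' := hB.summable.norm
  have h1 := (summable_norm_sum_mul_antidiagonal_of_summable_norm hA' hB').of_norm.hasSum
  rw [← tsum_mul_tsum_eq_tsum_sum_antidiagonal_of_summable_norm hA' hB', hA.tsum_eq,
    hB.tsum_eq] at h1
  refine h1.congr_fun fun n => ?_
  rw [PowerSeries.coeff_mul, Finset.sum_mul]
  refine Finset.sum_congr rfl fun p hp => ?_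
  rw [← Finset.HasAntidiagonal.mem_antidiagonal.1 hp, pow_add]
  ring

lemma eq_zero_of_hasSum_zero {p : ℕ → ℂ} {ε : ℝ} (hε : 0 < ε)
    (h : ∀ t : ℝ, 0 < t → t < ε → HasSum (fun n => p n * (t : ℂ) ^ n) 0) (n : ℕ) : p n = 0 := by
  set u : ℝ := ε / 2 with hu
  have hu0 : 0 < u := by positivity
  have huε : u < ε := by linarith
  have hq : ∀ z : ℂ, ‖z‖ < 1 → Summable fun n => p n * (u : ℂ) ^ n * z ^ n := by
    intro z hz
    refine Summable.of_norm_bounded (h u hu0 huε).summable.norm fun n => ?_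
    rw [norm_mul, norm_pow z]
    exact mul_le_of_le_one_right (norm_nonneg _) (pow_le_one₀ (norm_nonneg _) hz.le)
  have han := (hasFPowerSeriesOnBall_tsum hq).analyticAt
  have hfreq : ∃ᶠ z : ℂ in nhdsWithin 0 {0}ᶜ, ∑' n, p n * (u : ℂ) ^ n * z ^ n = 0 := by
    have htend : Filter.Tendsto (fun s : ℝ => (s : ℂ)) (nhdsWithin 0 (Set.Ioi 0))
        (nhdsWithin 0 {0}ᶜ) := by
      refine tendsto_nhdsWithin_iff.2 ⟨?_, ?_⟩
      · exact (Complex.continuous_ofReal.tendsto' 0 0 (by simp)).mono_left nhdsWithin_le_nhds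
      · filter_upwards [self_mem_nhdsWithin] with s hs
        simpa using (Set.mem_Ioi.1 hs).ne'
    refine htend.frequently (Filter.Eventually.frequently ?_)
    filter_upwards [self_mem_nhdsWithin, nhdsWithin_le_nhds (Iio_mem_nhds one_pos)] with s hs hs1
    have := (h (u * s) (mul_pos hu0 hs)
      ((mul_le_of_le_one_right hu0.le (le_of_lt hs1)).trans_lt huε)).tsum_eq
    rw [← this]
    refine tsum_congr fun n => ?_
    push_cast
    rw [mul_pow]
    ring
  have hev := han.frequently_zero_iff_eventually_zero.1 hfreq
  have h1 := iteratedDeriv_tsum_zero hq n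
  have hev' : (fun z : ℂ => ∑' n, p n * (u : ℂ) ^ n * z ^ n) =ᶠ[nhds 0] fun _ => 0 := hev
  rw [hev'.iteratedDeriv_eq] at h1
  have h2 : iteratedDeriv n (fun _ : ℂ => (0 : ℂ)) 0 = 0 := by simp
  rw [h2] at h1
  have h3 : (n.factorial : ℂ) ≠ 0 := by exact_mod_cast n.factorial_ne_zero
  have h4 : (u : ℂ) ^ n ≠ 0 := pow_ne_zero _ (by exact_mod_cast hu0.ne')
  have h5 := mul_eq_zero.1 h1.symm
  exact (mul_eq_zero.1 (h5.resolve_left h3)).resolve_right h4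

/-- The power series `exp (ζ̂ (X) + ζ̂ (y X) - ζ̂ (α X) - ζ̂ (β X))`, where
`ζ̂ (X) = ∑ r ≥ 2, ζ(r) / r * X ^ r`. -/
noncomputable def zetaSeries (y α β : ℂ) : PowerSeries ℂ :=
  PowerSeries.mk (SchurP zhat) * PowerSeries.rescale y (PowerSeries.mk (SchurP zhat)) *
    (PowerSeries.rescale α (PowerSeries.mk (SchurP fun n => -zhat n)) *
      PowerSeries.rescale β (PowerSeries.mk (SchurP fun n => -zhat n)))

lemma hasSum_zetaSeries {y α β t : ℂ} (ht : ‖t‖ < 1) (hy : ‖y * t‖ < 1) (hα : ‖α * t‖ < 1)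
    (hβ : ‖β * t‖ < 1) :
    HasSum (fun n => PowerSeries.coeff n (zetaSeries y α β) * t ^ n)
      (Complex.exp (∑' n, zhat n * t ^ n) * Complex.exp (∑' n, zhat n * (y * t) ^ n) *
        (Complex.exp (-∑' n, zhat n * (α * t) ^ n) *
          Complex.exp (-∑' n, zhat n * (β * t) ^ n))) := by
  refine hasSum_coeff_mul (hasSum_coeff_mul ?_ ?_) (hasSum_coeff_mul ?_ ?_)
  · simpa using hasSum_SchurP_zhat ht
  · refine (hasSum_SchurP_zhat hy).congr_fun fun n => ?_
    rw [PowerSeries.coeff_rescale, PowerSeries.coeff_mk, mul_pow]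
    ring
  · refine (hasSum_SchurP_neg_zhat hα).congr_fun fun n => ?_
    rw [PowerSeries.coeff_rescale, PowerSeries.coeff_mk, mul_pow]
    ring
  · refine (hasSum_SchurP_neg_zhat hβ).congr_fun fun n => ?_
    rw [PowerSeries.coeff_rescale, PowerSeries.coeff_mk, mul_pow]
    ring

lemma tendsto_prod_ratio {x y t : ℝ} {α β : ℂ} (hsum : α + β = 1 + y) (hprod : α * β = x)
    (ht : ‖(t : ℂ)‖ < 1) (hy : ‖(y : ℂ) * t‖ < 1) (hα : ‖α * t‖ < 1) (hβ : ‖β * t‖ < 1) :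
    Filter.Tendsto (fun N : ℕ => ((∏ n ∈ Finset.range N,
        (((n : ℝ) + 1) ^ 2 - (t + y * t) * (n + 1) + x * t ^ 2) /
          ((n + 1 - t) * (n + 1 - y * t)) : ℝ) : ℂ)) Filter.atTop
      (nhds (Complex.exp (∑' n, zhat n * (t : ℂ) ^ n) *
        Complex.exp (∑' n, zhat n * (y * t : ℂ) ^ n) *
        (Complex.exp (-∑' n, zhat n * (α * t) ^ n) *
          Complex.exp (-∑' n, zhat n * (β * t) ^ n)))) := by
  have h := ((tendsto_prod_mul_exp hα).mul (tendsto_prod_mul_exp hβ)).div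
    ((tendsto_prod_mul_exp ht).mul (tendsto_prod_mul_exp hy))
    (mul_ne_zero (Complex.exp_ne_zero _) (Complex.exp_ne_zero _))
  have e : ∀ a b c d : ℂ, Complex.exp a * Complex.exp b * (Complex.exp c * Complex.exp d) =
      (Complex.exp c * Complex.exp d) / (Complex.exp (-a) * Complex.exp (-b)) := by
    intro a b c d
    rw [Complex.exp_neg, Complex.exp_neg]
    have := Complex.exp_ne_zero a
    have := Complex.exp_ne_zero b
    field_simp
  rw [e]
  refine h.congr fun N => ?_
  simp only [Pi.div_apply]
  rw [← Finset.prod_mul_distrib, ← Finset.prod_mul_distrib, ← Finset.prod_div_distrib,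
    Complex.ofReal_prod]
  refine Finset.prod_congr rfl fun n _ => ?_
  have hn : (n : ℂ) + 1 ≠ 0 := by exact_mod_cast n.succ_ne_zero
  have hexp : Complex.exp (α * t / (n + 1)) * Complex.exp (β * t / (n + 1)) =
      Complex.exp (t / (n + 1)) * Complex.exp (y * t / (n + 1)) := by
    rw [← Complex.exp_add, ← Complex.exp_add]
    congr 1
    rw [← add_div, ← add_div, ← add_mul, hsum]
    ring
  have hE : Complex.exp (t / (n + 1)) * Complex.exp (y * t / (n + 1)) ≠ 0 :=
    mul_ne_zero (Complex.exp_ne_zero _) (Complex.exp_ne_zero _)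
  have e1 : ∀ a b E F : ℂ, a * E * (b * F) = a * b * (E * F) := by intros; ring
  rw [e1 (1 - α * t / (n + 1)), e1 (1 - (t : ℂ) / (n + 1)), hexp, mul_div_mul_right _ _ hE]
  push_cast
  have h1 : ((n : ℂ) + 1) ^ 2 - (t + y * t) * (n + 1) + x * t ^ 2 =
      (n + 1) ^ 2 * ((1 - α * t / (n + 1)) * (1 - β * t / (n + 1))) := by
    have : (t : ℂ) + y * t = (α + β) * t := by rw [hsum]; ring
    rw [this, ← hprod]
    field_simp
    ring
  have h2 : ((n : ℂ) + 1 - t) * (n + 1 - y * t) =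
      (n + 1) ^ 2 * ((1 - t / (n + 1)) * (1 - y * t / (n + 1))) := by
    field_simp
  rw [h1, h2, mul_div_mul_left _ _ (pow_ne_zero 2 hn)]

lemma genCoeff_eq_coeff_zetaSeries {x y : ℝ} (hx : 0 < x) (hy : 0 < y) {α β : ℂ}
    (hsum : α + β = 1 + y) (hprod : α * β = x) {K : ℕ} (hK : K ≠ 0) :
    (x - y : ℂ) * genCoeff x y K = x * PowerSeries.coeff K (zetaSeries y α β) := by
  have hsmall : ∀ᶠ t : ℝ in nhdsWithin 0 (Set.Ioi 0), t ≤ 1 / 2 ∧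
      y * t + 2 * (x * t ^ 2) ≤ 1 / 3 ∧ ‖(t : ℂ)‖ < 1 ∧ ‖(y : ℂ) * t‖ < 1 ∧ ‖α * t‖ < 1 ∧
        ‖β * t‖ < 1 := by
    refine Filter.Eventually.filter_mono nhdsWithin_le_nhds ?_
    have aux : ∀ (f : ℝ → ℝ) (c : ℝ), Continuous f → f 0 < c → ∀ᶠ t in nhds 0, f t < c :=
      fun f c hf h0 => hf.continuousAt.eventually_lt_const h0
    have a1 := aux (fun t => t) (1 / 2) (by fun_prop) (by norm_num)
    have a2 := aux (fun t => y * t + 2 * (x * t ^ 2)) (1 / 3) (by fun_prop) (by norm_num)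
    have a3 := aux (fun t => ‖(t : ℂ)‖) 1 (by fun_prop) (by norm_num)
    have a4 := aux (fun t => ‖(y : ℂ) * t‖) 1 (by fun_prop) (by norm_num)
    have a5 := aux (fun t => ‖α * t‖) 1 (by fun_prop) (by norm_num)
    have a6 := aux (fun t => ‖β * t‖) 1 (by fun_prop) (by norm_num)
    filter_upwards [a1, a2, a3, a4, a5, a6] with t b1 b2 b3 b4 b5 b6
    exact ⟨b1.le, b2.le, b3, b4, b5, b6⟩
  obtain ⟨ε, hε, hsub⟩ := mem_nhdsGT_iff_exists_Ioo_subset.1 hsmall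
  have hx' : (x : ℂ) ≠ 0 := by exact_mod_cast hx.ne'
  have key := eq_zero_of_hasSum_zero (p := fun n =>
    PowerSeries.coeff n (zetaSeries y α β) - ((if n = 0 then 1 else 0) +
      (x - y : ℂ) / x * genCoeff x y n)) hε (fun t ht0 htε => by
    obtain ⟨b1, b2, b3, b4, b5, b6⟩ := hsub ⟨ht0, htε⟩
    obtain ⟨S, hS, hlim⟩ := hasSum_genCoeff_and_tendsto hx hy ht0 b1 b2
    have hlim' := (Complex.continuous_ofReal.tendsto _).comp hlim
    have heq := tendsto_nhds_unique hlim' (tendsto_prod_ratio hsum hprod b3 b4 b5 b6)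
    have hF := hasSum_zetaSeries b3 b4 b5 b6
    rw [← heq] at hF
    have hS' := (Complex.hasSum_ofReal.2 hS).mul_left ((x - y : ℂ) / x)
    have h0 := hF.sub ((hasSum_ite_eq (0 : ℕ) (1 : ℂ)).add hS')
    have hz : ((1 + (x - y) / x * S : ℝ) : ℂ) - (1 + (x - y : ℂ) / x * (S : ℂ)) = 0 := by
      push_cast
      ring
    rw [hz] at h0
    refine h0.congr_fun fun n => ?_
    by_cases hn : n = 0
    · subst hn
      simp
    · simp only [if_neg hn]
      push_cast
      ring) K
  simp only [if_neg hK, zero_add] at key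
  rw [sub_eq_zero.1 key]
  field_simp

open Finset.HasAntidiagonal (antidiagonal mem_antidiagonal)

lemma sum_range_fold (f : ℕ → ℂ) (e : ℕ) :
    ∑ c ∈ Finset.range (e + 1), f c =
      ∑ c ∈ Finset.range (e / 2 + 1), (f c + if 2 * c < e then f (e - c) else 0) := by
  rw [Finset.sum_add_distrib, ← Finset.sum_filter_add_sum_filter_not (Finset.range (e + 1))
    (fun c => 2 * c ≤ e)]
  congr 1
  · refine Finset.sum_congr ?_ fun _ _ => rfl
    ext c
    simp only [Finset.mem_filter, Finset.mem_range]
    omega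
  · rw [← Finset.sum_filter]
    refine Finset.sum_nbij' (fun c => e - c) (fun c => e - c) ?_ ?_ ?_ ?_ ?_
    · intro c hc
      simp only [Finset.mem_filter, Finset.mem_range] at hc ⊢
      omega
    · intro c hc
      simp only [Finset.mem_filter, Finset.mem_range] at hc ⊢
      omega
    · intro c hc
      simp only [Finset.mem_filter, Finset.mem_range] at hc
      omega
    · intro c hc
      simp only [Finset.mem_filter, Finset.mem_range] at hc
      omega
    · intro c hc
      simp only [Finset.mem_filter, Finset.mem_range] at hc
      congr 1
      omega

lemma sum_antidiagonal_exchange (g : ℕ → ℕ → ℕ → ℕ → ℂ) (M : ℕ) :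
    ∑ p ∈ antidiagonal M, ∑ u ∈ antidiagonal p.1, ∑ v ∈ antidiagonal p.2,
        g u.1 u.2 v.1 v.2 =
      ∑ p ∈ antidiagonal M, ∑ v ∈ antidiagonal p.2, ∑ u ∈ antidiagonal p.1,
        g v.2 u.2 v.1 u.1 := by
  simp only [Finset.sum_sigma']
  refine Finset.sum_nbij'
    (fun s => ⟨(s.2.2.2 + s.2.1.2, s.2.2.1 + s.2.1.1), ⟨(s.2.2.1, s.2.1.1), (s.2.2.2, s.2.1.2)⟩⟩)
    (fun s => ⟨(s.2.1.2 + s.2.2.2, s.2.1.1 + s.2.2.1), ⟨(s.2.1.2, s.2.2.2), (s.2.1.1, s.2.2.1)⟩⟩)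
    ?_ ?_ ?_ ?_ ?_
  · rintro ⟨⟨p, n⟩, ⟨a, b⟩, i, j⟩ h
    simp only [Finset.mem_sigma, mem_antidiagonal, and_true] at h ⊢
    omega
  · rintro ⟨⟨p, n⟩, ⟨a, b⟩, i, j⟩ h
    simp only [Finset.mem_sigma, mem_antidiagonal, and_true] at h ⊢
    omega
  · rintro ⟨⟨p, n⟩, ⟨a, b⟩, i, j⟩ h
    simp only [Finset.mem_sigma, mem_antidiagonal] at h
    obtain ⟨-, rfl, rfl⟩ := h
    rfl
  · rintro ⟨⟨p, n⟩, ⟨a, b⟩, i, j⟩ h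
    simp only [Finset.mem_sigma, mem_antidiagonal] at h
    obtain ⟨-, rfl, rfl⟩ := h
    rfl
  · rintro ⟨⟨p, n⟩, ⟨a, b⟩, i, j⟩ h
    rfl

/-- The integers `N i j` express power sums in two variables through the elementary symmetric
polynomials. -/
def IsPowerSumCoeff (N : ℕ → ℕ → ℤ) : Prop :=
  ∀ n : ℕ, 1 ≤ n →
      (MvPolynomial.X 0 : MvPolynomial (Fin 2) ℤ) ^ n + MvPolynomial.X 1 ^ n =
        ∑ ij ∈ (Finset.range (n + 1) ×ˢ Finset.range (n + 1)).filter
            (fun ij => ij.1 + 2 * ij.2 = n),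
          MvPolynomial.C (N ij.1 ij.2) * (MvPolynomial.X 0 + MvPolynomial.X 1) ^ ij.1 *
            (MvPolynomial.X 0 * MvPolynomial.X 1) ^ ij.2

lemma IsPowerSumCoeff.eval {N : ℕ → ℕ → ℤ} (hN : IsPowerSumCoeff N) (hN0 : N 0 0 = 1)
    (α β : ℂ) (n : ℕ) :
    β ^ n + (if 0 < n then α ^ n else 0) =
      ∑ j ∈ Finset.range (n / 2 + 1),
        (N (n - 2 * j) j : ℂ) * (α + β) ^ (n - 2 * j) * (α * β) ^ j := by
  rcases Nat.eq_zero_or_pos n with rfl | hn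
  · simp [hN0]
  · have h := congrArg (MvPolynomial.aeval ![α, β]) (hN n hn)
    simp only [map_add, map_pow, map_sum, map_mul, MvPolynomial.aeval_X,
      Matrix.cons_val_zero, Matrix.cons_val_one, eq_intCast] at h
    rw [if_pos hn, add_comm, h]
    refine Finset.sum_nbij' (fun ij => ij.2) (fun j => (n - 2 * j, j)) ?_ ?_ ?_ ?_ ?_
    · rintro ⟨i, j⟩ h
      simp only [Finset.mem_filter, Finset.mem_product, Finset.mem_range] at h ⊢
      omega
    · intro j h
      simp only [Finset.mem_filter, Finset.mem_product, Finset.mem_range] at h ⊢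
      omega
    · rintro ⟨i, j⟩ h
      simp only [Finset.mem_filter, Finset.mem_product, Finset.mem_range] at h
      have : n - 2 * j = i := by omega
      simp [this]
    · intro j h
      rfl
    · rintro ⟨i, j⟩ h
      simp only [Finset.mem_filter, Finset.mem_product, Finset.mem_range] at h
      have : i = n - 2 * j := by omega
      simp [this]

lemma IsPowerSumCoeff.coeff_rescale_mul_rescale {N : ℕ → ℕ → ℤ} (hN : IsPowerSumCoeff N)
    (hN0 : N 0 0 = 1) (α β : ℂ) (Q : ℕ → ℂ) (e : ℕ) :
    PowerSeries.coeff e (PowerSeries.rescale α (PowerSeries.mk Q) *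
        PowerSeries.rescale β (PowerSeries.mk Q)) =
      ∑ m ∈ Finset.range (e / 2 + 1), ∑ μ ∈ Finset.range (m + 1),
        (α * β) ^ m * (Q μ * Q (e - μ) * N (e - 2 * m) (m - μ)) * (α + β) ^ (e - 2 * m) := by
  have h1 : ∀ c ∈ Finset.range (e / 2 + 1),
      (α ^ c * Q c * (β ^ (e - c) * Q (e - c)) +
        if 2 * c < e then α ^ (e - c) * Q (e - c) * (β ^ (e - (e - c)) * Q (e - (e - c))) else 0) =
      ∑ j ∈ Finset.range ((e - 2 * c) / 2 + 1), (α * β) ^ (c + j) *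
        (Q c * Q (e - c) * N (e - 2 * (c + j)) j) * (α + β) ^ (e - 2 * (c + j)) := by
    intro c hc
    have hc' : 2 * c ≤ e := by
      have := Finset.mem_range.1 hc
      omega
    obtain ⟨n, rfl⟩ := Nat.exists_eq_add_of_le hc'
    have e1 : 2 * c + n - c = n + c := by omega
    have e2 : 2 * c + n - (n + c) = c := by omega
    have e3 : 2 * c + n - 2 * c = n := by omega
    have e4 : (2 * c < 2 * c + n) ↔ 0 < n := by omega
    have e5 : ∀ j, 2 * c + n - 2 * (c + j) = n - 2 * j := by intro j; omega
    simp only [e1, e2, e3, e4, e5]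
    have hev := congrArg (fun w => (α * β) ^ c * (Q c * Q (n + c)) * w) (hN.eval hN0 α β n)
    simp only [Finset.mul_sum] at hev
    refine Eq.trans ?_ (hev.trans (Finset.sum_congr rfl fun j _ => ?_))
    · split_ifs
      · rw [pow_add, pow_add, mul_pow]
        ring
      · rw [pow_add, mul_pow]
        ring
    · rw [pow_add]
      ring
  rw [PowerSeries.coeff_mul, Finset.Nat.sum_antidiagonal_eq_sum_range_succ_mk]
  simp only [PowerSeries.coeff_rescale, PowerSeries.coeff_mk]
  rw [sum_range_fold, Finset.sum_congr rfl h1, Finset.sum_sigma', Finset.sum_sigma']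
  refine Finset.sum_nbij' (fun s => ⟨s.1 + s.2, s.1⟩) (fun s => ⟨s.2, s.1 - s.2⟩) ?_ ?_ ?_ ?_ ?_
  · rintro ⟨c, j⟩ h
    simp only [Finset.mem_sigma, Finset.mem_range] at h ⊢
    omega
  · rintro ⟨c, j⟩ h
    simp only [Finset.mem_sigma, Finset.mem_range] at h ⊢
    omega
  · rintro ⟨c, j⟩ h
    simp
  · rintro ⟨m, μ⟩ h
    simp only [Finset.mem_sigma, Finset.mem_range] at h
    have : μ + (m - μ) = m := by omega
    simp [this]
  · rintro ⟨c, j⟩ h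
    simp

/-- The triple sum of products of Schur polynomials in the Ohno–Zagier relation. -/
noncomputable def schurTripleSum (N : ℕ → ℕ → ℤ) (k l m : ℕ) : ℂ :=
  ∑ i ∈ Finset.range (k + 1), ∑ j ∈ Finset.range (l + 1), ∑ μ ∈ Finset.range (m + 1),
    (Nat.choose (i + j) i : ℂ) * SchurP zhat (k - i) * SchurP zhat (l - j) *
      SchurP (fun n => -zhat n) μ * SchurP (fun n => -zhat n) (i + j + 2 * m - μ) *
      (N (i + j) (m - μ) : ℂ)

lemma schurTripleSum_swap (N : ℕ → ℕ → ℤ) (k l m : ℕ) :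
    schurTripleSum N k l m = schurTripleSum N l k m := by
  rw [schurTripleSum, schurTripleSum, Finset.sum_comm]
  refine Finset.sum_congr rfl fun j _ => Finset.sum_congr rfl fun i _ =>
    Finset.sum_congr rfl fun μ _ => ?_
  rw [add_comm j i, Nat.choose_symm_add]
  ring

lemma coeff_zetaSeries {N : ℕ → ℕ → ℤ} (hN : IsPowerSumCoeff N) (hN0 : N 0 0 = 1)
    {x y α β : ℂ} (hsum : α + β = 1 + y) (hprod : α * β = x) (K : ℕ) :
    PowerSeries.coeff K (zetaSeries y α β) =
      ∑ m ∈ Finset.range (K / 2 + 1), x ^ m * ∑ p ∈ antidiagonal (K - 2 * m),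
        y ^ p.1 * schurTripleSum N p.2 p.1 m := by
  set P := SchurP zhat with hP
  set Q := SchurP fun n => -zhat n with hQ
  obtain ⟨A, hAdef⟩ : ∃ A : ℕ → ℂ, A = fun p =>
      ∑ u ∈ antidiagonal p, P u.1 * (y ^ u.2 * P u.2) := ⟨_, rfl⟩
  have hA : ∀ p, PowerSeries.coeff p
      (PowerSeries.mk P * PowerSeries.rescale y (PowerSeries.mk P)) = A p := by
    intro p
    rw [hAdef]
    simp [PowerSeries.coeff_mul, PowerSeries.coeff_rescale]
  set c : ℕ → ℕ → ℂ := fun n m => ∑ μ ∈ Finset.range (m + 1),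
    Q μ * Q (n + 2 * m - μ) * N n (m - μ) with hc
  obtain ⟨D, hDdef⟩ : ∃ D : ℕ → ℕ → ℂ, D = fun m n => ∑ v ∈ antidiagonal n,
      c (v.1 + v.2) m * ((v.1 + v.2).choose v.1 * y ^ v.2) := ⟨_, rfl⟩
  have hB : ∀ e, PowerSeries.coeff e (PowerSeries.rescale α (PowerSeries.mk Q) *
        PowerSeries.rescale β (PowerSeries.mk Q)) =
      ∑ m ∈ Finset.range (e / 2 + 1), x ^ m * D m (e - 2 * m) := by
    intro e
    rw [hDdef, hN.coeff_rescale_mul_rescale hN0]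
    refine Finset.sum_congr rfl fun m hm => ?_
    have hm' := Finset.mem_range.1 hm
    obtain ⟨n, rfl⟩ := Nat.exists_eq_add_of_le (by omega : 2 * m ≤ e)
    have e3 : 2 * m + n - 2 * m = n := by omega
    rw [← Finset.sum_mul, ← Finset.mul_sum, hsum, hprod, mul_assoc, e3]
    congr 1
    rw [(Commute.all (1 : ℂ) y).add_pow', Finset.mul_sum]
    refine Finset.sum_congr rfl fun v hv => ?_
    have hv' := mem_antidiagonal.1 hv
    rw [hv', hc]
    simp only [one_pow, one_mul, nsmul_eq_mul, add_comm n]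
  have hL : ∀ M m, ∑ p ∈ antidiagonal M, A p.1 * D m p.2 =
      ∑ p ∈ antidiagonal M, y ^ p.1 * schurTripleSum N p.2 p.1 m := by
    intro M m
    simp only [hAdef, hDdef, Finset.sum_mul_sum]
    rw [sum_antidiagonal_exchange fun a b i j => P a * (y ^ b * P b) *
      (c (i + j) m * ((i + j).choose i * y ^ j))]
    refine Finset.sum_congr rfl fun p _ => ?_
    rw [schurTripleSum, Finset.mul_sum, Finset.Nat.sum_antidiagonal_eq_sum_range_succ_mk]
    refine Finset.sum_congr rfl fun i _ => ?_
    rw [Finset.mul_sum, Finset.Nat.sum_antidiagonal_eq_sum_range_succ_mk]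
    refine Finset.sum_congr rfl fun j hj => ?_
    have hj' := Finset.mem_range.1 hj
    have hpow : y ^ p.1 = y ^ (p.1 - j) * y ^ j := by
      rw [← pow_add]
      congr 1
      omega
    simp only [hc, hpow, Finset.mul_sum, Finset.sum_mul]
    refine Finset.sum_congr rfl fun μ _ => ?_
    ring
  rw [zetaSeries, PowerSeries.coeff_mul]
  simp only [← hP, ← hQ, hA, hB]
  simp only [← hL, Finset.mul_sum]
  rw [Finset.sum_sigma', Finset.sum_sigma']
  refine Finset.sum_nbij' (fun s => ⟨s.2, (s.1.1, s.1.2 - 2 * s.2)⟩)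
    (fun s => ⟨(s.2.1, s.2.2 + 2 * s.1), s.1⟩) ?_ ?_ ?_ ?_ ?_
  · rintro ⟨⟨p, e⟩, m⟩ h
    simp only [Finset.mem_sigma, Finset.mem_range, mem_antidiagonal] at h ⊢
    omega
  · rintro ⟨m, p, n⟩ h
    simp only [Finset.mem_sigma, Finset.mem_range, mem_antidiagonal] at h ⊢
    omega
  · rintro ⟨⟨p, e⟩, m⟩ h
    simp only [Finset.mem_sigma, Finset.mem_range, mem_antidiagonal] at h
    have : e - 2 * m + 2 * m = e := by omega
    simp [this]
  · rintro ⟨m, p, n⟩ h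
    simp
  · rintro ⟨⟨p, e⟩, m⟩ h
    ring

lemma G0one_eq_zero {K n s : ℕ} (h : ¬(1 ≤ s ∧ s ≤ n ∧ n + s ≤ K)) : G0one K n s = 0 := by
  rw [G0one]
  refine Finset.sum_eq_zero fun c hc => ?_
  have h1 := le_of_mem_G0set hc
  have h2 := one_le_and_le_of_mem_G0set hc
  exact absurd ⟨h2.1, h2.2, h1⟩ h

lemma sub_mul_genCoeff (x y : ℝ) (K : ℕ) :
    (x - y) * genCoeff x y K = x * ∑ m ∈ Finset.range (K / 2 + 1),
      x ^ m * ∑ p ∈ antidiagonal (K - 2 * m), y ^ p.1 * Gbar0one K (p.1 + m) m := by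
  have hx : genCoeff x y K = ∑ m ∈ Finset.range (K / 2 + 1),
      x ^ m * ∑ p ∈ antidiagonal (K - 2 * m), y ^ p.1 * G0one K (p.1 + m) m := by
    simp only [Finset.mul_sum]
    rw [genCoeff, Finset.sum_comm, Finset.sum_sigma', Finset.sum_sigma']
    symm
    refine Finset.sum_of_injOn (fun s => ⟨s.1, s.2.1⟩) ?_ ?_ ?_ ?_
    · rintro ⟨m, l, k⟩ h ⟨m', l', k'⟩ h' heq
      simp only [Finset.mem_coe, Finset.mem_sigma, Finset.mem_range,
        mem_antidiagonal] at h h'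
      simp only [Sigma.mk.injEq, heq_eq_eq] at heq
      obtain ⟨rfl, rfl⟩ := heq
      have : k = k' := by omega
      rw [this]
    · rintro ⟨m, l, k⟩ h
      simp only [Finset.mem_coe, Finset.mem_sigma, Finset.mem_range,
        mem_antidiagonal] at h ⊢
      omega
    · rintro ⟨m, l⟩ h h'
      rw [G0one_eq_zero, zero_mul]
      intro hc
      apply h'
      dsimp only at hc
      refine ⟨⟨m, l, K - 2 * m - l⟩, ?_, rfl⟩
      simp only [Finset.mem_coe, Finset.mem_sigma, Finset.mem_range,
        mem_antidiagonal]
      omega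
    · rintro ⟨m, l, k⟩ h
      ring
  have hy : y * genCoeff x y K = x * ∑ m ∈ Finset.range (K / 2 + 1),
      x ^ m * ∑ p ∈ antidiagonal (K - 2 * m), y ^ p.1 * G0one K (p.1 + m) (m + 1) := by
    simp only [Finset.mul_sum]
    rw [genCoeff, Finset.sum_comm, Finset.mul_sum]
    simp only [Finset.mul_sum]
    rw [Finset.sum_sigma', Finset.sum_sigma', ← Finset.sum_filter_of_ne
      (p := fun s => 1 ≤ s.1 ∧ s.2 + s.1 + s.1 ≤ K)]
    · refine Finset.sum_of_injOn (fun s => ⟨s.1 - 1, (s.2 + 1, K - 2 * (s.1 - 1) - (s.2 + 1))⟩)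
        ?_ ?_ ?_ ?_
      · rintro ⟨m, l⟩ h ⟨m', l'⟩ h' heq
        simp only [Finset.coe_filter, Set.mem_ofPred_eq, Finset.mem_sigma, Finset.mem_range]
          at h h'
        simp only [Sigma.mk.injEq, heq_eq_eq, Prod.mk.injEq] at heq
        have h1 : m = m' := by omega
        have h2 : l = l' := by omega
        rw [h1, h2]
      · rintro ⟨m, l⟩ h
        simp only [Finset.coe_filter, Set.mem_ofPred_eq, Finset.mem_coe, Finset.mem_sigma,
          Finset.mem_range, mem_antidiagonal] at h ⊢
        omega
      · rintro ⟨m, l, k⟩ h h'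
        simp only [Finset.mem_sigma, Finset.mem_range,
          mem_antidiagonal] at h
        dsimp only at h h' ⊢
        rw [G0one_eq_zero, mul_zero, mul_zero, mul_zero]
        intro hc
        apply h'
        refine ⟨⟨m + 1, l - 1⟩, ?_, ?_⟩
        · simp only [Finset.coe_filter, Set.mem_ofPred_eq, Finset.mem_sigma, Finset.mem_range]
          omega
        · have h1 : l - 1 + 1 = l := by omega
          have h2 : K - 2 * m - l = k := by omega
          simp [h1, h2]
      · rintro ⟨m, l⟩ h
        simp only [Finset.mem_filter, Finset.mem_sigma, Finset.mem_range] at h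
        obtain ⟨m, rfl⟩ : ∃ m', m = m' + 1 := ⟨m - 1, by omega⟩
        have h1 : l + (m + 1) = l + 1 + m := by ring
        simp only [Nat.add_sub_cancel, h1]
        ring
    · rintro ⟨m, l⟩ _ hne
      by_contra hc
      apply hne
      dsimp only at hc ⊢
      rw [G0one_eq_zero (by omega)]
      ring
  rw [sub_mul, hy, hx, ← mul_sub, ← Finset.sum_sub_distrib]
  simp only [← mul_sub, ← Finset.sum_sub_distrib, Gbar0one]

lemma eq_zero_of_sum_mul_pow_eq_zero {n : ℕ} {c : ℕ → ℂ}
    (h : ∀ t : ℝ, 0 < t → ∑ i ∈ Finset.range n, (t : ℂ) ^ i * c i = 0) {i : ℕ} (hi : i < n) :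
    c i = 0 := by
  have := eq_zero_of_hasSum_zero (p := fun i => if i < n then c i else 0) one_pos
    (fun t ht _ => by
      have h1 : ∑ i ∈ Finset.range n, (t : ℂ) ^ i * c i =
          ∑ i ∈ Finset.range n, (if i < n then c i else 0) * (t : ℂ) ^ i := by
        refine Finset.sum_congr rfl fun j hj => ?_
        rw [if_pos (Finset.mem_range.1 hj), mul_comm]
      have h2 : ∀ j ∉ Finset.range n, (if j < n then c j else 0) * (t : ℂ) ^ j = 0 := by
        intro j hj
        rw [if_neg (by simpa using hj), zero_mul]
      have h3 : HasSum (fun j => (if j < n then c j else 0) * (t : ℂ) ^ j) _ :=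
        hasSum_sum_of_ne_finset_zero h2
      rwa [← h1, h t ht] at h3) i
  simpa [hi] using this

lemma exists_add_eq_and_mul_eq (s q : ℂ) : ∃ α β : ℂ, α + β = s ∧ α * β = q := by
  obtain ⟨r, hr⟩ := IsAlgClosed.exists_pow_nat_eq (s ^ 2 - 4 * q) two_pos
  refine ⟨(s + r) / 2, (s - r) / 2, by ring, ?_⟩
  linear_combination -hr / 4

lemma Gbar0one_eq_schurTripleSum {N : ℕ → ℕ → ℤ} (hN : IsPowerSumCoeff N) (hN0 : N 0 0 = 1)
    {k l m : ℕ} (hklm : ¬(k = 0 ∧ l = 0 ∧ m = 0)) :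
    (Gbar0one (k + l + 2 * m) (l + m) m : ℂ) = schurTripleSum N k l m := by
  set K := k + l + 2 * m with hKdef
  have hK : K ≠ 0 := by omega
  have key : ∀ x y : ℝ, 0 < x → 0 < y → ∑ m ∈ Finset.range (K / 2 + 1), (x : ℂ) ^ m *
      ∑ l ∈ Finset.range (K - 2 * m + 1), (y : ℂ) ^ l *
        ((Gbar0one K (l + m) m : ℂ) - schurTripleSum N (K - 2 * m - l) l m) = 0 := by
    intro x y hx hy
    obtain ⟨α, β, hsum, hprod⟩ := exists_add_eq_and_mul_eq (1 + y) x
    have h1 := genCoeff_eq_coeff_zetaSeries hx hy hsum hprod hK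
    have h2 := congrArg (fun r : ℝ => (r : ℂ)) (sub_mul_genCoeff x y K)
    simp only [Finset.Nat.sum_antidiagonal_eq_sum_range_succ_mk] at h2
    push_cast at h2
    rw [h2, coeff_zetaSeries hN hN0 hsum hprod] at h1
    have h3 := mul_left_cancel₀ (by exact_mod_cast hx.ne' : (x : ℂ) ≠ 0) h1
    simp only [Finset.Nat.sum_antidiagonal_eq_sum_range_succ_mk] at h3
    simp only [mul_sub, Finset.sum_sub_distrib]
    exact sub_eq_zero.2 h3
  have h1 : ∀ y : ℝ, 0 < y → _ := fun y hy =>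
    eq_zero_of_sum_mul_pow_eq_zero (fun x hx => key x y hx hy) (by omega : m < K / 2 + 1)
  have h2 := eq_zero_of_sum_mul_pow_eq_zero h1 (by omega : l < K - 2 * m + 1)
  have h3 : K - 2 * m - l = k := by omega
  rw [h3] at h2
  exact sub_eq_zero.1 h2

/-- The Ohno–Zagier relation: for `(k,l,m) ≠ (0,0,0)`,
`Ḡ_0(k+l+2m, l+m, m; 1) = Ḡ_0(k+l+2m, k+m, m; 1)` both equal the triple sum of
products of Schur polynomials in zeta values; the integers `N i j` are characterized by
`N 0 0 = 1` and `Xⁿ + Yⁿ = ∑_{i+2j=n} N i j (X+Y)ⁱ (XY)ʲ` for `n ≥ 1`. -/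
theorem ohno_zagier_relation (k l m : ℕ) (hklm : ¬(k = 0 ∧ l = 0 ∧ m = 0))
    (N : ℕ → ℕ → ℤ) (hN0 : N 0 0 = 1)
    (hN : ∀ n : ℕ, 1 ≤ n →
      (MvPolynomial.X 0 : MvPolynomial (Fin 2) ℤ) ^ n + MvPolynomial.X 1 ^ n =
        ∑ ij ∈ (Finset.range (n + 1) ×ˢ Finset.range (n + 1)).filter
            (fun ij => ij.1 + 2 * ij.2 = n),
          MvPolynomial.C (N ij.1 ij.2) * (MvPolynomial.X 0 + MvPolynomial.X 1) ^ ij.1 *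
            (MvPolynomial.X 0 * MvPolynomial.X 1) ^ ij.2) :
    (Gbar0one (k + l + 2 * m) (l + m) m : ℂ) =
        ∑ i ∈ Finset.range (k + 1), ∑ j ∈ Finset.range (l + 1), ∑ μ ∈ Finset.range (m + 1),
          (Nat.choose (i + j) i : ℂ) * SchurP zhat (k - i) * SchurP zhat (l - j) *
            SchurP (fun n => -zhat n) μ * SchurP (fun n => -zhat n) (i + j + 2 * m - μ) *
            (N (i + j) (m - μ) : ℂ) ∧
    (Gbar0one (k + l + 2 * m) (k + m) m : ℂ) =
        ∑ i ∈ Finset.range (k + 1), ∑ j ∈ Finset.range (l + 1), ∑ μ ∈ Finset.range (m + 1),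
          (Nat.choose (i + j) i : ℂ) * SchurP zhat (k - i) * SchurP zhat (l - j) *
            SchurP (fun n => -zhat n) μ * SchurP (fun n => -zhat n) (i + j + 2 * m - μ) *
            (N (i + j) (m - μ) : ℂ) := by
  have hN' : IsPowerSumCoeff N := hN
  refine ⟨Gbar0one_eq_schurTripleSum hN' hN0 hklm, ?_⟩
  have h := Gbar0one_eq_schurTripleSum hN' hN0 (k := l) (l := k) (m := m) (by tauto)
  rw [schurTripleSum_swap, add_comm l k] at h
  exact h
end

section
/- (Euler's inversion formula for polylogarithms.) For every real z with 0 < z < 1 and every integer k ≥ 1, Li_{k+1}(z) + Li_{2,1,…,1}(1−z) + ∑_{i=1}^{k} Li_i(z) · Li_{1,…,1}(1−z) = ζ(k+1), where in the second term the index is (2, 1, …, 1) with k−1 ones, and in the i-th summand of the sum the index is (1, …, 1) with k−i+1 ones. -/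
open scoped BigOperators

/-- Multiple polylogarithm of one variable:
`Li_{k_1,…,k_r}(z) = ∑_{m_1 > ⋯ > m_r > 0} z^{m_1} / (m_1^{k_1} ⋯ m_r^{k_r})`. -/
noncomputable def MPL (ks : List ℕ) (z : ℂ) : ℂ :=
  ∑' m : Fin ks.length → ℕ,
    if (∀ i, 0 < m i) ∧ (∀ i j, i < j → m j < m i) then
      (if h : 0 < ks.length then z ^ m ⟨0, h⟩ else 1) / ∏ i, (m i : ℂ) ^ ks.get i
    else 0

open Filter Topology

/-- The coefficient of `z ^ n` in the power series of `MPL ks z`. -/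
noncomputable def mplCoeff : List ℕ → ℕ → ℝ
  | [], n => if n = 0 then 1 else 0
  | k :: ks, n => (∑ j ∈ Finset.range n, mplCoeff ks j) / (n : ℝ) ^ k

/-- The power series of `MPL ks` on the real line. -/
noncomputable def mplSeries (ks : List ℕ) (x : ℝ) : ℝ := ∑' n, mplCoeff ks n * x ^ n

/-- The largest index of a decreasing tuple, with value `0` on the empty tuple. -/
def tupleHead {r : ℕ} (m : Fin r → ℕ) : ℕ := if h : 0 < r then m ⟨0, h⟩ else 0

theorem mplCoeff_nonneg (ks : List ℕ) (n : ℕ) : 0 ≤ mplCoeff ks n := by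
  induction ks generalizing n with
  | nil => simp only [mplCoeff]; split_ifs <;> norm_num
  | cons k ks ih =>
    exact div_nonneg (Finset.sum_nonneg fun j _ => ih j) (by positivity)

theorem mplCoeff_le_one {ks : List ℕ} (hks : ∀ k ∈ ks, 1 ≤ k) (n : ℕ) : mplCoeff ks n ≤ 1 := by
  induction ks generalizing n with
  | nil => simp only [mplCoeff]; split_ifs <;> norm_num
  | cons k ks ih =>
    have ih' := ih fun j hj => hks j (List.mem_cons_of_mem _ hj)
    have hk : 1 ≤ k := hks k List.mem_cons_self
    rcases Nat.eq_zero_or_pos n with rfl | hn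
    · simp [mplCoeff]
    have hn1 : (1 : ℝ) ≤ n := by exact_mod_cast hn
    rw [mplCoeff, div_le_one (by positivity)]
    calc ∑ j ∈ Finset.range n, mplCoeff ks j ≤ ∑ j ∈ Finset.range n, (1 : ℝ) :=
          Finset.sum_le_sum fun j _ => ih' j
      _ = (n : ℝ) := by simp
      _ ≤ (n : ℝ) ^ k := le_self_pow₀ hn1 (by omega)

theorem mplCoeff_cons_zero (k : ℕ) (ks : List ℕ) : mplCoeff (k :: ks) 0 = 0 := by
  simp [mplCoeff]

theorem mplCoeff_singleton {n : ℕ} (hn : n ≠ 0) (k : ℕ) : mplCoeff [k] n = 1 / (n : ℝ) ^ k := by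
  simp only [mplCoeff]
  rw [Finset.sum_ite_eq' (Finset.range n) 0 (fun _ => (1 : ℝ))]
  simp [Nat.pos_of_ne_zero hn]

theorem nat_mul_mplCoeff_succ_cons (k : ℕ) (ks : List ℕ) (n : ℕ) :
    n * mplCoeff ((k + 1) :: ks) n = mplCoeff (k :: ks) n := by
  rcases Nat.eq_zero_or_pos n with rfl | hn
  · simp [mplCoeff]
  have : (n : ℝ) ≠ 0 := by positivity
  simp only [mplCoeff]
  field_simp
  ring

theorem valid_cons_iff {r : ℕ} (n : ℕ) (m : Fin r → ℕ) :
    ((∀ i, 0 < (Fin.cons n m : Fin (r + 1) → ℕ) i) ∧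
      ∀ i j, i < j → (Fin.cons n m : Fin (r + 1) → ℕ) j < (Fin.cons n m : Fin (r + 1) → ℕ) i) ↔
    ((∀ i, 0 < m i) ∧ ∀ i j, i < j → m j < m i) ∧ tupleHead m < n := by
  constructor
  · rintro ⟨h1, h2⟩
    refine ⟨⟨fun i => by simpa using h1 i.succ, fun i j hij => ?_⟩, ?_⟩
    · simpa using h2 i.succ j.succ (by simpa using hij)
    · unfold tupleHead
      split_ifs with h
      · have h3 := h2 0 (Fin.succ ⟨0, h⟩) (Fin.succ_pos _)
        rwa [Fin.cons_succ, Fin.cons_zero] at h3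
      · simpa using h1 0
  · rintro ⟨⟨h1, h2⟩, h3⟩
    have hlt : ∀ i, m i < n := fun i => by
      have hr : 0 < r := i.pos
      rw [tupleHead, dif_pos hr] at h3
      rcases eq_or_ne i ⟨0, hr⟩ with rfl | hi
      · exact h3
      · refine (h2 ⟨0, hr⟩ i ?_).trans h3
        rw [Fin.lt_def]
        exact Nat.pos_of_ne_zero fun h => hi (Fin.ext h)
    refine ⟨fun i => ?_, fun i j hij => ?_⟩
    · refine Fin.cases ?_ (fun i => ?_) i
      · simpa using (Nat.zero_le _).trans_lt h3
      · simpa using h1 i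
    · induction j using Fin.cases with
      | zero => simp at hij
      | succ j =>
        induction i using Fin.cases with
        | zero => simpa using hlt j
        | succ i => simpa using h2 i j (by simpa using hij)

/-- A sum over decreasing tuples, weighted by a function of the largest index, collapses to a sum
over that index. -/
theorem hasSum_tuples (ks : List ℕ) {f : ℕ → ℝ} (hf : ∀ n, 0 ≤ f n) {S : ℝ}
    (hS : HasSum (fun n => mplCoeff ks n * f n) S) :
    HasSum (fun m : Fin ks.length → ℕ =>
      if (∀ i, 0 < m i) ∧ (∀ i j, i < j → m j < m i) then
        f (tupleHead m) / ∏ i, (m i : ℝ) ^ ks.get i else 0) S := by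
  induction ks generalizing f S with
  | nil =>
    have h0 : HasSum (fun n => mplCoeff [] n * f n) (f 0) := by
      convert hasSum_ite_eq (0 : ℕ) (f 0) using 2 with n
      by_cases h : n = 0 <;> simp [mplCoeff, h]
    rw [hS.unique h0]
    have : Unique (Fin ([] : List ℕ).length → ℕ) := Pi.uniqueOfIsEmpty (α := Fin 0) _
    have hs := hasSum_unique (fun m : Fin ([] : List ℕ).length → ℕ =>
      if (∀ i, 0 < m i) ∧ (∀ i j, i < j → m j < m i) then
        f (tupleHead m) / ∏ i, (m i : ℝ) ^ ([] : List ℕ).get i else 0)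
    convert hs using 1
    rw [if_pos ⟨fun i => i.elim0, fun i => i.elim0⟩]
    simp [tupleHead]
  | cons k ks ih =>
    let e : ℕ × (Fin ks.length → ℕ) ≃ (Fin (ks.length + 1) → ℕ) :=
      Fin.consEquiv fun _ => ℕ
    refine (Equiv.hasSum_iff e).1 ?_
    have hval : ∀ (n : ℕ) (m : Fin ks.length → ℕ),
        (if (∀ i, 0 < e (n, m) i) ∧ (∀ i j, i < j → e (n, m) j < e (n, m) i) then
          f (tupleHead (e (n, m))) / ∏ i, (e (n, m) i : ℝ) ^ (k :: ks).get i else 0) =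
        if (∀ i, 0 < m i) ∧ (∀ i j, i < j → m j < m i) then
          (if tupleHead m < n then f n / (n : ℝ) ^ k else 0) / ∏ i, (m i : ℝ) ^ ks.get i
        else 0 := by
      intro n m
      have he : e (n, m) = (Fin.cons n m : Fin (ks.length + 1) → ℕ) := rfl
      rw [he, if_congr (valid_cons_iff n m) rfl rfl]
      have hh : tupleHead (Fin.cons n m : Fin (ks.length + 1) → ℕ) = n := by
        simp [tupleHead]
      have hp : ∏ i : Fin (ks.length + 1),
          ((Fin.cons n m : Fin (ks.length + 1) → ℕ) i : ℝ) ^ (k :: ks).get i =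
          (n : ℝ) ^ k * ∏ i, (m i : ℝ) ^ ks.get i := by
        rw [Fin.prod_univ_succ]
        simp
      rw [hh]
      erw [hp]
      by_cases h1 : (∀ i, 0 < m i) ∧ (∀ i j, i < j → m j < m i)
      · by_cases h2 : tupleHead m < n
        · rw [if_pos ⟨h1, h2⟩, if_pos h1, if_pos h2, div_div]
        · rw [if_neg fun h => h2 h.2, if_pos h1, if_neg h2, zero_div]
      · rw [if_neg fun h => h1 h.1, if_neg h1]
    have hfib : ∀ n : ℕ, HasSum (fun m : Fin ks.length → ℕ =>
        if (∀ i, 0 < m i) ∧ (∀ i j, i < j → m j < m i) then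
          (if tupleHead m < n then f n / (n : ℝ) ^ k else 0) / ∏ i, (m i : ℝ) ^ ks.get i
        else 0) (mplCoeff (k :: ks) n * f n) := by
      intro n
      refine ih (f := fun j => if j < n then f n / (n : ℝ) ^ k else 0) (fun j => ?_) ?_
      · split_ifs
        · exact div_nonneg (hf n) (by positivity)
        · exact le_rfl
      · have h := hasSum_sum_of_ne_finset_zero (L := .unconditional ℕ) (s := Finset.range n)
          (f := fun j => mplCoeff ks j * if j < n then f n / (n : ℝ) ^ k else 0)
          (fun j hj => by simp [Finset.mem_range.not.1 hj])
        convert h using 1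
        rw [mplCoeff, div_mul_eq_mul_div, mul_div_assoc, Finset.sum_mul]
        refine Finset.sum_congr rfl fun j hj => ?_
        rw [if_pos (Finset.mem_range.1 hj)]
    have hfun : ((fun m : Fin (k :: ks).length → ℕ =>
        if (∀ i, 0 < m i) ∧ (∀ i j, i < j → m j < m i) then
          f (tupleHead m) / ∏ i, (m i : ℝ) ^ (k :: ks).get i else 0) ∘ e) =
        fun p : ℕ × (Fin ks.length → ℕ) =>
          if (∀ i, 0 < p.2 i) ∧ (∀ i j, i < j → p.2 j < p.2 i) then
            (if tupleHead p.2 < p.1 then f p.1 / (p.1 : ℝ) ^ k else 0) /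
              ∏ i, (p.2 i : ℝ) ^ ks.get i
          else 0 := by
      funext p
      exact hval p.1 p.2
    have hsum : Summable (fun p : ℕ × (Fin ks.length → ℕ) =>
          if (∀ i, 0 < p.2 i) ∧ (∀ i j, i < j → p.2 j < p.2 i) then
            (if tupleHead p.2 < p.1 then f p.1 / (p.1 : ℝ) ^ k else 0) /
              ∏ i, (p.2 i : ℝ) ^ ks.get i
          else 0) := by
      refine (summable_prod_of_nonneg fun p => ?_).2 ⟨fun n => (hfib n).summable, ?_⟩
      · dsimp only [Pi.zero_apply]
        have := hf p.1
        split_ifs <;> positivity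
      · simp only [(hfib _).tsum_eq]
        exact hS.summable
    rw [hfun]
    have h2 := hsum.hasSum.prod_fiberwise hfib
    rw [hS.unique h2]
    exact hsum.hasSum

theorem summable_mplSeries {ks : List ℕ} (hks : ∀ k ∈ ks, 1 ≤ k) {x : ℝ} (hx : |x| < 1) :
    Summable fun n => mplCoeff ks n * x ^ n := by
  refine Summable.of_norm_bounded (summable_geometric_of_lt_one (abs_nonneg x) hx) fun n => ?_
  rw [norm_mul, norm_pow, Real.norm_eq_abs, Real.norm_eq_abs, abs_of_nonneg (mplCoeff_nonneg _ _)]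
  exact mul_le_of_le_one_left (by positivity) (mplCoeff_le_one hks n)

theorem MPL_ofReal {ks : List ℕ} (hks : ∀ k ∈ ks, 1 ≤ k) {x : ℝ} (hx0 : 0 ≤ x) (hx1 : x < 1) :
    MPL ks (x : ℂ) = (mplSeries ks x : ℂ) := by
  have h := hasSum_tuples ks (f := fun n => x ^ n) (fun n => by positivity)
    (summable_mplSeries hks (by rwa [abs_of_nonneg hx0])).hasSum
  rw [mplSeries, ← h.tsum_eq, MPL, Complex.ofReal_tsum]
  refine tsum_congr fun m => ?_
  unfold tupleHead
  split_ifs <;> simp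

theorem mzv_singleton {k : ℕ} (hk : 2 ≤ k) : mzv [k] = mplSeries [k] 1 := by
  have hs : Summable fun n => mplCoeff [k] n * (1 : ℝ) ^ n := by
    refine (Real.summable_one_div_nat_pow.2 hk).congr fun n => ?_
    rcases eq_or_ne n 0 with rfl | hn
    · simp [mplCoeff_cons_zero, show k ≠ 0 by omega]
    · rw [mplCoeff_singleton hn, one_pow, mul_one]
  have h := hasSum_tuples [k] (f := fun n => 1 ^ n) (fun n => by positivity) hs.hasSum
  rw [mplSeries, ← h.tsum_eq, mzv]
  simp only [one_pow]

theorem hasDerivAt_tsum_mul_pow {a : ℕ → ℝ} (ha : ∀ n, |a n| ≤ 1) {x : ℝ} (hx : |x| < 1) :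
    HasDerivAt (fun y => ∑' n, a n * y ^ n) (∑' n, n * a n * x ^ (n - 1)) x := by
  obtain ⟨r, hxr, hr1⟩ := exists_between hx
  have hr0 : 0 < r := (abs_nonneg x).trans_lt hxr
  have hu : Summable fun n : ℕ => (n : ℝ) * r ^ (n - 1) := by
    have h := summable_pow_mul_geometric_of_norm_lt_one 1
      (show ‖r‖ < 1 by rwa [Real.norm_of_nonneg hr0.le])
    refine (h.mul_right r⁻¹).congr fun n => ?_
    rcases n with _ | n
    · simp
    · simp only [Nat.add_sub_cancel, pow_succ]
      field_simp
  refine hasDerivAt_tsum_of_isPreconnected hu (Metric.isOpen_ball (x := (0 : ℝ)) (ε := r))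
    (convex_ball (0 : ℝ) r).isPreconnected (g := fun n y => a n * y ^ n)
    (g' := fun n y => n * a n * y ^ (n - 1)) (fun n y _ => ?_) (fun n y hy => ?_)
    (Metric.mem_ball_self hr0) ?_ (by simpa using hxr)
  · exact ((hasDerivAt_pow n y).const_mul (a n)).congr_deriv (by ring)
  · have hy : |y| ≤ r := by simpa using (Metric.mem_ball.1 hy).le
    rw [norm_mul, norm_mul, norm_pow, Real.norm_natCast, Real.norm_eq_abs, Real.norm_eq_abs]
    gcongr
    exact mul_le_of_le_one_right (by positivity) (ha n)
  · refine summable_of_ne_finset_zero (s := {0}) fun n hn => ?_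
    simp [show n ≠ 0 by simpa using hn]

theorem summable_nat_mul_mul_pow_pred {a : ℕ → ℝ} (ha : ∀ n, |a n| ≤ 1) {x : ℝ} (hx : |x| < 1) :
    Summable fun n : ℕ => n * a n * x ^ (n - 1) := by
  rw [← summable_nat_add_iff 1]
  have h := summable_pow_mul_geometric_of_norm_lt_one 1 (show ‖|x|‖ < 1 by simpa using hx)
  have h' := (summable_geometric_of_lt_one (abs_nonneg x) hx).add h
  refine Summable.of_norm_bounded h' fun n => ?_
  rw [norm_mul, norm_mul, norm_pow, Real.norm_natCast, Real.norm_eq_abs, Real.norm_eq_abs]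
  have h1 : ((n + 1 : ℕ) : ℝ) * |a (n + 1)| ≤ n + 1 := by
    push_cast
    exact mul_le_of_le_one_right (by positivity) (ha _)
  calc _ ≤ ((n : ℝ) + 1) * |x| ^ n := by
        simpa using mul_le_mul_of_nonneg_right h1 (by positivity : 0 ≤ |x| ^ n)
    _ = _ := by ring

theorem abs_mplCoeff_le_one {ks : List ℕ} (hks : ∀ k ∈ ks, 1 ≤ k) (n : ℕ) :
    |mplCoeff ks n| ≤ 1 := by
  rw [abs_of_nonneg (mplCoeff_nonneg _ _)]
  exact mplCoeff_le_one hks n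

theorem hasDerivAt_mplSeries_succ_cons {k : ℕ} {ks : List ℕ} (hks : ∀ j ∈ (k + 1) :: ks, 1 ≤ j)
    {x : ℝ} (hx0 : x ≠ 0) (hx : |x| < 1) :
    HasDerivAt (mplSeries ((k + 1) :: ks)) (mplSeries (k :: ks) x / x) x := by
  refine (hasDerivAt_tsum_mul_pow (abs_mplCoeff_le_one hks) hx).congr_deriv (Eq.symm ?_)
  rw [mplSeries, div_eq_iff hx0, ← tsum_mul_right]
  refine tsum_congr fun n => ?_
  rw [nat_mul_mplCoeff_succ_cons]
  rcases n with _ | n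
  · simp [mplCoeff_cons_zero]
  · rw [Nat.add_sub_cancel, pow_succ, mul_assoc]

theorem hasDerivAt_mplSeries_one_cons {ks : List ℕ} (hks : ∀ j ∈ ks, 1 ≤ j)
    {x : ℝ} (hx : |x| < 1) :
    HasDerivAt (mplSeries (1 :: ks)) (mplSeries ks x / (1 - x)) x := by
  have hks' : ∀ j ∈ 1 :: ks, 1 ≤ j := by simpa using hks
  refine (hasDerivAt_tsum_mul_pow (abs_mplCoeff_le_one hks') hx).congr_deriv (Eq.symm ?_)
  have hs := summable_nat_mul_mul_pow_pred (abs_mplCoeff_le_one hks') hx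
  have hc : ∀ n : ℕ, (n : ℝ) * mplCoeff (1 :: ks) n = ∑ j ∈ Finset.range n, mplCoeff ks j := by
    intro n
    rw [nat_mul_mplCoeff_succ_cons, mplCoeff, pow_zero, div_one]
  simp only [hc] at hs ⊢
  have hx1 : 1 - x ≠ 0 := by linarith [(abs_lt.1 hx).2]
  have hs1 := (summable_nat_add_iff 1).2 hs
  have h0 := hs.tsum_eq_zero_add
  simp only [Finset.range_zero, Finset.sum_empty, zero_mul, zero_add, Nat.add_sub_cancel] at h0 hs1
  have hmul : (∑' n, (∑ j ∈ Finset.range n, mplCoeff ks j) * x ^ (n - 1)) * x =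
      ∑' n, (∑ j ∈ Finset.range n, mplCoeff ks j) * x ^ n := by
    rw [← tsum_mul_right]
    refine tsum_congr fun n => ?_
    rcases n with _ | n
    · simp
    · rw [Nat.add_sub_cancel, pow_succ, mul_assoc]
  have hs2 : Summable fun n => (∑ j ∈ Finset.range n, mplCoeff ks j) * x ^ n := by
    refine (hs.mul_right x).congr fun n => ?_
    rcases n with _ | n
    · simp
    · rw [Nat.add_sub_cancel, pow_succ, mul_assoc]
  rw [div_eq_iff hx1, mul_sub, mul_one, hmul, h0, ← hs1.tsum_sub hs2, mplSeries]
  refine tsum_congr fun n => ?_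
  rw [Finset.sum_range_succ]
  ring

theorem mplSeries_nil (x : ℝ) : mplSeries [] x = 1 := by
  rw [mplSeries, tsum_eq_single 0 fun n hn => by simp [mplCoeff, hn]]
  simp [mplCoeff]

theorem mplSeries_nonneg (ks : List ℕ) {x : ℝ} (hx : 0 ≤ x) : 0 ≤ mplSeries ks x :=
  tsum_nonneg fun n => mul_nonneg (mplCoeff_nonneg ks n) (pow_nonneg hx n)

theorem mplSeries_cons_le {k : ℕ} {ks : List ℕ} (hks : ∀ j ∈ k :: ks, 1 ≤ j) {x : ℝ}
    (hx0 : 0 ≤ x) (hx1 : x < 1) : mplSeries (k :: ks) x ≤ x / (1 - x) := by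
  have hs := summable_mplSeries hks (by rwa [abs_of_nonneg hx0])
  have hg := (hasSum_geometric_of_lt_one hx0 hx1).mul_left x
  rw [mplSeries, hs.tsum_eq_zero_add, mplCoeff_cons_zero, zero_mul, zero_add, div_eq_mul_inv,
    ← hg.tsum_eq]
  refine ((summable_nat_add_iff 1).2 hs).tsum_le_tsum (fun n => ?_) hg.summable
  rw [pow_succ, mul_comm x]
  exact mul_le_of_le_one_left (by positivity) (mplCoeff_le_one hks _)

theorem mplSeries_singleton_le {k : ℕ} (hk : 1 ≤ k) {x : ℝ} (hx0 : 0 ≤ x) (hx1 : x < 1) :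
    mplSeries [k] x ≤ -Real.log (1 - x) := by
  have habs : |x| < 1 := by rwa [abs_of_nonneg hx0]
  have hs := summable_mplSeries (ks := [k]) (by simpa using hk) habs
  have hl := Real.hasSum_pow_div_log_of_abs_lt_one habs
  rw [mplSeries, hs.tsum_eq_zero_add, mplCoeff_cons_zero, zero_mul, zero_add, ← hl.tsum_eq]
  refine ((summable_nat_add_iff 1).2 hs).tsum_le_tsum (fun n => ?_) hl.summable
  rw [mplCoeff_singleton n.succ_ne_zero, div_mul_eq_mul_div, one_mul]
  push_cast
  gcongr
  exact le_self_pow₀ (by linarith [(Nat.cast_nonneg n : (0 : ℝ) ≤ n)]) (by omega)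

theorem tendsto_mplSeries_singleton {k : ℕ} (hk : 2 ≤ k) :
    Tendsto (mplSeries [k]) (𝓝[<] 1) (𝓝 (mplSeries [k] 1)) := by
  have hc : ContinuousOn (mplSeries [k]) (Set.Icc 0 1) := by
    refine continuousOn_tsum (u := fun n : ℕ => 1 / (n : ℝ) ^ k) (fun n => by fun_prop)
      (Real.summable_one_div_nat_pow.2 hk) fun n x hx => ?_
    rcases eq_or_ne n 0 with rfl | hn
    · simp [mplCoeff_cons_zero]
    rw [mplCoeff_singleton hn, Real.norm_of_nonneg (mul_nonneg (by positivity) (pow_nonneg hx.1 n))]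
    exact mul_le_of_le_one_right (by positivity) (pow_le_one₀ hx.1 hx.2)
  have h := hc 1 (Set.right_mem_Icc.2 zero_le_one)
  refine h.mono_left ?_
  rw [← nhdsWithin_Ioo_eq_nhdsLT (zero_lt_one' ℝ)]
  exact nhdsWithin_mono _ Set.Ioo_subset_Icc_self

theorem tendsto_mplSeries_cons_one_sub {k : ℕ} {ks : List ℕ} (hks : ∀ j ∈ k :: ks, 1 ≤ j) :
    Tendsto (fun x => mplSeries (k :: ks) (1 - x)) (𝓝[<] 1) (𝓝 0) := by
  have hb : Tendsto (fun x : ℝ => (1 - x) / (1 - (1 - x))) (𝓝[<] 1) (𝓝 0) := by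
    have : ContinuousAt (fun x : ℝ => (1 - x) / (1 - (1 - x))) 1 := by
      refine ContinuousAt.div (by fun_prop) (by fun_prop) (by norm_num)
    simpa using this.tendsto.mono_left nhdsWithin_le_nhds
  have hI : Set.Ioo (0 : ℝ) 1 ∈ 𝓝[<] (1 : ℝ) := Ioo_mem_nhdsLT zero_lt_one
  refine tendsto_of_tendsto_of_tendsto_of_le_of_le' tendsto_const_nhds hb ?_ ?_
  · filter_upwards [hI] with x hx using mplSeries_nonneg _ (by linarith [hx.2])
  · filter_upwards [hI] with x hx
    exact mplSeries_cons_le hks (by linarith [hx.2]) (by linarith [hx.1])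

theorem tendsto_mplSeries_mul_one_sub {i k : ℕ} {ks : List ℕ} (hi : 1 ≤ i)
    (hks : ∀ j ∈ k :: ks, 1 ≤ j) :
    Tendsto (fun x => mplSeries [i] x * mplSeries (k :: ks) (1 - x)) (𝓝[<] 1) (𝓝 0) := by
  have hb : Tendsto (fun x : ℝ => -((1 - x) * Real.log (1 - x)) / (1 - (1 - x)))
      (𝓝[<] 1) (𝓝 0) := by
    have hl : Continuous fun x : ℝ => (1 - x) * Real.log (1 - x) :=
      Real.continuous_mul_log.comp (continuous_const.sub continuous_id)
    have : ContinuousAt (fun x : ℝ => -((1 - x) * Real.log (1 - x)) / (1 - (1 - x))) 1 :=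
      ContinuousAt.div hl.neg.continuousAt (by fun_prop) (by norm_num)
    simpa using this.tendsto.mono_left nhdsWithin_le_nhds
  have hI : Set.Ioo (0 : ℝ) 1 ∈ 𝓝[<] (1 : ℝ) := Ioo_mem_nhdsLT zero_lt_one
  refine tendsto_of_tendsto_of_tendsto_of_le_of_le' tendsto_const_nhds hb ?_ ?_
  · filter_upwards [hI] with x hx
    exact mul_nonneg (mplSeries_nonneg _ hx.1.le) (mplSeries_nonneg _ (by linarith [hx.2]))
  · filter_upwards [hI] with x hx
    have h1 := mplSeries_singleton_le hi hx.1.le hx.2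
    have h2 := mplSeries_cons_le hks (x := 1 - x) (by linarith [hx.2]) (by linarith [hx.1])
    calc _ ≤ -Real.log (1 - x) * ((1 - x) / (1 - (1 - x))) :=
          mul_le_mul h1 h2 (mplSeries_nonneg _ (by linarith [hx.2]))
            ((mplSeries_nonneg _ hx.1.le).trans h1)
      _ = _ := by ring

theorem one_le_of_mem_replicate_one (n : ℕ) : ∀ j ∈ List.replicate n 1, 1 ≤ j :=
  fun _ hj => (List.eq_of_mem_replicate hj).ge

/-- The left-hand side of the inversion formula for the index `k + 1`, on the real line. -/
noncomputable def inversionSum (k : ℕ) (x : ℝ) : ℝ :=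
  mplSeries [k + 2] x + mplSeries (2 :: List.replicate k 1) (1 - x) +
    ∑ j ∈ Finset.range (k + 1),
      mplSeries [j + 1] x * mplSeries (List.replicate (k + 1 - j) 1) (1 - x)

theorem hasDerivAt_inversionSum (k : ℕ) {x : ℝ} (hx0 : 0 < x) (hx1 : x < 1) :
    HasDerivAt (inversionSum k) 0 x := by
  have hx : |x| < 1 := by rwa [abs_of_pos hx0]
  have hy : |1 - x| < 1 := by rw [abs_of_pos (by linarith)]; linarith
  have hsub : HasDerivAt (fun y : ℝ => 1 - y) (-1) x := (hasDerivAt_id x).const_sub 1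
  let d : ℕ → ℝ := fun j => if j = 0 then 1 / (1 - x) else mplSeries [j] x / x
  have hL : ∀ j, HasDerivAt (mplSeries [j + 1]) (d j) x := by
    intro j
    rcases j with _ | j
    · simpa [d, mplSeries_nil] using hasDerivAt_mplSeries_one_cons (ks := []) (by simp) hx
    · simpa [d] using hasDerivAt_mplSeries_succ_cons (k := j + 1) (ks := []) (by simp) hx0.ne' hx
  have hA : ∀ n, HasDerivAt (fun y => mplSeries (List.replicate (n + 1) 1) (1 - y))
      (-(mplSeries (List.replicate n 1) (1 - x) / x)) x := by
    intro n
    have h := (hasDerivAt_mplSeries_one_cons (one_le_of_mem_replicate_one n) hy).comp x hsub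
    rw [sub_sub_cancel, mul_neg_one] at h
    exact h
  have hB : HasDerivAt (fun y => mplSeries (2 :: List.replicate k 1) (1 - y))
      (-(mplSeries (List.replicate (k + 1) 1) (1 - x) / (1 - x))) x := by
    have h := (hasDerivAt_mplSeries_succ_cons (k := 1) (ks := List.replicate k 1)
      (by simp) (by linarith) hy).comp x hsub
    rw [mul_neg_one] at h
    exact h
  have hS := HasDerivAt.fun_sum (u := Finset.range (k + 1))
    (A := fun j y => mplSeries [j + 1] y * mplSeries (List.replicate (k + 1 - j) 1) (1 - y))
    (A' := fun j => d j * mplSeries (List.replicate (k + 1 - j) 1) (1 - x) -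
      d (j + 1) * mplSeries (List.replicate (k + 1 - (j + 1)) 1) (1 - x)) (x := x) (by
    intro j hj
    have hn : k + 1 - j = (k + 1 - (j + 1)) + 1 := by
      have := Finset.mem_range.1 hj
      omega
    have h := (hL j).mul (hA (k + 1 - (j + 1)))
    rw [← hn] at h
    refine h.congr_deriv ?_
    simp only [d, Nat.add_eq_zero_iff, one_ne_zero, and_false, if_false]
    ring)
  rw [Finset.sum_range_sub' (fun j => d j * mplSeries (List.replicate (k + 1 - j) 1) (1 - x))] at hS
  refine (((hL (k + 1)).add hB).add hS).congr_deriv ?_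
  simp only [d, Nat.sub_self, List.replicate_zero, mplSeries_nil, if_true, Nat.sub_zero]
  ring

theorem inversionSum_eq (k : ℕ) {x : ℝ} (hx0 : 0 < x) (hx1 : x < 1) :
    inversionSum k x = mplSeries [k + 2] 1 := by
  have hconst : ∀ y ∈ Set.Ioo (0 : ℝ) 1, inversionSum k y = inversionSum k x := fun y hy =>
    isOpen_Ioo.is_const_of_deriv_eq_zero isPreconnected_Ioo
      (fun w hw => (hasDerivAt_inversionSum k hw.1 hw.2).differentiableAt.differentiableWithinAt)
      (fun w hw => (hasDerivAt_inversionSum k hw.1 hw.2).deriv) hy ⟨hx0, hx1⟩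
  have hlim1 : Tendsto (inversionSum k) (𝓝[<] 1) (𝓝 (inversionSum k x)) := by
    refine tendsto_const_nhds.congr' ?_
    filter_upwards [Ioo_mem_nhdsLT (zero_lt_one' ℝ)] with y hy using (hconst y hy).symm
  have hlim2 : Tendsto (inversionSum k) (𝓝[<] 1) (𝓝 (mplSeries [k + 2] 1)) := by
    have hS := tendsto_finsetSum (Finset.range (k + 1)) (f := fun j y =>
      mplSeries [j + 1] y * mplSeries (List.replicate (k + 1 - j) 1) (1 - y))
      (a := fun _ => (0 : ℝ)) (x := 𝓝[<] (1 : ℝ)) (by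
        intro j hj
        obtain ⟨n, hn⟩ : ∃ n, k + 1 - j = n + 1 := ⟨k - j, by
          have := Finset.mem_range.1 hj
          omega⟩
        rw [hn]
        exact tendsto_mplSeries_mul_one_sub (by omega) (one_le_of_mem_replicate_one (n + 1)))
    have h := ((tendsto_mplSeries_singleton (k := k + 2) (by omega)).add
      (tendsto_mplSeries_cons_one_sub (k := 2) (ks := List.replicate k 1)
        (by simp))).add hS
    rw [Finset.sum_const_zero, add_zero, add_zero] at h
    exact h
  exact tendsto_nhds_unique hlim1 hlim2

/-- Euler's inversion formula for polylogarithms: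
`Li_{k+1}(z) + Li_{2,1,…,1}(1−z) + ∑_{i=1}^{k} Li_i(z)·Li_{1,…,1}(1−z) = ζ(k+1)`. -/
theorem euler_inversion_polylog (z : ℝ) (hz0 : 0 < z) (hz1 : z < 1) (k : ℕ) (hk : 1 ≤ k) :
    MPL [k + 1] (z : ℂ) + MPL (2 :: List.replicate (k - 1) 1) ((1 : ℂ) - z) +
      ∑ i ∈ Finset.Icc 1 k, MPL [i] (z : ℂ) * MPL (List.replicate (k - i + 1) 1) ((1 : ℂ) - z) =
      (mzv [k + 1] : ℂ) := by
  obtain ⟨k, rfl⟩ := Nat.exists_eq_add_of_le' hk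
  have hw : (1 : ℂ) - z = ((1 - z : ℝ) : ℂ) := by push_cast; rfl
  have hw0 : 0 ≤ 1 - z := by linarith
  have hw1 : 1 - z < 1 := by linarith
  rw [hw, mzv_singleton (by omega), ← inversionSum_eq k hz0 hz1, inversionSum,
    MPL_ofReal (by simp) hz0.le hz1, Nat.add_sub_cancel,
    MPL_ofReal (by simp) hw0 hw1,
    Complex.ofReal_add, Complex.ofReal_add, Complex.ofReal_sum,
    ← Finset.Ico_add_one_right_eq_Icc, Finset.sum_Ico_eq_sum_range]
  congr 1
  refine Finset.sum_congr (by simp) fun j hj => ?_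
  have hj' : j < k + 1 := Finset.mem_range.1 (by simpa using hj)
  rw [show k + 1 - (1 + j) + 1 = k + 1 - j by omega, add_comm 1 j,
    MPL_ofReal (by simp) hz0.le hz1, MPL_ofReal (one_le_of_mem_replicate_one _) hw0 hw1,
    Complex.ofReal_mul]
end

section
/- For every real z with 0 < z < 1 and every integer k ≥ 1, Li_{k+1,1}(z) + Li_{3,1,…,1}(1−z) + Li_1(z) · Li_{2,1,…,1}(1−z) + ∑_{i=1}^{k} Li_{i,1}(z) · Li_{1,…,1}(1−z) = ((k+1)/2) · ζ(k+2) − (1/2) · ∑_{i=1}^{k−1} ζ(i+1) · ζ(k−i+1), where the index (3, 1, …, 1) has k−1 ones, the index (2, 1, …, 1) has k−1 ones, and in the i-th summand the index (1, …, 1) has k−i+1 ones. -/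
open scoped BigOperators

namespace MultiplePolylog

open Filter Topology

/-- The coefficient of `x ^ n` in the power series of `Li_{ks}(x)`. -/
noncomputable def coeff : List ℕ → ℕ → ℝ
  | [], n => if n = 0 then 1 else 0
  | k :: ks, n => (∑ m ∈ Finset.range n, coeff ks m) / (n : ℝ) ^ k

/-- The multiple polylogarithm as a real power series. -/
noncomputable def li (ks : List ℕ) (x : ℝ) : ℝ := ∑' n, coeff ks n * x ^ n

/-- The summand of the multiple zeta value `ζ(ks)`. -/
noncomputable def zetaTerm (ks : List ℕ) (m : Fin ks.length → ℕ) : ℝ :=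
  if (∀ i, 0 < m i) ∧ (∀ i j, i < j → m j < m i) then 1 / ∏ i, (m i : ℝ) ^ ks.get i else 0

lemma coeff_cons (k : ℕ) (ks : List ℕ) (n : ℕ) :
    coeff (k :: ks) n = (∑ m ∈ Finset.range n, coeff ks m) / (n : ℝ) ^ k := rfl

lemma coeff_cons_zero (k : ℕ) (ks : List ℕ) : coeff (k :: ks) 0 = 0 := by
  simp [coeff_cons]

lemma coeff_nonneg (ks : List ℕ) (n : ℕ) : 0 ≤ coeff ks n := by
  induction ks generalizing n with
  | nil => simp only [coeff]; split_ifs <;> norm_num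
  | cons k ks ih => exact div_nonneg (Finset.sum_nonneg fun m _ => ih m) (by positivity)

lemma coeff_le_pow (ks : List ℕ) (n : ℕ) : coeff ks n ≤ (n : ℝ) ^ ks.length := by
  induction ks generalizing n with
  | nil => simp only [coeff]; split_ifs <;> simp
  | cons k ks ih =>
    rcases Nat.eq_zero_or_pos n with rfl | hn
    · simp [coeff_cons]
    · have h1 : (1 : ℝ) ≤ n := by exact_mod_cast hn
      have hs : ∑ m ∈ Finset.range n, coeff ks m ≤ n * (n : ℝ) ^ ks.length := by
        calc ∑ m ∈ Finset.range n, coeff ks m ≤ ∑ m ∈ Finset.range n, (n : ℝ) ^ ks.length := by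
              refine Finset.sum_le_sum fun m hm => (ih m).trans ?_
              have : m ≤ n := (Finset.mem_range.1 hm).le
              gcongr
          _ = _ := by simp
      rw [coeff_cons, List.length_cons, pow_succ']
      exact (div_le_self (Finset.sum_nonneg fun m _ => coeff_nonneg ks m)
        (one_le_pow₀ h1)).trans hs

lemma summable_coeff_mul_pow (ks : List ℕ) {x : ℝ} (hx : |x| < 1) :
    Summable fun n => coeff ks n * x ^ n := by
  have h := summable_pow_mul_geometric_of_norm_lt_one (R := ℝ) ks.length (r := |x|) (by simpa)
  refine h.of_norm_bounded fun n => ?_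
  rw [norm_mul, norm_pow, Real.norm_eq_abs, Real.norm_eq_abs, abs_of_nonneg (coeff_nonneg ks n)]
  gcongr
  exact coeff_le_pow ks n

lemma li_nil (x : ℝ) : li [] x = 1 := by
  rw [li, tsum_eq_single 0]
  · simp [coeff]
  · intro n hn; simp [coeff, hn]

lemma li_cons_zero (k : ℕ) (ks : List ℕ) : li (k :: ks) 0 = 0 := by
  rw [li]
  convert tsum_zero with n
  rcases Nat.eq_zero_or_pos n with rfl | hn
  · simp [coeff_cons_zero]
  · simp [hn.ne']

lemma hasDerivAt_li (ks : List ℕ) {x : ℝ} (hx : |x| < 1) :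
    HasDerivAt (li ks) (∑' n : ℕ, coeff ks n * (n * x ^ (n - 1))) x := by
  obtain ⟨r, hxr, hr1⟩ := exists_between hx
  have hr0 : 0 < r := (abs_nonneg x).trans_lt hxr
  have hu : Summable fun n : ℕ => (n : ℝ) ^ ks.length * (n * r ^ (n - 1)) := by
    have h := summable_pow_mul_geometric_of_norm_lt_one (R := ℝ) (ks.length + 1) (r := r)
      (by rwa [Real.norm_eq_abs, abs_of_pos hr0])
    refine (h.mul_left r⁻¹).congr fun n => ?_
    rcases n with _ | n
    · simp
    · rw [Nat.add_sub_cancel, pow_succ r, pow_succ (_ : ℝ) ks.length]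
      field_simp
  refine hasDerivAt_tsum_of_isPreconnected (t := Metric.ball 0 r) (y₀ := x) hu Metric.isOpen_ball
    (convex_ball 0 r).isPreconnected (fun n y _ => (hasDerivAt_pow n y).const_mul _)
    (fun n y hy => ?_) ?_ (summable_coeff_mul_pow ks hx) ?_
  · have hy' : |y| ≤ r := by simpa using (Metric.mem_ball.1 hy).le
    rw [norm_mul, norm_mul, norm_pow, Real.norm_eq_abs, Real.norm_eq_abs, Real.norm_eq_abs,
      abs_of_nonneg (coeff_nonneg ks n), Nat.abs_cast]
    gcongr
    exact coeff_le_pow ks n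
  all_goals simpa using hxr

lemma coeff_cons_succ_mul (k : ℕ) (ks : List ℕ) (n : ℕ) :
    coeff ((k + 1) :: ks) n * n = coeff (k :: ks) n := by
  rcases Nat.eq_zero_or_pos n with rfl | hn
  · simp [coeff_cons]
  · rw [coeff_cons, coeff_cons, pow_succ]
    field_simp

lemma hasDerivAt_li_cons_succ_succ (k : ℕ) (ks : List ℕ) {x : ℝ} (hx0 : 0 < x) (hx1 : x < 1) :
    HasDerivAt (li ((k + 2) :: ks)) (li ((k + 1) :: ks) x / x) x := by
  convert hasDerivAt_li ((k + 2) :: ks) (x := x) (by rwa [abs_of_pos hx0]) using 1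
  rw [li, ← tsum_div_const]
  refine tsum_congr fun n => ?_
  rcases n with _ | n
  · simp [coeff_cons_zero]
  · rw [← mul_assoc, coeff_cons_succ_mul, Nat.add_sub_cancel, pow_succ]
    field_simp

lemma summable_sum_range_coeff_mul_pow (ks : List ℕ) {x : ℝ} (hx : |x| < 1) :
    Summable fun n : ℕ => (∑ m ∈ Finset.range n, coeff ks m) * x ^ n := by
  simpa [coeff_cons] using summable_coeff_mul_pow (0 :: ks) hx

/-- Multiplying by `1 - x` undoes the passage to partial sums of the coefficients. -/
lemma one_sub_mul_tsum_sum_range (ks : List ℕ) {x : ℝ} (hx : |x| < 1) :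
    (1 - x) * ∑' n : ℕ, (∑ m ∈ Finset.range (n + 1), coeff ks m) * x ^ n = li ks x := by
  have hs : Summable fun n : ℕ => (∑ m ∈ Finset.range (n + 1), coeff ks m) * x ^ n := by
    refine ((summable_sum_range_coeff_mul_pow ks hx).add (summable_coeff_mul_pow ks hx)).congr
      fun n => ?_
    rw [Finset.sum_range_succ]; ring
  have h1 : x * ∑' n : ℕ, (∑ m ∈ Finset.range (n + 1), coeff ks m) * x ^ n =
      ∑' n : ℕ, (∑ m ∈ Finset.range n, coeff ks m) * x ^ n := by
    rw [(summable_sum_range_coeff_mul_pow ks hx).tsum_eq_zero_add, ← tsum_mul_left]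
    simp only [Finset.range_zero, Finset.sum_empty, zero_mul, zero_add]
    exact tsum_congr fun n => by ring
  rw [sub_mul, one_mul, h1, ← hs.tsum_sub (summable_sum_range_coeff_mul_pow ks hx), li]
  refine tsum_congr fun n => ?_
  rw [Finset.sum_range_succ]; ring

lemma hasDerivAt_li_one_cons (ks : List ℕ) {x : ℝ} (hx0 : 0 < x) (hx1 : x < 1) :
    HasDerivAt (li (1 :: ks)) (li ks x / (1 - x)) x := by
  have hx : |x| < 1 := by rwa [abs_of_pos hx0]
  convert hasDerivAt_li (1 :: ks) hx using 1
  rw [← one_sub_mul_tsum_sum_range ks hx, mul_div_cancel_left₀ _ (by linarith)]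
  have hs : Summable fun n : ℕ => coeff (1 :: ks) n * (n * x ^ (n - 1)) := by
    refine ((summable_sum_range_coeff_mul_pow ks hx).mul_left x⁻¹).congr fun n => ?_
    rcases n with _ | n
    · simp
    · rw [← mul_assoc (coeff _ _), coeff_cons_succ_mul, coeff_cons, Nat.add_sub_cancel, pow_succ]
      field_simp
  rw [hs.tsum_eq_zero_add]
  simp only [CharP.cast_eq_zero, zero_mul, mul_zero, zero_add]
  refine tsum_congr fun n => ?_
  rw [← mul_assoc (coeff _ _), coeff_cons_succ_mul, coeff_cons]
  simp

/-- Fubini for nonnegative double series. -/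
lemma hasSum_prod_of_nonneg {α β : Type*} {f : α × β → ℝ} {g : α → ℝ} {a : ℝ} (hf : 0 ≤ f)
    (hg : ∀ x, HasSum (fun y => f (x, y)) (g x)) (ha : HasSum g a) : HasSum f a := by
  have hs : Summable f := by
    rw [summable_prod_of_nonneg hf]
    refine ⟨fun x => (hg x).summable, ?_⟩
    simpa only [fun x => (hg x).tsum_eq] using ha.summable
  rw [ha.unique (hs.hasSum.prod_fiberwise hg)]
  exact hs.hasSum

lemma zetaTerm_nonneg (ks : List ℕ) (m : Fin ks.length → ℕ) : 0 ≤ zetaTerm ks m := by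
  unfold zetaTerm
  split_ifs
  · positivity
  · exact le_rfl

lemma zetaTerm_cons (k : ℕ) (ks : List ℕ) {n : ℕ} (hn : 0 < n) (m : Fin ks.length → ℕ) :
    zetaTerm (k :: ks) (Fin.cons n m : Fin (ks.length + 1) → ℕ) =
      (if ∀ i, m i < n then zetaTerm ks m else 0) / (n : ℝ) ^ k := by
  have hiff : ((∀ i, 0 < (Fin.cons n m : Fin (ks.length + 1) → ℕ) i) ∧
      (∀ i j, i < j → (Fin.cons n m : Fin (ks.length + 1) → ℕ) j <
        (Fin.cons n m : Fin (ks.length + 1) → ℕ) i)) ↔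
      (∀ i, m i < n) ∧ (∀ i, 0 < m i) ∧ (∀ i j, i < j → m j < m i) := by
    simp only [Fin.forall_fin_succ, Fin.cons_zero, Fin.cons_succ, Fin.succ_lt_succ_iff,
      Fin.succ_pos, Fin.not_lt_zero, false_imp_iff, true_imp_iff, true_and, hn]
    tauto
  have hprod : ∏ i, ((Fin.cons n m : Fin (ks.length + 1) → ℕ) i : ℝ) ^ (k :: ks).get i =
      (n : ℝ) ^ k * ∏ i, (m i : ℝ) ^ ks.get i := by
    erw [Fin.prod_univ_succ]
    simp
  unfold zetaTerm
  erw [if_congr hiff rfl rfl]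
  rw [ite_and]
  split_ifs
  · erw [hprod]; rw [div_div, mul_comm]
  all_goals simp

lemma zetaTerm_cons_zero (k : ℕ) (ks : List ℕ) (m : Fin ks.length → ℕ) :
    zetaTerm (k :: ks) (Fin.cons 0 m : Fin (ks.length + 1) → ℕ) = 0 := by
  unfold zetaTerm
  rw [if_neg]
  rintro ⟨h, -⟩
  exact lt_irrefl 0 (h ⟨0, Nat.succ_pos _⟩)

lemma hasSum_zetaTerm_cons_fiber {k : ℕ} {ks : List ℕ}
    (h : ∀ n, 0 < n → HasSum (fun m => if ∀ i, m i < n then zetaTerm ks m else 0)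
      (∑ j ∈ Finset.range n, coeff ks j)) (n : ℕ) :
    HasSum (fun m => zetaTerm (k :: ks) (Fin.cons n m : Fin (ks.length + 1) → ℕ))
      (coeff (k :: ks) n) := by
  rcases Nat.eq_zero_or_pos n with rfl | hn
  · simpa only [zetaTerm_cons_zero, coeff_cons_zero] using hasSum_zero
  · simp only [zetaTerm_cons k ks hn]
    exact (h n hn).div_const _

lemma hasSum_zetaTerm_lt (ks : List ℕ) : ∀ n, 0 < n →
    HasSum (fun m => if ∀ i, m i < n then zetaTerm ks m else 0)
      (∑ j ∈ Finset.range n, coeff ks j) := by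
  induction ks with
  | nil =>
    intro n hn
    have : ∑ j ∈ Finset.range n, coeff [] j = 1 := by simp [coeff, hn.ne']
    rw [this]
    have h1 : ∀ m : Fin 0 → ℕ, (if ∀ i, m i < n then zetaTerm [] m else 0) = 1 := by
      intro m
      rw [if_pos fun i => i.elim0, zetaTerm, if_pos ⟨fun i => i.elim0, fun i => i.elim0⟩]
      simp
    have h2 := hasSum_unique fun m : Fin 0 → ℕ => if ∀ i, m i < n then zetaTerm [] m else 0
    rwa [h1] at h2
  | cons k ks ih =>
    intro n hn
    refine (Fin.consEquiv fun _ : Fin (ks.length + 1) => ℕ).hasSum_iff.1 ?_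
    refine hasSum_prod_of_nonneg (g := fun j => if j < n then coeff (k :: ks) j else 0) ?_ ?_ ?_
    · intro p
      dsimp only [Function.comp]
      split_ifs
      exacts [zetaTerm_nonneg _ _, le_rfl]
    · intro j
      have key : ∀ m : Fin ks.length → ℕ, ((if ∀ i, (Fin.cons j m : Fin (ks.length + 1) → ℕ) i < n
          then zetaTerm (k :: ks) (Fin.cons j m : Fin (ks.length + 1) → ℕ) else 0)) =
          if j < n then zetaTerm (k :: ks) (Fin.cons j m : Fin (ks.length + 1) → ℕ) else 0 := by
        intro m
        by_cases hj : j < n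
        · rw [if_pos hj]
          split_ifs with hm
          · rfl
          · rcases Nat.eq_zero_or_pos j with rfl | hj0
            · rw [zetaTerm_cons_zero]
            · rw [zetaTerm_cons k ks hj0, if_neg, zero_div]
              intro h
              exact hm (Fin.forall_fin_succ.2 ⟨by simpa using hj, fun i => by
                simpa using (h i).trans hj⟩)
        · rw [if_neg hj, if_neg]
          intro h
          exact hj (by simpa using h 0)
      change HasSum (fun m : Fin ks.length → ℕ =>
        (if ∀ i, (Fin.cons j m : Fin (ks.length + 1) → ℕ) i < n
          then zetaTerm (k :: ks) (Fin.cons j m : Fin (ks.length + 1) → ℕ) else 0)) _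
      simp only [key]
      by_cases hj : j < n
      · simpa only [if_pos hj] using hasSum_zetaTerm_cons_fiber ih j
      · simpa only [if_neg hj] using hasSum_zero
    · rw [← Finset.sum_congr rfl fun j hj => if_pos (Finset.mem_range.1 hj)]
      exact hasSum_sum_of_ne_finset_zero fun j hj => if_neg (by simpa using hj)

lemma hasSum_zetaTerm_mul_pow (k : ℕ) (ks : List ℕ) {x : ℝ} (hx : 0 ≤ x)
    (hs : Summable fun n => coeff (k :: ks) n * x ^ n) :
    HasSum (fun m : Fin (ks.length + 1) → ℕ => zetaTerm (k :: ks) m * x ^ m 0)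
      (li (k :: ks) x) := by
  rw [← (Fin.consEquiv fun _ : Fin (ks.length + 1) => ℕ).hasSum_iff]
  refine hasSum_prod_of_nonneg (fun p => ?_) (fun n => ?_) hs.hasSum
  · exact mul_nonneg (zetaTerm_nonneg _ _) (by positivity)
  · exact (hasSum_zetaTerm_cons_fiber (hasSum_zetaTerm_lt ks) n).mul_right _

lemma MPL_cons_ofReal (k : ℕ) (ks : List ℕ) {x : ℝ} (hx0 : 0 < x) (hx1 : x < 1) :
    MPL (k :: ks) x = (li (k :: ks) x : ℝ) := by
  rw [← (hasSum_zetaTerm_mul_pow k ks hx0.le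
    (summable_coeff_mul_pow _ (by rwa [abs_of_pos hx0]))).tsum_eq, Complex.ofReal_tsum, MPL]
  refine tsum_congr fun m => ?_
  unfold zetaTerm
  split_ifs with h1 h2
  · push_cast
    rw [one_div, div_eq_mul_inv, mul_comm]
    rfl
  · exact absurd (Nat.succ_pos _) h2
  · simp

lemma mzv_cons_eq_li_one (k : ℕ) (ks : List ℕ) (hs : Summable (coeff (k :: ks))) :
    mzv (k :: ks) = li (k :: ks) 1 := by
  rw [← (hasSum_zetaTerm_mul_pow k ks zero_le_one (by simpa using hs)).tsum_eq, mzv]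
  exact tsum_congr fun m => by simp [zetaTerm]

lemma tendsto_coeff_cons_atTop (k : ℕ) (ks : List ℕ) (hks : ∀ j ∈ ks, j ≠ 0) :
    Tendsto (coeff ((k + 1) :: ks)) atTop (𝓝 0) := by
  have h1 : ∀ ls : List ℕ, Tendsto (coeff ls) atTop (𝓝 0) →
      Tendsto (coeff ((k + 1) :: ls)) atTop (𝓝 0) := by
    intro ls h
    refine squeeze_zero (fun n => coeff_nonneg _ n) (fun n => ?_) h.cesaro
    rcases Nat.eq_zero_or_pos n with rfl | hn
    · simp [coeff_cons]
    · have hn1 : (1 : ℝ) ≤ n := by exact_mod_cast hn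
      rw [coeff_cons, div_eq_inv_mul]
      refine mul_le_mul_of_nonneg_right ?_ (Finset.sum_nonneg fun m _ => coeff_nonneg ls m)
      gcongr
      exact le_self_pow₀ hn1 (Nat.succ_ne_zero k)
  refine h1 ks ?_
  clear h1
  induction ks generalizing k with
  | nil =>
    refine tendsto_const_nhds.congr' ?_
    filter_upwards [eventually_ne_atTop 0] with n hn
    simp [coeff, hn]
  | cons j ks ih =>
    have ihk := ih k fun i hi => hks i (List.mem_cons_of_mem _ hi)
    refine squeeze_zero (fun n => coeff_nonneg _ n) (fun n => ?_) ihk.cesaro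
    rcases Nat.eq_zero_or_pos n with rfl | hn
    · simp [coeff_cons]
    · have hn1 : (1 : ℝ) ≤ n := by exact_mod_cast hn
      rw [coeff_cons, div_eq_inv_mul]
      refine mul_le_mul_of_nonneg_right ?_ (Finset.sum_nonneg fun m _ => coeff_nonneg ks m)
      gcongr
      exact le_self_pow₀ hn1 (hks j List.mem_cons_self)

lemma eventually_mem_Ioo_nhdsLT_one : ∀ᶠ x : ℝ in 𝓝[<] 1, x ∈ Set.Ioo (0 : ℝ) 1 :=
  Ioo_mem_nhdsLT one_pos

lemma tendsto_one_sub_mul_li (ks : List ℕ) (hks : ∀ j ∈ ks, j ≠ 0) (hne : ks ≠ []) :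
    Tendsto (fun x => (1 - x) * li ks x) (𝓝[<] 1) (𝓝 0) := by
  obtain ⟨k, ls, rfl⟩ := List.exists_cons_of_ne_nil hne
  obtain ⟨k, rfl⟩ := Nat.exists_eq_succ_of_ne_zero (hks k List.mem_cons_self)
  have hc := tendsto_coeff_cons_atTop k ls fun j hj => hks j (List.mem_cons_of_mem _ hj)
  set a := coeff ((k + 1) :: ls) with ha
  have ht : Tendsto (fun n => ∑ i ∈ Finset.range n, (a (i + 1) - a i)) atTop (𝓝 0) := by
    simpa only [Finset.sum_range_sub, ha, coeff_cons_zero, sub_zero] using hc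
  have hx : Tendsto (fun x : ℝ => x) (𝓝[<] 1) (𝓝 1) := tendsto_id.mono_left nhdsWithin_le_nhds
  have := hx.mul (Real.tendsto_tsum_powerSeries_nhdsWithin_lt ht)
  rw [mul_zero] at this
  refine this.congr' ?_
  filter_upwards [eventually_mem_Ioo_nhdsLT_one] with x hx
  have hx' : |x| < 1 := by rw [abs_of_pos hx.1]; exact hx.2
  have hs := summable_coeff_mul_pow ((k + 1) :: ls) hx'
  have hs' := (summable_nat_add_iff 1).2 hs
  have h1 : ∑' n, a (n + 1) * x ^ (n + 1) = li ((k + 1) :: ls) x := by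
    rw [li, hs.tsum_eq_zero_add, coeff_cons_zero]
    simp [ha]
  have h2 : x * li ((k + 1) :: ls) x = ∑' n, x * (a n * x ^ n) := by
    rw [li, tsum_mul_left]
  rw [Nat.succ_eq_add_one, sub_mul, one_mul, h2, ← h1, ← tsum_mul_left,
    ← hs'.tsum_sub (hs.mul_left x)]
  exact tsum_congr fun n => by simp only [ha]; ring

lemma tendsto_li_mul_li_one_sub (ks ls : List ℕ) (hks : ∀ j ∈ ks, j ≠ 0) (hne : ks ≠ [])
    (hls : ls ≠ []) : Tendsto (fun x => li ks x * li ls (1 - x)) (𝓝[<] 1) (𝓝 0) := by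
  obtain ⟨l, ls, rfl⟩ := List.exists_cons_of_ne_nil hls
  have hd := (hasDerivAt_li (l :: ls) (x := 0) (by simp)).tendsto_slope
  have hx : Tendsto (fun x : ℝ => 1 - x) (𝓝[<] 1) (𝓝[≠] 0) := by
    refine tendsto_nhdsWithin_iff.2 ⟨?_, ?_⟩
    · refine Tendsto.mono_left ?_ nhdsWithin_le_nhds
      exact (continuous_const.sub continuous_id).tendsto' 1 0 (by simp)
    · filter_upwards [self_mem_nhdsWithin] with x hx
      exact (sub_pos.2 hx).ne'
  have := (tendsto_one_sub_mul_li ks hks hne).mul (hd.comp hx)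
  rw [zero_mul] at this
  refine this.congr' ?_
  filter_upwards [self_mem_nhdsWithin] with x hx
  have hx0 : (1 - x) ≠ 0 := (sub_pos.2 hx).ne'
  simp only [Function.comp, slope_def_field, li_cons_zero]
  field_simp
  ring

lemma tendsto_li_nhdsLT_one (ks : List ℕ) (hs : Summable (coeff ks)) :
    Tendsto (li ks) (𝓝[<] 1) (𝓝 (∑' n, coeff ks n)) :=
  Real.tendsto_tsum_powerSeries_nhdsWithin_lt hs.hasSum.tendsto_sum_nat

lemma tendsto_li_cons_one_sub (k : ℕ) (ks : List ℕ) :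
    Tendsto (fun x => li (k :: ks) (1 - x)) (𝓝[<] 1) (𝓝 0) := by
  have h : ContinuousAt (li (k :: ks)) 0 := (hasDerivAt_li _ (by simp)).continuousAt
  have h0 : Tendsto (li (k :: ks)) (𝓝 0) (𝓝 0) := by simpa [ContinuousAt, li_cons_zero] using h
  refine (h0.comp ?_).mono_left nhdsWithin_le_nhds
  exact (continuous_const.sub continuous_id).tendsto' 1 0 (by simp)

/-- The left-hand side of the functional equation, with `K = k - 1`. -/
noncomputable def relationSum (K : ℕ) (x : ℝ) : ℝ :=
  li [K + 2, 1] x + li (3 :: List.replicate K 1) (1 - x) +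
    li [1] x * li (2 :: List.replicate K 1) (1 - x) +
    ∑ j ∈ Finset.range (K + 1), li [j + 1, 1] x * li (List.replicate (K + 1 - j) 1) (1 - x)

lemma hasDerivAt_li_one_sub_replicate (n : ℕ) {x : ℝ} (hx0 : 0 < x) (hx1 : x < 1) :
    HasDerivAt (fun x => li (List.replicate (n + 1) 1) (1 - x))
      (-(li (List.replicate n 1) (1 - x) / x)) x := by
  have h := hasDerivAt_li_one_cons (List.replicate n 1) (x := 1 - x) (by linarith) (by linarith)
  rw [sub_sub_cancel] at h
  exact h.comp_const_sub 1 x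

lemma hasDerivAt_relationSum (K : ℕ) {x : ℝ} (hx0 : 0 < x) (hx1 : x < 1) :
    HasDerivAt (relationSum K) 0 x := by
  have hy0 : 0 < 1 - x := by linarith
  have hy1 : 1 - x < 1 := by linarith
  have hA := hasDerivAt_li_cons_succ_succ K [1] hx0 hx1
  have hB := (hasDerivAt_li_cons_succ_succ 1 (List.replicate K 1) hy0 hy1).comp_const_sub 1 x
  have hC := (hasDerivAt_li_one_cons [] hx0 hx1).mul
    ((hasDerivAt_li_cons_succ_succ 0 (List.replicate K 1) hy0 hy1).comp_const_sub 1 x)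
  let d : ℕ → ℝ := fun j => Nat.casesOn j (li [1] x / (1 - x)) fun i => li [i + 1, 1] x / x
  have hd_zero : d 0 = li [1] x / (1 - x) := rfl
  have hd_succ : ∀ i, d (i + 1) = li [i + 1, 1] x / x := fun _ => rfl
  have hd : ∀ j, HasDerivAt (li [j + 1, 1]) (d j) x := by
    intro j
    rcases j with _ | j
    · exact hasDerivAt_li_one_cons [1] hx0 hx1
    · exact hasDerivAt_li_cons_succ_succ j [1] hx0 hx1
  have hP : ∀ j ∈ Finset.range (K + 1),
      HasDerivAt (fun x => li (List.replicate (K + 1 - j) 1) (1 - x))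
        (-(li (List.replicate (K - j) 1) (1 - x) / x)) x := by
    intro j hj
    rw [Nat.sub_add_comm (Nat.lt_succ_iff.1 (Finset.mem_range.1 hj))]
    exact hasDerivAt_li_one_sub_replicate (K - j) hx0 hx1
  have hD := HasDerivAt.fun_sum fun j hj => (hd j).mul (hP j hj)
  refine (((hA.add hB).add hC).add hD).congr_deriv ?_
  rw [Finset.sum_add_distrib, Finset.sum_range_succ', Finset.sum_range_succ]
  simp only [hd_zero, hd_succ, li_nil, Nat.sub_self, List.replicate_zero, Nat.sub_zero,
    List.replicate_succ, Nat.add_sub_add_right, zero_add]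
  rw [add_assoc (∑ _ ∈ _, _), ← sub_eq_zero]
  have : ∑ j ∈ Finset.range K, li [j + 1, 1] x / x * li (List.replicate (K - j) 1) (1 - x) +
      ∑ j ∈ Finset.range K, li [j + 1, 1] x * -(li (List.replicate (K - j) 1) (1 - x) / x) = 0 := by
    rw [← Finset.sum_add_distrib]
    exact Finset.sum_eq_zero fun j _ => by ring
  simp only [mul_neg, Finset.sum_neg_distrib, Nat.reduceAdd] at this ⊢
  linear_combination this

lemma relationSum_eq (K : ℕ) {x : ℝ} (hx0 : 0 < x) (hx1 : x < 1)
    (hs : Summable (coeff [K + 2, 1])) : relationSum K x = ∑' n, coeff [K + 2, 1] n := by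
  have hconst : ∀ y ∈ Set.Ioo (0 : ℝ) 1, relationSum K x = relationSum K y := by
    intro y hy
    exact isOpen_Ioo.is_const_of_deriv_eq_zero isPreconnected_Ioo
      (fun t ht => (hasDerivAt_relationSum K ht.1 ht.2).differentiableAt.differentiableWithinAt)
      (fun t ht => (hasDerivAt_relationSum K ht.1 ht.2).deriv) ⟨hx0, hx1⟩ hy
  have h1 : Tendsto (relationSum K) (𝓝[<] 1) (𝓝 (relationSum K x)) := by
    refine tendsto_const_nhds.congr' ?_
    filter_upwards [eventually_mem_Ioo_nhdsLT_one] with y hy using hconst y hy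
  have h2 : Tendsto (relationSum K) (𝓝[<] 1) (𝓝 (∑' n, coeff [K + 2, 1] n + 0 + 0 +
      ∑ j ∈ Finset.range (K + 1), 0)) := by
    refine (((tendsto_li_nhdsLT_one _ hs).add (tendsto_li_cons_one_sub _ _)).add
      (tendsto_li_mul_li_one_sub _ _ (by simp) (by simp) (by simp))).add
      (tendsto_finsetSum _ fun j hj => tendsto_li_mul_li_one_sub _ _ (by simp) (by simp) ?_)
    have := Finset.mem_range.1 hj
    simp [List.replicate_eq_nil_iff]
    omega
  simpa using tendsto_nhds_unique h1 h2

/-- The harmonic numbers as real numbers. -/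
noncomputable def harm (n : ℕ) : ℝ := ∑ i ∈ Finset.range n, 1 / ((i : ℝ) + 1)

lemma harm_succ (n : ℕ) : harm (n + 1) = harm n + 1 / ((n : ℝ) + 1) :=
  Finset.sum_range_succ _ _

/-- Telescoping: `∑ (1/(q+1) - 1/(q+1+c)) = H_c`. -/
lemma hasSum_inv_sub_inv (c : ℕ) :
    HasSum (fun q : ℕ => 1 / ((q : ℝ) + 1) - 1 / ((q : ℝ) + 1 + c)) (harm c) := by
  induction c with
  | zero => simp [harm, hasSum_zero]
  | succ c ih =>
    have h : HasSum (fun q : ℕ => 1 / ((q : ℝ) + 1 + c) - 1 / ((q : ℝ) + 2 + c))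
        (1 / ((c : ℝ) + 1)) := by
      rw [hasSum_iff_tendsto_nat_of_nonneg]
      · have key : ∀ n : ℕ, ∑ q ∈ Finset.range n,
            (1 / ((q : ℝ) + 1 + c) - 1 / ((q : ℝ) + 2 + c)) =
            1 / ((c : ℝ) + 1) - 1 / (((n + c : ℕ) : ℝ) + 1) := by
          intro n
          induction n with
          | zero => simp
          | succ n ihn =>
            rw [Finset.sum_range_succ, ihn]
            push_cast
            ring_nf
        simp only [key]
        have h0 := (tendsto_one_div_add_atTop_nhds_zero_nat (𝕜 := ℝ)).comp (tendsto_add_atTop_nat c)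
        simpa using h0.const_sub (1 / ((c : ℝ) + 1))
      · intro q
        rw [sub_nonneg]
        gcongr
        norm_num
    rw [harm_succ]
    refine (ih.add h).congr_fun fun q => ?_
    push_cast
    ring

lemma hasSum_one_div_mul (p : ℕ) :
    HasSum (fun q : ℕ => 1 / (((p : ℝ) + q + 2) * (q + 1))) (harm (p + 1) / (p + 1)) := by
  refine ((hasSum_inv_sub_inv (p + 1)).div_const ((p : ℝ) + 1)).congr_fun fun q => ?_
  push_cast
  have : (p : ℝ) + q + 2 ≠ 0 := by positivity
  have : (q : ℝ) + 1 + (p + 1) ≠ 0 := by positivity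
  field_simp
  ring

lemma sum_range_inv_pow_mul_inv_pow (K : ℕ) {a b : ℝ} (ha : a ≠ 0) (hb : b ≠ 0) (hab : a - b ≠ 0) :
    ∑ j ∈ Finset.range K, 1 / a ^ (j + 2) * (1 / b ^ (K + 1 - j)) =
      1 / (a * b ^ (K + 1) * (a - b)) - 1 / (a ^ (K + 1) * b * (a - b)) := by
  induction K with
  | zero => simp
  | succ K ih =>
    have h : ∑ j ∈ Finset.range K, 1 / a ^ (j + 2) * (1 / b ^ (K + 1 + 1 - j)) =
        1 / b * ∑ j ∈ Finset.range K, 1 / a ^ (j + 2) * (1 / b ^ (K + 1 - j)) := by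
      rw [Finset.mul_sum]
      refine Finset.sum_congr rfl fun j hj => ?_
      have := Finset.mem_range.1 hj
      rw [show K + 1 + 1 - j = K + 1 - j + 1 by omega, pow_succ (_ : ℝ) (K + 1 - j)]
      field_simp
    rw [Finset.sum_range_succ, h, ih, show K + 1 + 1 - K = 2 by omega]
    field_simp
    ring

/-- The summand `∑ 1/(a^{j+2} b^{K+1-j})` of the products of zeta values, with `a = p.1 + 1`,
`b = p.2 + 1`. -/
noncomputable def eulerTerm (K : ℕ) (p : ℕ × ℕ) : ℝ :=
  ∑ j ∈ Finset.range K, 1 / ((p.1 : ℝ) + 1) ^ (j + 2) * (1 / ((p.2 : ℝ) + 1) ^ (K + 1 - j))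

lemma eulerTerm_swap (K : ℕ) (p : ℕ × ℕ) : eulerTerm K p.swap = eulerTerm K p := by
  unfold eulerTerm
  rw [← Finset.sum_range_reflect]
  refine Finset.sum_congr rfl fun j hj => ?_
  have := Finset.mem_range.1 hj
  rw [show K - 1 - j + 2 = K + 1 - j by omega, show K + 1 - (K - 1 - j) = j + 2 by omega, mul_comm]
  rfl

lemma summable_mordellTerm (K : ℕ) : Summable fun p : ℕ × ℕ =>
    1 / ((p.1 : ℝ) + 1) ^ (K + 1) * (1 / (((p.1 : ℝ) + p.2 + 2) * (p.2 + 1))) := by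
  have h : Summable fun n : ℕ => (((n : ℝ) + 1) ^ (3 / 2 : ℝ))⁻¹ := by
    have := (summable_nat_add_iff 1).2 (Real.summable_nat_rpow_inv (p := 3 / 2).2 (by norm_num))
    simpa using this
  refine (h.mul_of_nonneg h (fun n => by positivity) fun n => by positivity).of_nonneg_of_le
    (fun p => by positivity) fun p => ?_
  have hx : (1 : ℝ) ≤ (p.1 : ℝ) + 1 := by simp
  have hy : (1 : ℝ) ≤ (p.2 : ℝ) + 1 := by simp
  rw [show (p.1 : ℝ) + p.2 + 2 = (p.1 + 1) + (p.2 + 1) by ring]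
  generalize (p.1 : ℝ) + 1 = x at *
  generalize (p.2 : ℝ) + 1 = y at *
  have hx0 : 0 < x := by linarith
  have hy0 : 0 < y := by linarith
  have e : ∀ t : ℝ, 0 < t → t ^ (3 / 2 : ℝ) = t * √t := by
    intro t ht
    rw [show (3 / 2 : ℝ) = 1 + 1 / 2 by norm_num, Real.rpow_add ht, Real.rpow_one,
      Real.sqrt_eq_rpow]
  rw [e x hx0, e y hy0, one_div_mul_one_div, one_div, ← mul_inv]
  have hp : x ≤ x ^ (K + 1) := le_self_pow₀ hx (Nat.succ_ne_zero K)
  have hq : √x * √y ≤ x + y := by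
    nlinarith [sq_nonneg (√x - √y), Real.sq_sqrt hx0.le, Real.sq_sqrt hy0.le]
  refine inv_anti₀ (by positivity) ?_
  calc x * √x * (y * √y) = x * ((√x * √y) * y) := by ring
    _ ≤ x ^ (K + 1) * ((x + y) * y) := by gcongr

/-- A double series is the sum of its diagonal and of the two open half-quadrants. -/
lemma hasSum_diag_add_upper_add_lower {f : ℕ × ℕ → ℝ} {a b c : ℝ}
    (ha : HasSum (fun n => f (n, n)) a) (hb : HasSum (fun p : ℕ × ℕ => f (p.1 + p.2 + 1, p.1)) b)
    (hc : HasSum (fun p : ℕ × ℕ => f (p.1, p.1 + p.2 + 1)) c) : HasSum f (a + (b + c)) := by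
  let e : ℕ ⊕ ((ℕ × ℕ) ⊕ (ℕ × ℕ)) → ℕ × ℕ :=
    Sum.elim (fun n => (n, n))
      (Sum.elim (fun p => (p.1 + p.2 + 1, p.1)) fun p => (p.1, p.1 + p.2 + 1))
  have he : Function.Bijective e := by
    constructor
    · rintro (n | ⟨p, q⟩ | ⟨p, q⟩) (n' | ⟨p', q'⟩ | ⟨p', q'⟩) h <;>
        simp only [e, Sum.elim_inl, Sum.elim_inr, Prod.mk.injEq] at h <;>
        simp only [Sum.inl.injEq, Sum.inr.injEq, Prod.mk.injEq, reduceCtorEq] <;> omega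
    · rintro ⟨x, y⟩
      rcases lt_trichotomy x y with h | rfl | h
      · exact ⟨Sum.inr (Sum.inr (x, y - x - 1)), by simp [e]; omega⟩
      · exact ⟨Sum.inl x, rfl⟩
      · exact ⟨Sum.inr (Sum.inl (y, x - y - 1)), by simp [e]; omega⟩
  rw [← (Equiv.ofBijective e he).hasSum_iff]
  exact HasSum.sum ha (HasSum.sum hb hc)

lemma coeff_singleton (s n : ℕ) : coeff [s] (n + 1) = 1 / ((n : ℝ) + 1) ^ s := by
  simp [coeff]

lemma coeff_pair_one (s n : ℕ) : coeff [s, 1] (n + 1) = harm n / ((n : ℝ) + 1) ^ s := by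
  rw [coeff_cons, Finset.sum_range_succ']
  simp only [coeff_singleton, coeff_cons_zero, add_zero, pow_one]
  push_cast
  rfl

lemma summable_coeff_singleton (s : ℕ) : Summable (coeff [s + 2]) := by
  rw [← summable_nat_add_iff 1]
  simp only [coeff_singleton]
  have := (summable_nat_add_iff 1).2 (Real.summable_one_div_nat_pow (p := s + 2).2 (by omega))
  simpa using this

lemma hasSum_one_div_pow (s : ℕ) :
    HasSum (fun n : ℕ => 1 / ((n : ℝ) + 1) ^ (s + 2)) (mzv [s + 2]) := by
  rw [mzv_cons_eq_li_one _ _ (summable_coeff_singleton s), li]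
  have h := (hasSum_nat_add_iff' 1).2 (summable_coeff_singleton s).hasSum
  simpa [coeff_singleton, coeff_cons_zero] using h

lemma hasSum_harm_succ_div (K : ℕ) :
    HasSum (fun n : ℕ => harm (n + 1) / ((n : ℝ) + 1) ^ (K + 2))
      (∑' p : ℕ × ℕ, 1 / ((p.1 : ℝ) + 1) ^ (K + 1) * (1 / (((p.1 : ℝ) + p.2 + 2) * (p.2 + 1)))) := by
  refine ((summable_mordellTerm K).hasSum.prod_fiberwise fun p =>
    (hasSum_one_div_mul p).mul_left (1 / ((p : ℝ) + 1) ^ (K + 1))).congr_fun fun n => ?_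
  rw [pow_succ _ (K + 1)]
  field_simp

lemma hasSum_harm_div (K : ℕ) :
    HasSum (fun n : ℕ => harm n / ((n : ℝ) + 1) ^ (K + 2))
      (∑' p : ℕ × ℕ, 1 / ((p.1 : ℝ) + 1) ^ (K + 1) * (1 / (((p.1 : ℝ) + p.2 + 2) * (p.2 + 1)))
        - mzv [K + 3]) := by
  refine ((hasSum_harm_succ_div K).sub (hasSum_one_div_pow (K + 1))).congr_fun fun n => ?_
  rw [harm_succ, pow_succ _ (K + 2)]
  field_simp
  ring

lemma hasSum_coeff_pair_one (K : ℕ) :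
    HasSum (coeff [K + 2, 1])
      (∑' p : ℕ × ℕ, 1 / ((p.1 : ℝ) + 1) ^ (K + 1) * (1 / (((p.1 : ℝ) + p.2 + 2) * (p.2 + 1)))
        - mzv [K + 3]) := by
  rw [← hasSum_nat_add_iff' 1]
  simpa [coeff_pair_one, coeff_cons_zero] using hasSum_harm_div K

lemma sum_antidiagonal_one_div_mul (n : ℕ) :
    ∑ p ∈ Finset.HasAntidiagonal.antidiagonal n, 1 / (((p.1 : ℝ) + 1) * (p.2 + 1)) =
      2 * (harm (n + 1) / (n + 2)) := by
  have h1 : ∑ p ∈ Finset.HasAntidiagonal.antidiagonal n, 1 / ((p.1 : ℝ) + 1) = harm (n + 1) :=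
    Finset.Nat.sum_antidiagonal_eq_sum_range_succ (fun i _ => 1 / ((i : ℝ) + 1)) n
  have h2 : ∑ p ∈ Finset.HasAntidiagonal.antidiagonal n, 1 / ((p.2 : ℝ) + 1) = harm (n + 1) := by
    rw [← h1, ← Finset.Nat.sum_antidiagonal_swap]
    rfl
  rw [two_mul, ← add_div]
  nth_rewrite 1 [← h1]
  rw [← h2, ← Finset.sum_add_distrib, Finset.sum_div]
  refine Finset.sum_congr rfl fun p hp => ?_
  have hp' : (p.1 : ℝ) + p.2 = n := by exact_mod_cast Finset.HasAntidiagonal.mem_antidiagonal.1 hp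
  rw [← hp']
  field_simp
  ring

/-- The sum of the coefficients of `Li_{K+2,1}`, that is, `ζ(K+2,1)`. -/
noncomputable def zetaPairOne (K : ℕ) : ℝ := ∑' n, coeff [K + 2, 1] n

lemma hasSum_harm_div_zetaPairOne (K : ℕ) :
    HasSum (fun n : ℕ => harm n / ((n : ℝ) + 1) ^ (K + 2)) (zetaPairOne K) := by
  rw [zetaPairOne, (hasSum_coeff_pair_one K).tsum_eq]
  exact hasSum_harm_div K

lemma hasSum_mordellTerm (K : ℕ) : HasSum (fun p : ℕ × ℕ =>
    1 / ((p.1 : ℝ) + 1) ^ (K + 1) * (1 / (((p.1 : ℝ) + p.2 + 2) * (p.2 + 1))))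
    (zetaPairOne K + mzv [K + 3]) := by
  rw [zetaPairOne, (hasSum_coeff_pair_one K).tsum_eq, sub_add_cancel]
  exact (summable_mordellTerm K).hasSum

lemma hasSum_tornheimTerm (K : ℕ) : HasSum (fun p : ℕ × ℕ =>
    1 / ((p.1 : ℝ) + p.2 + 2) ^ (K + 1) * (1 / (((p.1 : ℝ) + 1) * (p.2 + 1))))
    (2 * zetaPairOne K) := by
  have hs : Summable fun p : ℕ × ℕ =>
      1 / ((p.1 : ℝ) + p.2 + 2) ^ (K + 1) * (1 / (((p.1 : ℝ) + 1) * (p.2 + 1))) := by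
    refine (summable_mordellTerm K).of_nonneg_of_le (fun p => by positivity) fun p => ?_
    rw [one_div_mul_one_div, one_div_mul_one_div, pow_succ, pow_succ]
    refine one_div_le_one_div_of_le (by positivity) ?_
    have h : ((p.1 : ℝ) + 1) ^ K ≤ ((p.1 : ℝ) + p.2 + 2) ^ K := by
      gcongr ?_ ^ K
      linarith [(Nat.cast_nonneg p.2 : (0 : ℝ) ≤ p.2)]
    calc ((p.1 : ℝ) + 1) ^ K * (p.1 + 1) * ((p.1 + p.2 + 2) * (p.2 + 1))
        ≤ ((p.1 : ℝ) + p.2 + 2) ^ K * (p.1 + 1) * ((p.1 + p.2 + 2) * (p.2 + 1)) := by gcongr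
      _ = _ := by ring
  have h1 := (Finset.HasAntidiagonal.sigmaAntidiagonalEquivProd.hasSum_iff.2 hs.hasSum).sigma
    fun n => hasSum_fintype _
  have h2 : HasSum (fun n : ℕ => 2 * (harm (n + 1) / ((n : ℝ) + 2) ^ (K + 2)))
      (2 * zetaPairOne K) := by
    have h := ((hasSum_nat_add_iff' 1).2 (hasSum_harm_div_zetaPairOne K)).mul_left 2
    simp only [Finset.sum_range_one, harm, Finset.range_zero, Finset.sum_empty, zero_div,
      sub_zero] at h
    refine h.congr_fun fun n => ?_
    push_cast
    rw [harm, add_assoc (n : ℝ), one_add_one_eq_two]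
  convert hs.hasSum using 1
  refine h2.unique (h1.congr_fun fun n => ?_)
  simp only [Function.comp]
  rw [Finset.univ_eq_attach]
  change _ = ∑ p ∈ (Finset.HasAntidiagonal.antidiagonal n).attach,
    1 / (((p : ℕ × ℕ).1 : ℝ) + (p : ℕ × ℕ).2 + 2) ^ (K + 1) *
      (1 / ((((p : ℕ × ℕ).1 : ℝ) + 1) * ((p : ℕ × ℕ).2 + 1)))
  rw [Finset.sum_attach (Finset.HasAntidiagonal.antidiagonal n) fun p : ℕ × ℕ =>
    1 / ((p.1 : ℝ) + p.2 + 2) ^ (K + 1) * (1 / (((p.1 : ℝ) + 1) * (p.2 + 1)))]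
  have h3 : ∀ p ∈ Finset.HasAntidiagonal.antidiagonal n,
      1 / ((p.1 : ℝ) + p.2 + 2) ^ (K + 1) * (1 / (((p.1 : ℝ) + 1) * (p.2 + 1))) =
      1 / ((n : ℝ) + 2) ^ (K + 1) * (1 / (((p.1 : ℝ) + 1) * (p.2 + 1))) := by
    intro p hp
    rw [← Finset.HasAntidiagonal.mem_antidiagonal.1 hp]
    push_cast
    rfl
  rw [Finset.sum_congr rfl h3, ← Finset.mul_sum, sum_antidiagonal_one_div_mul, pow_succ _ (K + 1)]
  field_simp

lemma hasSum_eulerTerm_lower (K : ℕ) :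
    HasSum (fun p : ℕ × ℕ => eulerTerm K (p.1 + p.2 + 1, p.1))
      (mzv [K + 3] - zetaPairOne K) := by
  have h := (hasSum_mordellTerm K).sub (hasSum_tornheimTerm K)
  rw [show zetaPairOne K + mzv [K + 3] - 2 * zetaPairOne K = mzv [K + 3] - zetaPairOne K by
    ring] at h
  refine h.congr_fun fun p => ?_
  have hab : ((p.1 + p.2 + 1 : ℕ) : ℝ) + 1 - ((p.1 : ℝ) + 1) = p.2 + 1 := by push_cast; ring
  have ha : ((p.1 + p.2 + 1 : ℕ) : ℝ) + 1 = p.1 + p.2 + 2 := by push_cast; ring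
  rw [eulerTerm, sum_range_inv_pow_mul_inv_pow K (by positivity) (by positivity)
    (by rw [hab]; positivity), hab, ha]
  field_simp

lemma hasSum_eulerTerm_diag (K : ℕ) :
    HasSum (fun n : ℕ => eulerTerm K (n, n)) (K * mzv [K + 3]) := by
  refine ((hasSum_one_div_pow (K + 1)).mul_left (K : ℝ)).congr_fun fun n => ?_
  have h : ∀ j ∈ Finset.range K, 1 / ((n : ℝ) + 1) ^ (j + 2) * (1 / ((n : ℝ) + 1) ^ (K + 1 - j)) =
      1 / ((n : ℝ) + 1) ^ (K + 1 + 2) := by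
    intro j hj
    have := Finset.mem_range.1 hj
    rw [one_div_mul_one_div, ← pow_add]
    congr 2
    omega
  rw [eulerTerm, Finset.sum_congr rfl h]
  simp

lemma hasSum_eulerTerm (K : ℕ) :
    HasSum (eulerTerm K) (∑ j ∈ Finset.range K, mzv [j + 2] * mzv [K + 1 - j]) := by
  have h : ∀ j ∈ Finset.range K, HasSum (fun p : ℕ × ℕ => 1 / ((p.1 : ℝ) + 1) ^ (j + 2) *
      (1 / ((p.2 : ℝ) + 1) ^ (K + 1 - j))) (mzv [j + 2] * mzv [K + 1 - j]) := by
    intro j hj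
    have hj' := Finset.mem_range.1 hj
    obtain ⟨s, hs⟩ : ∃ s, K + 1 - j = s + 2 := ⟨K - 1 - j, by omega⟩
    rw [hs]
    have hsum := (hasSum_one_div_pow j).summable.mul_of_nonneg (hasSum_one_div_pow s).summable
      (fun n => by positivity) fun n => by positivity
    exact (hasSum_one_div_pow j).mul (hasSum_one_div_pow s) hsum
  exact hasSum_sum h

/-- Euler's evaluation of `ζ(K+2,1)`. -/
lemma zetaPairOne_eq (K : ℕ) : zetaPairOne K = ((K : ℝ) + 2) / 2 * mzv [K + 3] -
    1 / 2 * ∑ j ∈ Finset.range K, mzv [j + 2] * mzv [K + 1 - j] := by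
  have h := hasSum_diag_add_upper_add_lower (hasSum_eulerTerm_diag K) (hasSum_eulerTerm_lower K)
    ((hasSum_eulerTerm_lower K).congr_fun fun p => (eulerTerm_swap K _).symm)
  rw [(hasSum_eulerTerm K).unique h]
  ring

end MultiplePolylog

/-- `Li_{k+1,1}(z) + Li_{3,1,…,1}(1−z) + Li_1(z)·Li_{2,1,…,1}(1−z)
  + ∑_{i=1}^{k} Li_{i,1}(z)·Li_{1,…,1}(1−z)
  = ((k+1)/2)·ζ(k+2) − (1/2)·∑_{i=1}^{k−1} ζ(i+1)·ζ(k−i+1)`. -/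
theorem MPL_relation_m0_l2 (z : ℝ) (hz0 : 0 < z) (hz1 : z < 1) (k : ℕ) (hk : 1 ≤ k) :
    MPL [k + 1, 1] (z : ℂ) + MPL (3 :: List.replicate (k - 1) 1) ((1 : ℂ) - z) +
      MPL [1] (z : ℂ) * MPL (2 :: List.replicate (k - 1) 1) ((1 : ℂ) - z) +
      ∑ i ∈ Finset.Icc 1 k,
        MPL [i, 1] (z : ℂ) * MPL (List.replicate (k - i + 1) 1) ((1 : ℂ) - z) =
      (((k : ℝ) + 1) / 2 * mzv [k + 2] -
        1 / 2 * ∑ i ∈ Finset.Icc 1 (k - 1), mzv [i + 1] * mzv [k - i + 1] : ℝ) := by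
  obtain ⟨K, rfl⟩ := Nat.exists_eq_add_of_le' hk
  have hw0 : 0 < 1 - z := by linarith
  have hw1 : 1 - z < 1 := by linarith
  have hw : (1 : ℂ) - z = ((1 - z : ℝ) : ℂ) := by push_cast; rfl
  have hMPL : ∀ n, n ≠ 0 → MPL (List.replicate n 1) ((1 - z : ℝ) : ℂ) =
      (MultiplePolylog.li (List.replicate n 1) (1 - z) : ℝ) := by
    intro n hn
    obtain ⟨n, rfl⟩ := Nat.exists_eq_succ_of_ne_zero hn
    exact MultiplePolylog.MPL_cons_ofReal 1 (List.replicate n 1) hw0 hw1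
  have hIcc : ∀ {M : Type} [AddCommMonoid M] (n : ℕ) (f : ℕ → M),
      ∑ i ∈ Finset.Icc 1 n, f i = ∑ j ∈ Finset.range n, f (j + 1) := by
    intro M _ n f
    rw [Finset.range_eq_Ico, Finset.sum_Ico_add' f 0 n 1]
    rfl
  have hsum : ∑ i ∈ Finset.Icc 1 (K + 1),
      MPL [i, 1] (z : ℂ) * MPL (List.replicate (K + 1 - i + 1) 1) ((1 - z : ℝ) : ℂ) =
      ((∑ j ∈ Finset.range (K + 1), MultiplePolylog.li [j + 1, 1] z *
        MultiplePolylog.li (List.replicate (K + 1 - j) 1) (1 - z) : ℝ) : ℂ) := by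
    rw [hIcc, Complex.ofReal_sum]
    refine Finset.sum_congr rfl fun j hj => ?_
    have hj' := Finset.mem_range.1 hj
    rw [MultiplePolylog.MPL_cons_ofReal _ _ hz0 hz1, show K + 1 - (j + 1) + 1 = K + 1 - j by omega,
      hMPL _ (by omega), Complex.ofReal_mul]
  have hzeta : ∑ i ∈ Finset.Icc 1 K, mzv [i + 1] * mzv [K + 1 - i + 1] =
      ∑ j ∈ Finset.range K, mzv [j + 2] * mzv [K + 1 - j] := by
    rw [hIcc]
    refine Finset.sum_congr rfl fun j hj => ?_
    have hj' := Finset.mem_range.1 hj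
    rw [show K + 1 - (j + 1) + 1 = K + 1 - j by omega]
  have hmain := (MultiplePolylog.relationSum_eq K hz0 hz1
    (MultiplePolylog.hasSum_coeff_pair_one K).summable).trans (MultiplePolylog.zetaPairOne_eq K)
  rw [Nat.add_sub_cancel, hw, hsum, hzeta, MultiplePolylog.MPL_cons_ofReal _ _ hz0 hz1,
    MultiplePolylog.MPL_cons_ofReal _ _ hz0 hz1, MultiplePolylog.MPL_cons_ofReal _ _ hw0 hw1,
    MultiplePolylog.MPL_cons_ofReal _ _ hw0 hw1, ← Complex.ofReal_mul, ← Complex.ofReal_add,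
    ← Complex.ofReal_add, ← Complex.ofReal_add, Complex.ofReal_inj]
  refine hmain.trans ?_
  push_cast
  ring
end

section
/- (Euler's relation.) For every integer k ≥ 1, ζ(k+1, 1) = ((k+1)/2) · ζ(k+2) − (1/2) · ∑_{i=1}^{k−1} ζ(i+1) · ζ(k−i+1). -/
open scoped BigOperators

theorem hasSum_mzv_singleton {s : ℕ} (hs : 2 ≤ s) :
    HasSum (fun n : ℕ => 1 / ((n : ℝ) + 1) ^ s) (mzv [s]) := by
  have hsum : Summable (fun n : ℕ => 1 / ((n : ℝ) + 1) ^ s) := by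
    have h := (summable_nat_add_iff 1).2 (Real.summable_one_div_nat_pow.2 (by omega : 1 < s))
    simpa using h
  convert hsum.hasSum using 1
  have hinj : Function.Injective (fun (n : ℕ) (_ : Fin [s].length) => n + 1) := by
    intro a b h
    have := congrFun h ⟨0, by simp⟩
    simpa using this
  unfold mzv
  rw [← hinj.tsum_eq]
  · refine tsum_congr fun n => ?_
    rw [if_pos ⟨fun _ => Nat.succ_pos n, fun i j hij => by
      have hi := i.2
      have hj := j.2
      rw [Fin.lt_def] at hij
      simp only [List.length_cons, List.length_nil] at hi hj
      omega⟩]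
    simp
  · intro m hm
    have hc : (∀ i, 0 < m i) ∧ (∀ i j, i < j → m j < m i) := by
      by_contra hc
      exact hm (if_neg hc)
    refine ⟨m ⟨0, by simp⟩ - 1, ?_⟩
    funext i
    have hi : i = ⟨0, by simp⟩ := by
      ext
      have := i.2
      simp only [List.length_cons, List.length_nil] at this
      simp only
      omega
    subst hi
    exact Nat.sub_add_cancel (hc.1 _)

theorem hasSum_mzv_mul_mzv {s t : ℕ} (hs : 2 ≤ s) (ht : 2 ≤ t) :
    HasSum (fun p : ℕ × ℕ => 1 / ((p.1 : ℝ) + 1) ^ s * (1 / ((p.2 : ℝ) + 1) ^ t))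
      (mzv [s] * mzv [t]) := by
  have h1 := hasSum_mzv_singleton hs
  have h2 := hasSum_mzv_singleton ht
  exact h1.mul h2 (h1.summable.mul_of_nonneg h2.summable
    (fun n => by positivity) (fun n => by positivity))

theorem summable_one_div_pow_mul_of_lt {s : ℕ} (hs : 2 ≤ s) :
    Summable (fun p : ℕ × ℕ => 1 / (((p.1 : ℝ) + p.2 + 2) ^ s * ((p.1 : ℝ) + 1))) := by
  have h1 : Summable (fun n : ℕ => 1 / ((n : ℝ) + 1) ^ (3 / 2 : ℝ)) := by
    have h := (summable_nat_add_iff 1).2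
      (Real.summable_one_div_nat_rpow.2 (by norm_num : (1 : ℝ) < 3 / 2))
    simpa using h
  refine Summable.of_nonneg_of_le (fun p => by positivity) (fun p => ?_)
    (h1.mul_of_nonneg h1 (fun n => by positivity) (fun n => by positivity))
  obtain ⟨m, d⟩ := p
  simp only
  rw [one_div_mul_one_div_rev]
  have hm : (0 : ℝ) ≤ m := m.cast_nonneg
  have hd : (0 : ℝ) ≤ d := d.cast_nonneg
  apply one_div_le_one_div_of_le (by positivity)
  have e1 : ((m : ℝ) + 1) ^ (3 / 2 : ℝ) = ((m : ℝ) + 1) ^ (1 / 2 : ℝ) * ((m : ℝ) + 1) := by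
    rw [← Real.rpow_add_one (by positivity)]
    norm_num
  have e2 : ((m : ℝ) + d + 2) ^ 2
      = ((m : ℝ) + d + 2) ^ (3 / 2 : ℝ) * ((m : ℝ) + d + 2) ^ (1 / 2 : ℝ) := by
    rw [← Real.rpow_add (by positivity), ← Real.rpow_natCast]
    norm_num
  calc ((d : ℝ) + 1) ^ (3 / 2 : ℝ) * ((m : ℝ) + 1) ^ (3 / 2 : ℝ)
      = ((d : ℝ) + 1) ^ (3 / 2 : ℝ) * ((m : ℝ) + 1) ^ (1 / 2 : ℝ) * ((m : ℝ) + 1) := by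
        rw [e1]; ring
    _ ≤ ((m : ℝ) + d + 2) ^ (3 / 2 : ℝ) * ((m : ℝ) + d + 2) ^ (1 / 2 : ℝ) * ((m : ℝ) + 1) := by
        gcongr <;> linarith
    _ = ((m : ℝ) + d + 2) ^ 2 * ((m : ℝ) + 1) := by rw [e2]
    _ ≤ ((m : ℝ) + d + 2) ^ s * ((m : ℝ) + 1) := by
        gcongr
        linarith
    _ = _ := by ring

theorem hasSum_mzv_pair_one {s : ℕ} (hs : 2 ≤ s) :
    HasSum (fun p : ℕ × ℕ => 1 / (((p.1 : ℝ) + p.2 + 2) ^ s * ((p.1 : ℝ) + 1)))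
      (mzv [s, 1]) := by
  convert (summable_one_div_pow_mul_of_lt hs).hasSum using 1
  have hinj : Function.Injective
      (fun p : ℕ × ℕ => (![p.1 + p.2 + 2, p.1 + 1] : Fin 2 → ℕ)) := by
    rintro ⟨a, b⟩ ⟨c, d⟩ h
    have h0 : a + b + 2 = c + d + 2 := congrFun h (0 : Fin 2)
    have h1 : a + 1 = c + 1 := congrFun h (1 : Fin 2)
    ext <;> simp only <;> omega
  change (∑' m : Fin 2 → ℕ, if (∀ i, 0 < m i) ∧ (∀ i j, i < j → m j < m i) then
    1 / ∏ i : Fin 2, (m i : ℝ) ^ [s, 1].get i else 0) = _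
  rw [← hinj.tsum_eq]
  · refine tsum_congr fun p => ?_
    rw [if_pos, Fin.prod_univ_two]
    · simp
    · simp [Fin.forall_fin_two]
  · intro m hm
    have hc : (∀ i, 0 < m i) ∧ (∀ i j, i < j → m j < m i) := by
      by_contra hc
      exact hm (if_neg hc)
    have h1 := hc.1 (1 : Fin 2)
    have h2 := hc.2 (0 : Fin 2) (1 : Fin 2) (by decide)
    refine ⟨(m (1 : Fin 2) - 1, m (0 : Fin 2) - m (1 : Fin 2) - 1), ?_⟩
    funext i
    fin_cases i
    · change m (1 : Fin 2) - 1 + (m (0 : Fin 2) - m (1 : Fin 2) - 1) + 2 = m (0 : Fin 2)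
      omega
    · change m (1 : Fin 2) - 1 + 1 = m (1 : Fin 2)
      omega

theorem HasSum.prod_of_nonneg {f : ℕ × ℕ → ℝ} {g : ℕ → ℝ} {S : ℝ} (hf : 0 ≤ f)
    (hrow : ∀ m, HasSum (fun d => f (m, d)) (g m)) (hg : HasSum g S) : HasSum f S := by
  have hs : Summable f := (summable_prod_of_nonneg hf).2
    ⟨fun m => (hrow m).summable, by simpa only [(hrow _).tsum_eq] using hg.summable⟩
  have h := hs.hasSum.prod_fiberwise hrow
  rw [← h.unique hg]
  exact hs.hasSum

theorem hasSum_one_div_sub_one_div_add (M : ℕ) :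
    HasSum (fun d : ℕ => 1 / ((d : ℝ) + 1) - 1 / ((d : ℝ) + 1 + M))
      (∑ j ∈ Finset.range M, 1 / ((j : ℝ) + 1)) := by
  induction M with
  | zero => simp
  | succ M ih =>
    rw [Finset.sum_range_succ]
    have h : HasSum (fun d : ℕ => 1 / ((d : ℝ) + 1 + M) - 1 / ((d : ℝ) + 1 + (M + 1 : ℕ)))
        (1 / ((M : ℝ) + 1)) := by
      rw [hasSum_iff_tendsto_nat_of_nonneg]
      · have e : ∀ n : ℕ, ∑ d ∈ Finset.range n,
            (1 / ((d : ℝ) + 1 + M) - 1 / ((d : ℝ) + 1 + (M + 1 : ℕ)))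
            = 1 / ((M : ℝ) + 1) - 1 / ((n + M : ℕ) + 1 : ℝ) := by
          intro n
          have := Finset.sum_range_sub' (fun d : ℕ => 1 / ((d : ℝ) + 1 + M)) n
          convert this using 2
          · push_cast
            ring
          · push_cast
            ring
          · push_cast
            ring
        simp only [e]
        have ht := (Filter.tendsto_add_atTop_iff_nat M).2
          (tendsto_one_div_add_atTop_nhds_zero_nat (𝕜 := ℝ))
        simpa using ht.const_sub (1 / ((M : ℝ) + 1))
      · intro d
        rw [sub_nonneg]
        apply one_div_le_one_div_of_le (by positivity)
        push_cast
        linarith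
    convert ih.add h using 2
    ring

theorem hasSum_harmonic_div_pow {s : ℕ} (hs : 2 ≤ s) :
    HasSum (fun m : ℕ => (∑ j ∈ Finset.range m, 1 / ((j : ℝ) + 1)) / ((m : ℝ) + 1) ^ s)
      (mzv [s, 1]) := by
  rw [← hasSum_nat_add_iff' 1]
  have h := ((Finset.HasAntidiagonal.sigmaAntidiagonalEquivProd (A := ℕ)).hasSum_iff.2
    (hasSum_mzv_pair_one hs)).sigma (fun n => hasSum_fintype _)
  rw [Finset.sum_range_one, Finset.sum_range_zero, zero_div, sub_zero]
  refine HasSum.congr_fun h fun n => ?_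
  change _ = ∑ b : Finset.HasAntidiagonal.antidiagonal n,
    1 / (((b.1.1 : ℝ) + b.1.2 + 2) ^ s * ((b.1.1 : ℝ) + 1))
  rw [Finset.univ_eq_attach, Finset.sum_attach (Finset.HasAntidiagonal.antidiagonal n)
    (fun p : ℕ × ℕ => 1 / (((p.1 : ℝ) + p.2 + 2) ^ s * ((p.1 : ℝ) + 1))),
    Finset.Nat.sum_antidiagonal_eq_sum_range_succ_mk, Finset.sum_div]
  refine Finset.sum_congr rfl fun j hj => ?_
  have hj' : j ≤ n := Nat.lt_succ_iff.1 (Finset.mem_range.1 hj)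
  rw [Nat.cast_sub hj', div_div]
  push_cast
  congr 1
  ring

/-- The sum of `1 / (p ^ k * n * (n - p))` over `n > p ≥ 1`, with `p = m + 1`, `n = m + d + 2`. -/
theorem hasSum_one_div_fst_pow {k : ℕ} (hk : 1 ≤ k) :
    HasSum (fun p : ℕ × ℕ =>
        1 / (((p.1 : ℝ) + 1) ^ k * ((p.1 : ℝ) + p.2 + 2) * ((p.2 : ℝ) + 1)))
      (mzv [k + 1, 1] + mzv [k + 2]) := by
  refine HasSum.prod_of_nonneg
    (g := fun m => (∑ j ∈ Finset.range (m + 1), 1 / ((j : ℝ) + 1)) / ((m : ℝ) + 1) ^ (k + 1))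
    (fun p => by positivity) (fun m => ?_) ?_
  · refine HasSum.congr_fun ((hasSum_one_div_sub_one_div_add (m + 1)).div_const
      (((m : ℝ) + 1) ^ (k + 1))) fun d => ?_
    push_cast
    have : (d : ℝ) + 1 + (m + 1) ≠ 0 := by positivity
    have : (m : ℝ) + d + 2 ≠ 0 := by positivity
    field_simp
    ring
  · refine HasSum.congr_fun ((hasSum_harmonic_div_pow (by omega : 2 ≤ k + 1)).add
      (hasSum_mzv_singleton (by omega : 2 ≤ k + 2))) fun m => ?_
    rw [Finset.sum_range_succ]
    field_simp
    ring

/-- The sum of `1 / (n ^ k * p * (n - p))` over `n > p ≥ 1`, with `p = m + 1`, `n = m + d + 2`. -/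
theorem hasSum_one_div_add_pow {k : ℕ} (hk : 1 ≤ k) :
    HasSum (fun p : ℕ × ℕ =>
        1 / (((p.1 : ℝ) + p.2 + 2) ^ k * ((p.1 : ℝ) + 1) * ((p.2 : ℝ) + 1)))
      (mzv [k + 1, 1] + mzv [k + 1, 1]) := by
  have h := hasSum_mzv_pair_one (by omega : 2 ≤ k + 1)
  refine HasSum.congr_fun (h.add ((Equiv.prodComm ℕ ℕ).hasSum_iff.2 h)) fun p => ?_
  obtain ⟨m, d⟩ := p
  simp only [Function.comp, Equiv.prodComm_apply, Prod.swap]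
  rw [add_comm (d : ℝ) m]
  have : (m : ℝ) + d + 2 ≠ 0 := by positivity
  field_simp
  ring

theorem HasSum.of_diag_of_lt_of_gt {f : ℕ × ℕ → ℝ} {a b c : ℝ}
    (ha : HasSum (fun m => f (m, m)) a)
    (hb : HasSum (fun p : ℕ × ℕ => f (p.1, p.1 + p.2 + 1)) b)
    (hc : HasSum (fun p : ℕ × ℕ => f (p.1 + p.2 + 1, p.1)) c) :
    HasSum f (a + (b + c)) := by
  have i1 : Function.Injective (fun m : ℕ => (m, m)) := fun x y h => congrArg Prod.fst h
  have i2 : Function.Injective (fun p : ℕ × ℕ => (p.1, p.1 + p.2 + 1)) := by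
    rintro ⟨x, y⟩ ⟨z, w⟩ h
    simp only [Prod.mk.injEq] at h ⊢
    omega
  have i3 : Function.Injective (fun p : ℕ × ℕ => (p.1 + p.2 + 1, p.1)) := by
    rintro ⟨x, y⟩ ⟨z, w⟩ h
    simp only [Prod.mk.injEq] at h ⊢
    omega
  have h1 := i1.hasSum_range_iff (f := f).2 ha
  have h2 := i2.hasSum_range_iff (f := f).2 hb
  have h3 := i3.hasSum_range_iff (f := f).2 hc
  have d23 : Disjoint (Set.range fun p : ℕ × ℕ => (p.1, p.1 + p.2 + 1))
      (Set.range fun p : ℕ × ℕ => (p.1 + p.2 + 1, p.1)) := by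
    rw [Set.disjoint_left]
    rintro _ ⟨⟨x, y⟩, rfl⟩ ⟨⟨z, w⟩, h⟩
    simp only [Prod.mk.injEq] at h
    omega
  refine h1.add_isCompl ⟨?_, ?_⟩ (h2.add_disjoint d23 h3)
  · rw [Set.disjoint_left]
    rintro _ ⟨x, rfl⟩ (⟨⟨z, w⟩, h⟩ | ⟨⟨z, w⟩, h⟩) <;>
    · simp only [Prod.mk.injEq] at h
      omega
  · rw [codisjoint_iff_le_sup]
    rintro ⟨x, y⟩ -
    rcases lt_trichotomy x y with h | rfl | h
    · refine Or.inr (Or.inl ⟨(x, y - x - 1), ?_⟩)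
      simp only [Prod.mk.injEq, true_and]
      omega
    · exact Or.inl ⟨x, rfl⟩
    · refine Or.inr (Or.inr ⟨(y, x - y - 1), ?_⟩)
      simp only [Prod.mk.injEq, and_true]
      omega

theorem sum_one_div_pow_mul_pow {x y : ℝ} (hx : 0 < x) (hy : 0 < y) {k : ℕ} (hk : 1 ≤ k) :
    (∑ i ∈ Finset.Icc 1 (k - 1), 1 / x ^ (i + 1) * (1 / (x + y) ^ (k - i + 1)))
      = 1 / (x ^ k * (x + y) * y) - 1 / ((x + y) ^ k * x * y) := by
  induction k, hk using Nat.le_induction with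
  | base =>
    simp
    ring
  | succ k hk ih =>
    obtain ⟨k, rfl⟩ : ∃ l, k = l + 1 := ⟨k - 1, by omega⟩
    have hxy : 0 < x + y := by positivity
    have e : (∑ i ∈ Finset.Icc 1 k, 1 / x ^ (i + 1) * (1 / (x + y) ^ (k + 1 + 1 - i + 1)))
        = (∑ i ∈ Finset.Icc 1 k, 1 / x ^ (i + 1) * (1 / (x + y) ^ (k + 1 - i + 1)))
          * (1 / (x + y)) := by
      rw [Finset.sum_mul]
      refine Finset.sum_congr rfl fun i hi => ?_
      have := (Finset.mem_Icc.1 hi).2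
      rw [show k + 1 + 1 - i + 1 = k + 1 - i + 1 + 1 by omega, pow_succ (x + y)]
      field_simp
    simp only [Nat.add_sub_cancel] at ih ⊢
    rw [Finset.sum_Icc_succ_top (by omega), e, ih, show k + 1 + 1 - (k + 1) + 1 = 2 by omega]
    field_simp
    ring

/-- Euler's relation:
`ζ(k+1,1) = ((k+1)/2)·ζ(k+2) − (1/2)·∑_{i=1}^{k−1} ζ(i+1)·ζ(k−i+1)`. -/
theorem euler_zeta_relation (k : ℕ) (hk : 1 ≤ k) :
    mzv [k + 1, 1] = ((k : ℝ) + 1) / 2 * mzv [k + 2] -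
      1 / 2 * ∑ i ∈ Finset.Icc 1 (k - 1), mzv [i + 1] * mzv [k - i + 1] := by
  set f : ℕ × ℕ → ℝ := fun p => ∑ i ∈ Finset.Icc 1 (k - 1),
    1 / ((p.1 : ℝ) + 1) ^ (i + 1) * (1 / ((p.2 : ℝ) + 1) ^ (k - i + 1)) with hf
  have hprod : HasSum f (∑ i ∈ Finset.Icc 1 (k - 1), mzv [i + 1] * mzv [k - i + 1]) := by
    refine hasSum_sum fun i hi => ?_
    obtain ⟨hi1, hi2⟩ := Finset.mem_Icc.1 hi
    exact hasSum_mzv_mul_mzv (by omega) (by omega)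
  have hdiag : HasSum (fun m => f (m, m)) (((k : ℝ) - 1) * mzv [k + 2]) := by
    refine HasSum.congr_fun ((hasSum_mzv_singleton (by omega : 2 ≤ k + 2)).mul_left
      ((k : ℝ) - 1)) fun m => ?_
    simp only [hf]
    rw [Finset.sum_congr rfl (g := fun _ => 1 / ((m : ℝ) + 1) ^ (k + 2))]
    · simp [Nat.cast_sub hk]
    · intro i hi
      obtain ⟨hi1, hi2⟩ := Finset.mem_Icc.1 hi
      rw [one_div_mul_one_div_rev, ← pow_add]
      congr 2
      omega
  have hlt : HasSum (fun p : ℕ × ℕ => f (p.1, p.1 + p.2 + 1))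
      (mzv [k + 1, 1] + mzv [k + 2] - (mzv [k + 1, 1] + mzv [k + 1, 1])) := by
    refine HasSum.congr_fun ((hasSum_one_div_fst_pow hk).sub
      (hasSum_one_div_add_pow hk)) fun p => ?_
    have h := sum_one_div_pow_mul_pow (x := (p.1 : ℝ) + 1) (y := (p.2 : ℝ) + 1)
      (by positivity) (by positivity) hk
    rw [show (p.1 : ℝ) + 1 + (p.2 + 1) = p.1 + p.2 + 2 by ring] at h
    rw [← h]
    simp only [hf]
    push_cast
    refine Finset.sum_congr rfl fun i _ => ?_
    congr 3
    ring
  have hgt : HasSum (fun p : ℕ × ℕ => f (p.1 + p.2 + 1, p.1))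
      (mzv [k + 1, 1] + mzv [k + 2] - (mzv [k + 1, 1] + mzv [k + 1, 1])) := by
    refine HasSum.congr_fun hlt fun p => ?_
    simp only [hf]
    refine Finset.sum_nbij' (fun i => k - i) (fun i => k - i) ?_ ?_ ?_ ?_ ?_
    · simp only [Finset.mem_Icc]; omega
    · simp only [Finset.mem_Icc]; omega
    · simp only [Finset.mem_Icc]; omega
    · simp only [Finset.mem_Icc]; omega
    · intro i hi
      obtain ⟨hi1, hi2⟩ := Finset.mem_Icc.1 hi
      rw [show k - (k - i) = i by omega, mul_comm]
  have := hprod.unique (HasSum.of_diag_of_lt_of_gt hdiag hlt hgt)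
  rw [this]
  ring
end
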